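/- arXiv:math/9208201 — 2 statements merged into one kernel-verified Lean document; each statement's English description precedes it below -/
import Mathlib

section
/- Let X be a Banach space of type 2. Then there exists C>0 such that for every ℓ∈ℕ and all y_1,…,y_ℓ∈X, ∫_0^1 ‖∑_{k=1}^ℓ r_k(t) y_k‖² dt ≤ C·∫_0^1 ‖∑_{k=1}^ℓ h̃_k(t) y_k‖² dt, where (h̃_k) is the L²-normalized Haar system. -/
open MeasureTheory Set Filter

/-- The Haar system `(h_j)_{j ≥ 1}` on `[0,1)`: `h_1 ≡ 1` and, for `j = 2^k + i` with
`k ≥ 0`, `1 ≤ i ≤ 2^k`,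
`h_j = 1_{[(i-1)2^{-k}, (i-1/2)2^{-k})} - 1_{[(i-1/2)2^{-k}, i·2^{-k})}`. -/
noncomputable def haarFn (j : ℕ) (t : ℝ) : ℝ :=
  if j ≤ 1 then (if 0 ≤ t ∧ t < 1 then 1 else 0)
  else
    let k : ℕ := Nat.log 2 (j - 1)
    let i : ℝ := (j : ℝ) - 2 ^ k
    if (i - 1) / 2 ^ k ≤ t ∧ t < (i - 1 / 2) / 2 ^ k then 1
    else if (i - 1 / 2) / 2 ^ k ≤ t ∧ t < i / 2 ^ k then -1
    else 0

/-- The `L²`-normalized Haar system: `h̃_1 = h_1` and `h̃_j = 2^{k/2} h_j` for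
`j = 2^k + i`, `1 ≤ i ≤ 2^k`. -/
noncomputable def haarNFn (j : ℕ) (t : ℝ) : ℝ :=
  if j ≤ 1 then haarFn j t
  else (2 : ℝ) ^ ((Nat.log 2 (j - 1) : ℝ) / 2) * haarFn j t

/-- The Rademacher functions `r_n(t) = sgn (sin (2^n π t))`. -/
noncomputable def rademacherFn (n : ℕ) (t : ℝ) : ℝ :=
  Real.sign (Real.sin (2 ^ n * Real.pi * t))

/-- Dyadic description of the Haar functions through integer parts. -/
theorem haarFn_two_pow_add {k i : ℕ} (hi : i < 2 ^ k) {t : ℝ} (ht : 0 ≤ t) :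
    haarFn (2 ^ k + i + 1) t =
      if ⌊2 ^ k * t⌋₊ = i then (-1) ^ ⌊2 ^ (k + 1) * t⌋₊ else 0 := by
  have hk : 0 < 2 ^ k := by positivity
  have hkr : (0 : ℝ) < 2 ^ k := by positivity
  have hlog : Nat.log 2 (2 ^ k + i + 1 - 1) = k :=
    Nat.log_eq_of_pow_le_of_lt_pow (by omega) (by rw [pow_succ]; omega)
  have hut : 0 ≤ 2 ^ k * t := by positivity
  have hut' : 0 ≤ 2 ^ (k + 1) * t := by positivity
  unfold haarFn
  rw [if_neg (by omega)]
  simp only [hlog]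
  push_cast
  have e1 : (2 : ℝ) ^ k + i + 1 - 2 ^ k - 1 = i := by ring
  have e2 : (2 : ℝ) ^ k + i + 1 - 2 ^ k - 1 / 2 = i + 1 / 2 := by ring
  have e3 : (2 : ℝ) ^ k + i + 1 - 2 ^ k = i + 1 := by ring
  rw [e1, e2, e3]
  simp only [div_le_iff₀ hkr, lt_div_iff₀ hkr, Nat.floor_eq_iff hut]
  have e4 : (2 : ℝ) ^ (k + 1) * t = 2 * (t * 2 ^ k) := by ring
  rw [e4, mul_comm (2 ^ k) t]
  rw [mul_comm (2 ^ k) t] at hut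
  generalize t * 2 ^ k = u at *
  by_cases h1 : (i : ℝ) ≤ u ∧ u < i + 1 / 2
  · have : ⌊2 * u⌋₊ = 2 * i := by
      rw [Nat.floor_eq_iff (by positivity)]; push_cast; constructor <;> linarith
    rw [if_pos h1, if_pos ⟨h1.1, by linarith⟩, this]
    simp
  · rw [if_neg h1]
    by_cases h2 : (i : ℝ) + 1 / 2 ≤ u ∧ u < i + 1
    · have : ⌊2 * u⌋₊ = 2 * i + 1 := by
        rw [Nat.floor_eq_iff (by positivity)]; push_cast; constructor <;> linarith
      rw [if_pos h2, if_pos ⟨by linarith, h2.2⟩, this]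
      simp [pow_succ]
    · rw [if_neg h2, if_neg]
      rintro ⟨h3, h4⟩
      by_cases h5 : u < i + 1 / 2
      · exact h1 ⟨h3, h5⟩
      · exact h2 ⟨not_lt.1 h5, h4⟩

theorem haarNFn_two_pow_add {k i : ℕ} (hi : i < 2 ^ k) {t : ℝ} (ht : 0 ≤ t) :
    haarNFn (2 ^ k + i + 1) t =
      (2 : ℝ) ^ ((k : ℝ) / 2) *
        if ⌊2 ^ k * t⌋₊ = i then (-1) ^ ⌊2 ^ (k + 1) * t⌋₊ else 0 := by
  have hk : 0 < 2 ^ k := by positivity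
  have hlog : Nat.log 2 (2 ^ k + i + 1 - 1) = k :=
    Nat.log_eq_of_pow_le_of_lt_pow (by omega) (by rw [pow_succ]; omega)
  rw [haarNFn, if_neg (by omega), hlog, haarFn_two_pow_add hi ht]

theorem haarNFn_one {t : ℝ} (ht : t ∈ Ico (0 : ℝ) 1) : haarNFn 1 t = 1 := by
  simp [haarNFn, haarFn, ht.1, ht.2]

theorem floor_two_pow_mul_div (k d : ℕ) (t : ℝ) :
    ⌊2 ^ (k + d) * t⌋₊ / 2 ^ d = ⌊2 ^ k * t⌋₊ := by
  rw [← Nat.floor_div_natCast]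
  congr 1
  push_cast
  rw [pow_add]
  field_simp

/-- On `[0,1)` the first `2 ^ n` Haar functions depend only on the dyadic interval of
generation `n`. -/
theorem haarNFn_eq_of_floor_eq {n j : ℕ} (hj : j < 2 ^ n) {s t : ℝ}
    (hs : s ∈ Ico (0 : ℝ) 1) (ht : t ∈ Ico (0 : ℝ) 1)
    (hst : ⌊2 ^ n * s⌋₊ = ⌊2 ^ n * t⌋₊) : haarNFn (j + 1) s = haarNFn (j + 1) t := by
  have hfloor : ∀ k ≤ n, ⌊2 ^ k * s⌋₊ = ⌊2 ^ k * t⌋₊ := by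
    intro k hk
    obtain ⟨d, rfl⟩ := Nat.exists_eq_add_of_le hk
    rw [← floor_two_pow_mul_div k d s, ← floor_two_pow_mul_div k d t, hst]
  rcases Nat.eq_zero_or_pos j with rfl | hpos
  · rw [zero_add, haarNFn_one hs, haarNFn_one ht]
  · have h1 : 2 ^ Nat.log 2 j ≤ j := Nat.pow_log_le_self 2 hpos.ne'
    have h2 : j < 2 ^ (Nat.log 2 j + 1) := Nat.lt_pow_succ_log_self (by norm_num) j
    have h3 : Nat.log 2 j < n := (Nat.pow_lt_pow_iff_right (by norm_num)).1 (h1.trans_lt hj)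
    obtain ⟨i, hi⟩ := Nat.exists_eq_add_of_le h1
    generalize Nat.log 2 j = k at *
    subst hi
    have hik : i < 2 ^ k := by rw [pow_succ] at h2; omega
    rw [haarNFn_two_pow_add hik hs.1, haarNFn_two_pow_add hik ht.1, hfloor k h3.le,
      hfloor (k + 1) h3]

/-- The reproducing kernel of the first `2 ^ n` normalized Haar functions. -/
theorem sum_haarNFn_mul_haarNFn (n : ℕ) {s t : ℝ} (hs : s ∈ Ico (0 : ℝ) 1)
    (ht : t ∈ Ico (0 : ℝ) 1) :
    ∑ j ∈ Finset.range (2 ^ n), haarNFn (j + 1) s * haarNFn (j + 1) t =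
      if ⌊2 ^ n * s⌋₊ = ⌊2 ^ n * t⌋₊ then 2 ^ n else 0 := by
  induction n with
  | zero =>
    have h : ∀ {x : ℝ}, x ∈ Ico (0 : ℝ) 1 → ⌊x⌋₊ = 0 := fun hx => Nat.floor_eq_zero.2 hx.2
    simp [haarNFn_one hs, haarNFn_one ht, h hs, h ht]
  | succ k ih =>
    have hsk : ⌊2 ^ k * s⌋₊ < 2 ^ k := by
      rw [Nat.floor_lt (by have := hs.1; positivity)]
      push_cast
      exact mul_lt_of_lt_one_right (by positivity) hs.2
    have hterm : ∀ i ∈ Finset.range (2 ^ k),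
        haarNFn (2 ^ k + i + 1) s * haarNFn (2 ^ k + i + 1) t =
          if ⌊2 ^ k * s⌋₊ = i then
            (if ⌊2 ^ k * s⌋₊ = ⌊2 ^ k * t⌋₊ then
              2 ^ k * ((-1) ^ ⌊2 ^ (k + 1) * s⌋₊ * (-1) ^ ⌊2 ^ (k + 1) * t⌋₊) else 0)
          else 0 := by
      intro i hi
      rw [Finset.mem_range] at hi
      have hpow : (2 : ℝ) ^ ((k : ℝ) / 2) * 2 ^ ((k : ℝ) / 2) = 2 ^ k := by
        rw [← Real.rpow_add (by norm_num), add_halves, Real.rpow_natCast]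
      rw [haarNFn_two_pow_add hi hs.1, haarNFn_two_pow_add hi ht.1, mul_mul_mul_comm, hpow]
      by_cases h : ⌊2 ^ k * s⌋₊ = i
      · subst h
        simp [eq_comm]
      · simp [h]
    rw [pow_succ, mul_two, Finset.sum_range_add, ih, Finset.sum_congr rfl hterm,
      Finset.sum_ite_eq, if_pos (Finset.mem_range.2 hsk)]
    have es := floor_two_pow_mul_div k 1 s
    have et := floor_two_pow_mul_div k 1 t
    rw [← es, ← et, pow_one]
    generalize ⌊2 ^ (k + 1) * s⌋₊ = a
    generalize ⌊2 ^ (k + 1) * t⌋₊ = b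
    by_cases hab : a = b
    · subst hab
      simp [← mul_pow, pow_succ, mul_two]
    · rw [if_neg hab]
      by_cases h : a / 2 = b / 2
      · have hodd : Odd (a + b) := by rw [Nat.odd_iff]; omega
        rw [if_pos h, if_pos h, ← pow_add, hodd.neg_one_pow]
        ring
      · simp [h]

/-- Integral of a function that is constant on the intervals of an equidistant partition. -/
theorem setIntegral_Ioo_eq_sum_div {N : ℕ} (hN : 0 < N) {F : ℝ → ℝ} {G : ℕ → ℝ}
    (h : ∀ m < N, ∀ t ∈ Ioo ((m : ℝ) / N) ((m + 1) / N), F t = G m) :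
    ∫ t in Ioo (0 : ℝ) 1, F t = (∑ m ∈ Finset.range N, G m) / N := by
  have hN' : (0 : ℝ) < N := by exact_mod_cast hN
  have hle : ∀ m : ℕ, (m : ℝ) / N ≤ (m + 1) / N := fun m => by gcongr; linarith
  have hconst : ∀ m < N, IntegrableOn F (Ioo ((m : ℝ) / N) ((m + 1) / N)) := fun m hm =>
    (integrableOn_const (C := G m) (by simp)).congr_fun (fun t ht => (h m hm t ht).symm)
      measurableSet_Ioo
  have hsum := intervalIntegral.sum_integral_adjacent_intervals (f := F) (μ := volume)
    (a := fun m : ℕ => (m : ℝ) / N) (n := N) (fun m hm => by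
      push_cast
      rw [intervalIntegrable_iff_integrableOn_Ioo_of_le (hle m)]
      exact hconst m hm)
  simp only [Nat.cast_zero, zero_div, div_self hN'.ne'] at hsum
  rw [← integral_Ioc_eq_integral_Ioo, ← intervalIntegral.integral_of_le zero_le_one, ← hsum,
    Finset.sum_div]
  refine Finset.sum_congr rfl fun m hm => ?_
  push_cast
  rw [intervalIntegral.integral_of_le (hle m), integral_Ioc_eq_integral_Ioo,
    setIntegral_congr_fun measurableSet_Ioo (h m (Finset.mem_range.1 hm)), setIntegral_const,
    measureReal_def, Real.volume_Ioo, ENNReal.toReal_ofReal (by linarith [hle m])]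
  simp only [smul_eq_mul]
  field_simp
  ring

theorem measurable_rademacherFn (n : ℕ) : Measurable (rademacherFn n) := by
  have hs : Measurable Real.sign := by
    unfold Real.sign
    exact Measurable.ite measurableSet_Iio measurable_const
      (Measurable.ite measurableSet_Ioi measurable_const measurable_const)
  exact hs.comp (Real.continuous_sin.comp (by fun_prop)).measurable

theorem abs_rademacherFn_le_one (n : ℕ) (t : ℝ) : |rademacherFn n t| ≤ 1 := by
  rcases Real.sign_apply_eq (Real.sin (2 ^ n * Real.pi * t)) with h | h | h <;>
    simp [rademacherFn, h]

theorem ae_rademacherFn_mul_self : ∀ᵐ t : ℝ, ∀ n, rademacherFn n t * rademacherFn n t = 1 := by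
  rw [ae_all_iff]
  intro n
  have hc : (range fun m : ℤ => (m : ℝ) / 2 ^ n).Countable := countable_range _
  filter_upwards [hc.ae_notMem volume] with t ht
  have hsin : Real.sin (2 ^ n * Real.pi * t) ≠ 0 := by
    intro h0
    obtain ⟨m, hm⟩ := Real.sin_eq_zero_iff.1 h0
    refine ht ⟨m, ?_⟩
    have : (m : ℝ) = 2 ^ n * t := mul_right_cancel₀ Real.pi_ne_zero (by rw [hm]; ring)
    simp only [this]
    field_simp
  rcases Real.sign_apply_eq_of_ne_zero _ hsin with h | h <;> simp [rademacherFn, h]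

theorem rademacherFn_one_left {u : ℝ} (hu : u ∈ Ioo (0 : ℝ) 1) :
    rademacherFn 1 (u / 2) = 1 := by
  rw [rademacherFn, Real.sign_of_pos]
  have : (2 : ℝ) ^ 1 * Real.pi * (u / 2) = Real.pi * u := by ring
  rw [this]
  exact Real.sin_pos_of_pos_of_lt_pi (mul_pos Real.pi_pos hu.1)
    (mul_lt_of_lt_one_right Real.pi_pos hu.2)

theorem rademacherFn_one_right {u : ℝ} (hu : u ∈ Ioo (0 : ℝ) 1) :
    rademacherFn 1 (u / 2 + 1 / 2) = -1 := by
  rw [rademacherFn, Real.sign_of_neg]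
  have : (2 : ℝ) ^ 1 * Real.pi * (u / 2 + 1 / 2) = Real.pi * u + Real.pi := by ring
  rw [this, Real.sin_add_pi, neg_lt_zero]
  exact Real.sin_pos_of_pos_of_lt_pi (mul_pos Real.pi_pos hu.1)
    (mul_lt_of_lt_one_right Real.pi_pos hu.2)

theorem rademacherFn_succ_left (n : ℕ) (u : ℝ) :
    rademacherFn (n + 1) (u / 2) = rademacherFn n u := by
  simp only [rademacherFn]
  congr 2
  rw [pow_succ]
  ring

theorem rademacherFn_succ_right {n : ℕ} (hn : n ≠ 0) (u : ℝ) :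
    rademacherFn (n + 1) (u / 2 + 1 / 2) = rademacherFn n u := by
  obtain ⟨m, rfl⟩ := Nat.exists_eq_succ_of_ne_zero hn
  simp only [rademacherFn]
  congr 1
  have : (2 : ℝ) ^ (m.succ + 1) * Real.pi * (u / 2 + 1 / 2) =
      2 ^ m.succ * Real.pi * u + (2 ^ m : ℕ) * (2 * Real.pi) := by
    push_cast
    rw [Nat.succ_eq_add_one, pow_succ, pow_succ]
    ring
  rw [this, Real.sin_add_nat_mul_two_pi]

section RademacherSums

variable {X : Type*} [NormedAddCommGroup X] [NormedSpace ℝ X]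

theorem stronglyMeasurable_sum_rademacherFn_smul (l : ℕ) (y : ℕ → X) :
    StronglyMeasurable fun t => ∑ i ∈ Finset.range l, rademacherFn (i + 1) t • y i :=
  Finset.stronglyMeasurable_fun_sum _ fun i _ =>
    (measurable_rademacherFn (i + 1)).stronglyMeasurable.smul_const (y i)

theorem norm_sum_rademacherFn_smul_le (l : ℕ) (y : ℕ → X) (t : ℝ) :
    ‖∑ i ∈ Finset.range l, rademacherFn (i + 1) t • y i‖ ≤ ∑ i ∈ Finset.range l, ‖y i‖ := by
  refine norm_sum_le_of_le _ fun i _ => ?_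
  rw [norm_smul]
  exact mul_le_of_le_one_left (norm_nonneg _) (abs_rademacherFn_le_one _ _)

theorem intervalIntegrable_norm_add_sum_rademacherFn_sq (l : ℕ) (y : ℕ → X) (z : X) (a b : ℝ) :
    IntervalIntegrable
      (fun t => ‖z + ∑ i ∈ Finset.range l, rademacherFn (i + 1) t • y i‖ ^ 2) volume a b := by
  refine (intervalIntegrable_const (c := (‖z‖ + ∑ i ∈ Finset.range l, ‖y i‖) ^ 2)).mono_fun'
    ?_ ?_
  · exact ((stronglyMeasurable_const.add
      (stronglyMeasurable_sum_rademacherFn_smul l y)).norm.pow 2).aestronglyMeasurable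
  · refine Eventually.of_forall fun t => ?_
    simp only [norm_pow, norm_norm]
    gcongr
    exact (norm_add_le _ _).trans (by gcongr; exact norm_sum_rademacherFn_smul_le l y t)

theorem integral_norm_add_sum_rademacherFn_succ (l : ℕ) (y : ℕ → X) (z : X) :
    ∫ t in (0 : ℝ)..1, ‖z + ∑ i ∈ Finset.range (l + 1), rademacherFn (i + 1) t • y i‖ ^ 2 =
      ((∫ t in (0 : ℝ)..1,
          ‖(z + y 0) + ∑ i ∈ Finset.range l, rademacherFn (i + 1) t • y (i + 1)‖ ^ 2) +
        ∫ t in (0 : ℝ)..1,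
          ‖(z - y 0) + ∑ i ∈ Finset.range l, rademacherFn (i + 1) t • y (i + 1)‖ ^ 2) / 2 := by
  have hint := fun a b => intervalIntegrable_norm_add_sum_rademacherFn_sq (l + 1) y z a b
  set F : ℝ → ℝ := fun t =>
    ‖z + ∑ i ∈ Finset.range (l + 1), rademacherFn (i + 1) t • y i‖ ^ 2 with hF
  have hl : ∫ u in (0 : ℝ)..1, F (u / 2) = 2 * ∫ t in (0 : ℝ)..1 / 2, F t := by
    rw [intervalIntegral.integral_comp_div F two_ne_zero]
    norm_num
  have hr : ∫ u in (0 : ℝ)..1, F (u / 2 + 1 / 2) = 2 * ∫ t in (1 / 2 : ℝ)..1, F t := by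
    rw [intervalIntegral.integral_comp_div_add F two_ne_zero]
    norm_num
  rw [← intervalIntegral.integral_add_adjacent_intervals (hint 0 (1 / 2)) (hint (1 / 2) 1)]
  have el : ∀ u ∈ Ioo (0 : ℝ) 1, F (u / 2) =
      ‖(z + y 0) + ∑ i ∈ Finset.range l, rademacherFn (i + 1) u • y (i + 1)‖ ^ 2 := by
    intro u hu
    simp only [hF, Finset.sum_range_succ', rademacherFn_succ_left (_ + 1), zero_add,
      rademacherFn_one_left hu, one_smul]
    congr 2
    abel
  have er : ∀ u ∈ Ioo (0 : ℝ) 1, F (u / 2 + 1 / 2) =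
      ‖(z - y 0) + ∑ i ∈ Finset.range l, rademacherFn (i + 1) u • y (i + 1)‖ ^ 2 := by
    intro u hu
    simp only [hF, Finset.sum_range_succ', rademacherFn_succ_right (Nat.succ_ne_zero _),
      zero_add, rademacherFn_one_right hu, neg_smul, one_smul]
    congr 2
    abel
  have hcongr : ∀ {f g : ℝ → ℝ}, (∀ u ∈ Ioo (0 : ℝ) 1, f u = g u) →
      ∫ u in (0 : ℝ)..1, f u = ∫ u in (0 : ℝ)..1, g u := fun {f g} h => by
    rw [intervalIntegral.integral_of_le zero_le_one, intervalIntegral.integral_of_le zero_le_one,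
      integral_Ioc_eq_integral_Ioo, integral_Ioc_eq_integral_Ioo]
    exact setIntegral_congr_fun measurableSet_Ioo h
  rw [← hcongr el, ← hcongr er, hl, hr]
  ring

/-- Rademacher means are invariant under changes of signs. -/
theorem integral_norm_add_sum_rademacherFn_sign (l : ℕ) (y : ℕ → X) (z : X) {e : ℕ → ℝ}
    (he : ∀ i, e i = 1 ∨ e i = -1) :
    ∫ t in (0 : ℝ)..1, ‖z + ∑ i ∈ Finset.range l, rademacherFn (i + 1) t • e i • y i‖ ^ 2 =
      ∫ t in (0 : ℝ)..1, ‖z + ∑ i ∈ Finset.range l, rademacherFn (i + 1) t • y i‖ ^ 2 := by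
  induction l generalizing y z e with
  | zero => simp
  | succ l ih =>
    rw [integral_norm_add_sum_rademacherFn_succ,
      integral_norm_add_sum_rademacherFn_succ, ih (fun i => y (i + 1)) _ fun i => he (i + 1),
      ih (fun i => y (i + 1)) _ fun i => he (i + 1)]
    rcases he 0 with h | h
    · simp [h]
    · simp only [h, neg_smul, one_smul, sub_neg_eq_add, ← sub_eq_add_neg]
      rw [add_comm]

end RademacherSums

section GaussianSums

open ProbabilityTheory

variable {X : Type*} [NormedAddCommGroup X] [NormedSpace ℝ X] {N : ℕ}

/-- Standard Gaussian sums are invariant under orthogonal transformations. -/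
theorem integral_stdGaussian_norm_sum_mulVec_smul (A : Matrix (Fin N) (Fin N) ℝ)
    (hA : A.transpose * A = 1) (y : Fin N → X) :
    ∫ g, ‖∑ k, A.mulVec (WithLp.ofLp g) k • y k‖ ^ 2 ∂stdGaussian (EuclideanSpace ℝ (Fin N)) =
      ∫ g, ‖∑ k, g k • y k‖ ^ 2 ∂stdGaussian (EuclideanSpace ℝ (Fin N)) := by
  let L : EuclideanSpace ℝ (Fin N) →ₗᵢ[ℝ] EuclideanSpace ℝ (Fin N) :=
    { toLinearMap := Matrix.toEuclideanLin A
      norm_map' := fun g => by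
        rw [EuclideanSpace.norm_eq, EuclideanSpace.norm_eq]
        congr 1
        have h : A.mulVec g.ofLp ⬝ᵥ A.mulVec g.ofLp = g.ofLp ⬝ᵥ g.ofLp := by
          rw [Matrix.dotProduct_mulVec, ← Matrix.mulVec_transpose, Matrix.mulVec_mulVec, hA,
            Matrix.one_mulVec]
        simpa [dotProduct, sq] using h }
  have hmap := stdGaussian_map (L.toLinearIsometryEquiv rfl)
  conv_rhs => rw [← hmap]
  exact ((L.toLinearIsometryEquiv rfl).toHomeomorph.measurableEmbedding.integral_map
    (fun g => ‖∑ k, g k • y k‖ ^ 2)).symm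

theorem map_eval_stdGaussian (k : Fin N) :
    (stdGaussian (EuclideanSpace ℝ (Fin N))).map (fun g => g k) = gaussianReal 0 1 := by
  rw [← map_pi_eq_stdGaussian, Measure.map_map (by fun_prop) (by fun_prop)]
  exact (measurePreserving_eval (fun _ : Fin N => gaussianReal 0 1) k).map_eq

theorem integral_eval_stdGaussian (k : Fin N) {F : ℝ → ℝ} (hF : Measurable F) :
    ∫ g, F (g k) ∂stdGaussian (EuclideanSpace ℝ (Fin N)) = ∫ x, F x ∂gaussianReal 0 1 := by
  rw [← map_eval_stdGaussian k, integral_map (by fun_prop) hF.aestronglyMeasurable]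

theorem integral_sq_gaussianReal_zero_one : ∫ x, x ^ 2 ∂gaussianReal 0 1 = 1 := by
  have h := variance_id_gaussianReal (μ := 0) (v := 1)
  rw [variance_of_integral_eq_zero aemeasurable_id (by simp)] at h
  simpa using h

theorem integral_abs_gaussianReal_zero_one_pos : 0 < ∫ x, |x| ∂gaussianReal 0 1 := by
  have hint : Integrable (fun x : ℝ => |x|) (gaussianReal 0 1) :=
    (memLp_id_gaussianReal 1).integrable (by norm_num) |>.abs
  refine (integral_nonneg fun x => abs_nonneg x).lt_of_ne fun h => ?_
  have h0 := (integral_eq_zero_iff_of_nonneg (fun x => abs_nonneg x) hint).1 h.symm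
  have h1 : ∫ x, x ^ 2 ∂gaussianReal 0 1 = 0 := by
    rw [integral_congr_ae (g := fun _ => (0 : ℝ)) ?_, integral_zero]
    filter_upwards [h0] with x hx
    simpa using hx
  rw [integral_sq_gaussianReal_zero_one] at h1
  exact one_ne_zero h1

theorem integrable_norm_sq_stdGaussian :
    Integrable (fun g : EuclideanSpace ℝ (Fin N) => ‖g‖ ^ 2)
      (stdGaussian (EuclideanSpace ℝ (Fin N))) := by
  have h := (IsGaussian.memLp_two_id (μ := stdGaussian (EuclideanSpace ℝ (Fin N)))).norm
  exact h.integrable_sq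

theorem norm_sum_smul_le_of_abs_le {a : Fin N → ℝ} {r : ℝ} (ha : ∀ k, |a k| ≤ r)
    (y : Fin N → X) : ‖∑ k, a k • y k‖ ≤ r * ∑ k, ‖y k‖ := by
  rw [Finset.mul_sum]
  refine norm_sum_le_of_le _ fun k _ => ?_
  rw [norm_smul]
  exact mul_le_mul_of_nonneg_right (ha k) (norm_nonneg _)

theorem memLp_sum_smul_stdGaussian {w : EuclideanSpace ℝ (Fin N) → Fin N → ℝ}
    (hw : Continuous w) (hle : ∀ g k, |w g k| ≤ ‖g‖) (y : Fin N → X) :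
    MemLp (fun g => ∑ k, w g k • y k) 2 (stdGaussian (EuclideanSpace ℝ (Fin N))) := by
  refine (IsGaussian.memLp_two_id.const_smul (∑ k, ‖y k‖)).mono ?_ ?_
  · exact Continuous.aestronglyMeasurable (by fun_prop)
  · refine Eventually.of_forall fun g => ?_
    rw [Pi.smul_apply, norm_smul, Real.norm_of_nonneg (by positivity), mul_comm]
    exact norm_sum_smul_le_of_abs_le (hle g) y

theorem integrable_norm_sum_rademacherFn_smul_sq {w : EuclideanSpace ℝ (Fin N) → Fin N → ℝ}
    (hw : Continuous w) (hle : ∀ g k, |w g k| ≤ ‖g‖) (y : Fin N → X) :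
    Integrable
      (fun p : ℝ × EuclideanSpace ℝ (Fin N) =>
        ‖∑ k : Fin N, rademacherFn (k + 1) p.1 • w p.2 k • y k‖ ^ 2)
      ((volume.restrict (Ioo (0 : ℝ) 1)).prod (stdGaussian (EuclideanSpace ℝ (Fin N)))) := by
  have hdom : Integrable
      (fun p : ℝ × EuclideanSpace ℝ (Fin N) => ‖p.2‖ ^ 2 * (∑ k, ‖y k‖) ^ 2)
      ((volume.restrict (Ioo (0 : ℝ) 1)).prod (stdGaussian (EuclideanSpace ℝ (Fin N)))) :=
    (integrable_norm_sq_stdGaussian.mul_const _).comp_snd _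
  refine hdom.mono' ?_ ?_
  · refine ((Finset.stronglyMeasurable_fun_sum _ fun k _ => ?_).norm.pow 2).aestronglyMeasurable
    have h1 : Measurable fun p : ℝ × EuclideanSpace ℝ (Fin N) => rademacherFn (k + 1) p.1 :=
      (measurable_rademacherFn _).comp measurable_fst
    have h2 : Continuous fun p : ℝ × EuclideanSpace ℝ (Fin N) => w p.2 k := by fun_prop
    exact h1.stronglyMeasurable.smul (h2.measurable.stronglyMeasurable.smul_const (y k))
  · refine Eventually.of_forall fun p => ?_
    simp only [norm_pow, norm_norm, smul_smul, ← mul_pow]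
    gcongr
    refine norm_sum_smul_le_of_abs_le (fun k => ?_) y
    rw [abs_mul]
    exact (mul_le_of_le_one_left (abs_nonneg _) (abs_rademacherFn_le_one _ _)).trans (hle _ _)

/-- Gaussian sums can be randomized by Rademacher functions. -/
theorem integral_stdGaussian_rademacherFn (y : Fin N → X) :
    ∫ g, (∫ t in Ioo (0 : ℝ) 1, ‖∑ k : Fin N, rademacherFn (k + 1) t • g k • y k‖ ^ 2)
        ∂stdGaussian (EuclideanSpace ℝ (Fin N)) =
      ∫ g, ‖∑ k, g k • y k‖ ^ 2 ∂stdGaussian (EuclideanSpace ℝ (Fin N)) := by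
  rw [← integral_integral_swap (integrable_norm_sum_rademacherFn_smul_sq
    (w := fun g => g.ofLp) (by fun_prop) (fun g k => PiLp.norm_apply_le g k) y)]
  rw [integral_congr_ae (g := fun _ =>
    ∫ g, ‖∑ k, g k • y k‖ ^ 2 ∂stdGaussian (EuclideanSpace ℝ (Fin N)))]
  · simp
  · filter_upwards [ae_restrict_of_ae ae_rademacherFn_mul_self] with t ht
    rw [← integral_stdGaussian_norm_sum_mulVec_smul
      (Matrix.diagonal fun k : Fin N => rademacherFn (k + 1) t) _ y]
    · simp [Matrix.mulVec_diagonal, smul_smul]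
    · simp [Matrix.diagonal_mul_diagonal, ht]

/-- Rademacher type 2 implies Gaussian type 2. -/
theorem integral_stdGaussian_norm_sum_smul_le {c : ℝ} {N : ℕ}
    (h : ∀ x : Fin N → X,
      ∫ t in Ioo (0 : ℝ) 1, ‖∑ k : Fin N, rademacherFn (k + 1) t • x k‖ ^ 2 ≤
        c ^ 2 * ∑ k, ‖x k‖ ^ 2) (x : Fin N → X) :
    ∫ g, ‖∑ k, g k • x k‖ ^ 2 ∂stdGaussian (EuclideanSpace ℝ (Fin N)) ≤
      c ^ 2 * ∑ k, ‖x k‖ ^ 2 := by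
  have hsq : ∀ k : Fin N, Integrable (fun g : EuclideanSpace ℝ (Fin N) => g k ^ 2)
      (stdGaussian (EuclideanSpace ℝ (Fin N))) := fun k => by
    refine integrable_norm_sq_stdGaussian.mono' (Continuous.aestronglyMeasurable (by fun_prop)) ?_
    refine Eventually.of_forall fun g => ?_
    rw [norm_pow]
    gcongr
    exact PiLp.norm_apply_le g k
  rw [← integral_stdGaussian_rademacherFn]
  have hrhs : ∫ g, (c ^ 2 * ∑ k, g k ^ 2 * ‖x k‖ ^ 2)
      ∂stdGaussian (EuclideanSpace ℝ (Fin N)) = c ^ 2 * ∑ k, ‖x k‖ ^ 2 := by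
    rw [integral_const_mul, integral_finsetSum _ fun k _ => (hsq k).mul_const _]
    congr 1
    refine Finset.sum_congr rfl fun k _ => ?_
    rw [integral_mul_const, integral_eval_stdGaussian k (F := fun x => x ^ 2) (by fun_prop),
      integral_sq_gaussianReal_zero_one, one_mul]
  rw [← hrhs]
  refine integral_mono ?_ ?_ fun g => ?_
  · exact (integrable_norm_sum_rademacherFn_smul_sq
      (w := fun g => g.ofLp) (by fun_prop) (fun g k => PiLp.norm_apply_le g k) x).integral_prod_right
  · exact (integrable_finsetSum _ fun k _ => (hsq k).mul_const _).const_mul _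
  · refine (h fun k => g k • x k).trans (le_of_eq ?_)
    simp [norm_smul, mul_pow]

theorem integral_rademacherFn_abs_smul (v : Fin N → ℝ) (y : Fin N → X) :
    ∫ t in Ioo (0 : ℝ) 1, ‖∑ k : Fin N, rademacherFn (k + 1) t • |v k| • y k‖ ^ 2 =
      ∫ t in Ioo (0 : ℝ) 1, ‖∑ k : Fin N, rademacherFn (k + 1) t • v k • y k‖ ^ 2 := by
  let v' : ℕ → ℝ := fun i => if hi : i < N then v ⟨i, hi⟩ else 0
  let y' : ℕ → X := fun i => if hi : i < N then y ⟨i, hi⟩ else 0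
  have hsign := integral_norm_add_sum_rademacherFn_sign N (fun i => v' i • y' i) 0
    (e := fun i => if 0 ≤ v' i then 1 else -1) fun i => by
      by_cases hi : 0 ≤ v' i <;> simp [hi]
  have habs : ∀ i, (if 0 ≤ v' i then (1 : ℝ) else -1) • v' i • y' i = |v' i| • y' i := fun i => by
    split_ifs with hi
    · rw [abs_of_nonneg hi, one_smul]
    · rw [abs_of_neg (not_le.1 hi), neg_smul, neg_smul, one_smul]
  simp only [habs, zero_add, intervalIntegral.integral_of_le zero_le_one,
    integral_Ioc_eq_integral_Ioo, Finset.sum_range] at hsign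
  simpa [v', y'] using hsign

theorem norm_integral_sq_le_integral_norm_sq {Ω : Type*} [MeasurableSpace Ω] {μ : Measure Ω}
    [IsProbabilityMeasure μ] {f : Ω → X} (hf : MemLp f 2 μ) :
    ‖∫ ω, f ω ∂μ‖ ^ 2 ≤ ∫ ω, ‖f ω‖ ^ 2 ∂μ := by
  have hvar := variance_nonneg (fun ω => ‖f ω‖) μ
  rw [variance_eq_sub hf.norm] at hvar
  calc ‖∫ ω, f ω ∂μ‖ ^ 2 ≤ (∫ ω, ‖f ω‖ ∂μ) ^ 2 := by gcongr; exact norm_integral_le_integral_norm _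
    _ ≤ ∫ ω, ‖f ω‖ ^ 2 ∂μ := by simpa using hvar

/-- Rademacher means are dominated by Gaussian means. -/
theorem integral_rademacherFn_le_integral_stdGaussian [CompleteSpace X] (y : Fin N → X) :
    (∫ x, |x| ∂gaussianReal 0 1) ^ 2 *
        ∫ t in Ioo (0 : ℝ) 1, ‖∑ k : Fin N, rademacherFn (k + 1) t • y k‖ ^ 2 ≤
      ∫ g, ‖∑ k, g k • y k‖ ^ 2 ∂stdGaussian (EuclideanSpace ℝ (Fin N)) := by
  have hw : Continuous fun (g : EuclideanSpace ℝ (Fin N)) (k : Fin N) => |g k| := by fun_prop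
  have hle : ∀ (g : EuclideanSpace ℝ (Fin N)) (k : Fin N), |(|g k|)| ≤ ‖g‖ := fun g k => by
    rw [abs_abs]; exact PiLp.norm_apply_le g k
  have hprod := integrable_norm_sum_rademacherFn_smul_sq hw hle y
  rw [← integral_stdGaussian_rademacherFn, ← integral_congr_ae (Eventually.of_forall
    fun g : EuclideanSpace ℝ (Fin N) => integral_rademacherFn_abs_smul g.ofLp y),
    ← integral_integral_swap hprod, ← integral_const_mul]
  refine integral_mono_of_nonneg (Eventually.of_forall fun t => by positivity)
    hprod.integral_prod_left (Eventually.of_forall fun t => ?_)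
  have hmem : MemLp (fun g : EuclideanSpace ℝ (Fin N) =>
      ∑ k : Fin N, rademacherFn (k + 1) t • |g k| • y k) 2
      (stdGaussian (EuclideanSpace ℝ (Fin N))) := by
    refine (memLp_sum_smul_stdGaussian hw hle
      fun k : Fin N => rademacherFn (k + 1) t • y k).ae_eq (Eventually.of_forall fun g => ?_)
    exact Finset.sum_congr rfl fun k _ => smul_comm _ _ _
  refine le_trans (le_of_eq ?_) (norm_integral_sq_le_integral_norm_sq hmem)
  have habs : ∀ k : Fin N, Integrable (fun g : EuclideanSpace ℝ (Fin N) => |g k|)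
      (stdGaussian (EuclideanSpace ℝ (Fin N))) := fun k =>
    IsGaussian.integrable_id.mono (Continuous.aestronglyMeasurable (by fun_prop))
      (Eventually.of_forall fun g => hle g k)
  dsimp only
  rw [integral_finsetSum (f := fun (k : Fin N) (g : EuclideanSpace ℝ (Fin N)) =>
    rademacherFn (k + 1) t • |g k| • y k) _ fun k _ => ((habs k).smul_const (y k)).smul _]
  have hterm : ∀ k : Fin N, ∫ g, rademacherFn (k + 1) t • |g k| • y k
      ∂stdGaussian (EuclideanSpace ℝ (Fin N)) =
        (∫ x, |x| ∂gaussianReal 0 1) • rademacherFn (k + 1) t • y k := fun k => by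
    rw [integral_smul, integral_smul_const,
      integral_eval_stdGaussian k (F := fun x => |x|) measurable_norm, smul_comm]
  rw [Finset.sum_congr rfl fun k _ => hterm k, ← Finset.smul_sum, norm_smul, mul_pow,
    Real.norm_eq_abs, sq_abs]

end GaussianSums

theorem sum_Icc_one_eq_sum_fin {M : Type*} [AddCommMonoid M] (f : ℕ → M) (m : ℕ) :
    ∑ j ∈ Finset.Icc 1 m, f j = ∑ k : Fin m, f (k + 1) := by
  rw [← Finset.sum_range fun k => f (k + 1), Finset.range_eq_Ico, Finset.sum_Ico_add' f 0 m 1,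
    zero_add]
  rfl

section HaarSums

open ProbabilityTheory

variable {X : Type*} [NormedAddCommGroup X] [NormedSpace ℝ X]

/-- The values of the normalized Haar functions at the dyadic points of generation `n`,
rescaled so as to form an orthogonal matrix. -/
noncomputable def haarMatrix (n : ℕ) : Matrix (Fin (2 ^ n)) (Fin (2 ^ n)) ℝ :=
  fun k m => (√(2 ^ n))⁻¹ * haarNFn (k + 1) ((m : ℝ) / 2 ^ n)

theorem natCast_div_two_pow_mem_Ico {n m : ℕ} (hm : m < 2 ^ n) :
    (m : ℝ) / 2 ^ n ∈ Ico (0 : ℝ) 1 := by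
  refine ⟨by positivity, ?_⟩
  rw [div_lt_one (by positivity)]
  exact_mod_cast hm

theorem floor_two_pow_mul_natCast_div (n m : ℕ) : ⌊(2 : ℝ) ^ n * (m / 2 ^ n)⌋₊ = m := by
  rw [mul_div_cancel₀ _ (by positivity), Nat.floor_natCast]

theorem haarMatrix_transpose_mul_self (n : ℕ) :
    (haarMatrix n).transpose * haarMatrix n = 1 := by
  ext a b
  have hker := sum_haarNFn_mul_haarNFn n (natCast_div_two_pow_mem_Ico a.isLt)
    (natCast_div_two_pow_mem_Ico b.isLt)
  rw [floor_two_pow_mul_natCast_div, floor_two_pow_mul_natCast_div, Finset.sum_range] at hker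
  have hsqrt : (√(2 ^ n) : ℝ)⁻¹ * (√(2 ^ n))⁻¹ = (2 ^ n)⁻¹ := by
    rw [← mul_inv, Real.mul_self_sqrt (by positivity)]
  rw [Matrix.mul_apply]
  simp only [Matrix.transpose_apply, haarMatrix]
  rw [Finset.sum_congr rfl fun k _ => mul_mul_mul_comm _ _ _ _, ← Finset.mul_sum, hker, hsqrt,
    Matrix.one_apply]
  by_cases hab : a = b <;> simp [hab, Fin.val_inj]

/-- The second moment of a Haar sum is a sum over the columns of `haarMatrix`. -/
theorem integral_norm_sum_haarNFn_sq (n : ℕ) (y : Fin (2 ^ n) → X) :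
    ∫ t in Ioo (0 : ℝ) 1, ‖∑ k : Fin (2 ^ n), haarNFn (k + 1) t • y k‖ ^ 2 =
      ∑ m, ‖∑ k, haarMatrix n k m • y k‖ ^ 2 := by
  rw [setIntegral_Ioo_eq_sum_div (N := 2 ^ n) (by positivity)
    (G := fun m => ‖∑ k : Fin (2 ^ n), haarNFn (k + 1) ((m : ℝ) / 2 ^ n) • y k‖ ^ 2)]
  · rw [Finset.sum_range, Finset.sum_div]
    refine Finset.sum_congr rfl fun m _ => ?_
    simp only [haarMatrix, mul_smul, ← Finset.smul_sum, norm_smul, mul_pow]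
    rw [norm_inv, inv_pow, Real.norm_of_nonneg (Real.sqrt_nonneg _),
      Real.sq_sqrt (by positivity)]
    push_cast
    rw [div_eq_inv_mul]
  · intro m hm t ht
    push_cast at ht
    have hpow : (0 : ℝ) < 2 ^ n := by positivity
    have hmem := natCast_div_two_pow_mem_Ico hm
    have hm' : (m : ℝ) + 1 ≤ 2 ^ n := by exact_mod_cast hm
    have ht' : t ∈ Ico (0 : ℝ) 1 :=
      ⟨hmem.1.trans ht.1.le, ht.2.trans_le ((div_le_one hpow).2 hm')⟩
    have hfl : ⌊2 ^ n * t⌋₊ = m := by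
      rw [Nat.floor_eq_iff (mul_nonneg hpow.le ht'.1), mul_comm]
      exact ⟨((div_lt_iff₀ hpow).1 ht.1).le, (lt_div_iff₀ hpow).1 ht.2⟩
    congr 2
    refine Finset.sum_congr rfl fun k _ => ?_
    rw [haarNFn_eq_of_floor_eq k.isLt ht' hmem (by rw [hfl, floor_two_pow_mul_natCast_div])]

/-- In a space of type 2, Gaussian means are dominated by Haar means. -/
theorem integral_stdGaussian_le_integral_haarNFn {c : ℝ} {n : ℕ}
    (h : ∀ x : Fin (2 ^ n) → X,
      ∫ t in Ioo (0 : ℝ) 1, ‖∑ k : Fin (2 ^ n), rademacherFn (k + 1) t • x k‖ ^ 2 ≤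
        c ^ 2 * ∑ k, ‖x k‖ ^ 2) (y : Fin (2 ^ n) → X) :
    ∫ g, ‖∑ k, g k • y k‖ ^ 2 ∂stdGaussian (EuclideanSpace ℝ (Fin (2 ^ n))) ≤
      c ^ 2 * ∫ t in Ioo (0 : ℝ) 1, ‖∑ k : Fin (2 ^ n), haarNFn (k + 1) t • y k‖ ^ 2 := by
  rw [← integral_stdGaussian_norm_sum_mulVec_smul _ (haarMatrix_transpose_mul_self n) y,
    integral_norm_sum_haarNFn_sq]
  have hswap : ∀ g : EuclideanSpace ℝ (Fin (2 ^ n)),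
      ∑ k, (haarMatrix n).mulVec g.ofLp k • y k =
        ∑ m, g m • ∑ k, haarMatrix n k m • y k := fun g => by
    simp only [Matrix.mulVec, dotProduct, Finset.sum_smul, Finset.smul_sum, smul_smul]
    rw [Finset.sum_comm]
    simp only [mul_comm]
  simp only [hswap]
  exact integral_stdGaussian_norm_sum_smul_le h _

end HaarSums

/-- If `X` has type 2, then the Rademacher means are dominated by the corresponding
(`L²`-normalized) Haar means. -/
theorem rademacher_mean_le_haar_mean_of_type_two
    {X : Type*} [NormedAddCommGroup X] [NormedSpace ℝ X] [CompleteSpace X]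
    (c : ℝ) (hc : 0 < c)
    (htype2 : ∀ m : ℕ, ∀ x : ℕ → X,
      (∫ t in Ioo (0:ℝ) 1, ‖∑ j ∈ Finset.Icc 1 m, rademacherFn j t • x j‖ ^ 2) ^ ((1:ℝ) / 2)
        ≤ c * (∑ j ∈ Finset.Icc 1 m, ‖x j‖ ^ 2) ^ ((1:ℝ) / 2)) :
    ∃ C : ℝ, 0 < C ∧ ∀ ℓ : ℕ, ∀ y : ℕ → X,
      (∫ t in Ioo (0:ℝ) 1, ‖∑ k ∈ Finset.Icc 1 ℓ, rademacherFn k t • y k‖ ^ 2)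
        ≤ C * (∫ t in Ioo (0:ℝ) 1, ‖∑ k ∈ Finset.Icc 1 ℓ, haarNFn k t • y k‖ ^ 2) := by
  have htype : ∀ m : ℕ, ∀ x : Fin m → X,
      ∫ t in Ioo (0 : ℝ) 1, ‖∑ k : Fin m, rademacherFn (k + 1) t • x k‖ ^ 2 ≤
        c ^ 2 * ∑ k, ‖x k‖ ^ 2 := by
    intro m x
    have h := htype2 m fun j => if hj : j - 1 < m then x ⟨j - 1, hj⟩ else 0
    simp only [sum_Icc_one_eq_sum_fin, Nat.add_sub_cancel, Fin.is_lt, dite_true, Fin.eta,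
      ← Real.sqrt_eq_rpow] at h
    have h2 := pow_le_pow_left₀ (Real.sqrt_nonneg _) h 2
    rwa [mul_pow, Real.sq_sqrt (integral_nonneg fun t => by positivity),
      Real.sq_sqrt (by positivity)] at h2
  have ha := integral_abs_gaussianReal_zero_one_pos
  refine ⟨c ^ 2 / (∫ x, |x| ∂ProbabilityTheory.gaussianReal 0 1) ^ 2, by positivity,
    fun ℓ y => ?_⟩
  have hext : ∀ a : ℕ → ℝ, ∑ k ∈ Finset.Icc 1 ℓ, a k • y k =
      ∑ k : Fin (2 ^ ℓ), a (k + 1) • if (k : ℕ) + 1 ≤ ℓ then y (k + 1) else 0 := by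
    intro a
    rw [← sum_Icc_one_eq_sum_fin fun j => a j • if j ≤ ℓ then y j else 0]
    have hsub : Finset.Icc 1 ℓ ⊆ Finset.Icc 1 (2 ^ ℓ) :=
      Finset.Icc_subset_Icc_right Nat.lt_two_pow_self.le
    rw [← Finset.sum_subset hsub]
    · refine Finset.sum_congr rfl fun k hk => ?_
      rw [if_pos (Finset.mem_Icc.1 hk).2]
    · intro k hk hk'
      rw [if_neg fun hle => hk' (Finset.mem_Icc.2 ⟨(Finset.mem_Icc.1 hk).1, hle⟩), smul_zero]
  simp only [hext fun k => rademacherFn k _, hext fun k => haarNFn k _]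
  rw [div_mul_eq_mul_div, le_div_iff₀ (by positivity), mul_comm]
  exact (integral_rademacherFn_le_integral_stdGaussian _).trans
    (integral_stdGaussian_le_integral_haarNFn (htype _) _)
end

section
/- Let α,β>−1. For n∈ℕ denote by t_1^n>⋯>t_n^n the zeros of p_n^{(α,β)}. Then there exist constants 0<c≤C and n_0∈ℕ such that for all n≥n_0 and all integers i with 1≤i≤3n/4, c·(n/i)^{α−1/2} ≤ |p_{n+1}^{(α,β)}(t_i^n)| ≤ C·(n/i)^{α−1/2}. -/
open MeasureTheory Set Filter
open scoped ENNReal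

/-- The Jacobi weight `w_{α,β}(t) = (1-t)^α (1+t)^β`. -/
noncomputable def jacobiWeight (α β : ℝ) (t : ℝ) : ℝ := (1 - t) ^ α * (1 + t) ^ β

/-- The system of `L₂(I, w_{α,β})`-normalized Jacobi polynomials. -/
structure JacobiSystem (α β : ℝ) where
  P : ℕ → Polynomial ℝ
  natDegree_eq : ∀ n, (P n).natDegree = n
  leadingCoeff_pos : ∀ n, 0 < (P n).leadingCoeff
  orthonormal : ∀ n m, (∫ t in Ioo (-1:ℝ) 1,
      (P n).eval t * (P m).eval t * jacobiWeight α β t) = if n = m then 1 else 0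

/-- For each `n`, the zeros `t_1^n > ⋯ > t_n^n` of `p_n^{(α,β)}`, all lying in
`I = (-1,1)`, listed in decreasing order. -/
structure JacobiZeros {α β : ℝ} (J : JacobiSystem α β) where
  z : (n : ℕ) → Fin n → ℝ
  mem : ∀ n j, z n j ∈ Ioo (-1:ℝ) 1
  strictAnti : ∀ n, StrictAnti (z n)
  isZero : ∀ n j, (J.P n).eval (z n j) = 0

open Polynomial Topology

/-- Two-sided Grönwall estimate for a function whose logarithmic derivative is dominated by the
derivative of `K`. -/
lemma gronwall_two_sided {φ φ' K k : ℝ → ℝ} {a b : ℝ} (hab : a ≤ b)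
    (hφ : ∀ x ∈ Icc a b, HasDerivAt φ (φ' x) x) (hK : ∀ x ∈ Icc a b, HasDerivAt K (k x) x)
    (h : ∀ x ∈ Icc a b, |φ' x| ≤ k x * φ x) :
    φ b ≤ φ a * Real.exp (K b - K a) ∧ φ a ≤ φ b * Real.exp (K b - K a) := by
  have h1 : AntitoneOn (fun x => φ x * Real.exp (-K x)) (Icc a b) := by
    have hd : ∀ x ∈ Icc a b, HasDerivAt (fun x => φ x * Real.exp (-K x))
        (φ' x * Real.exp (-K x) + φ x * (Real.exp (-K x) * (-k x))) x :=
      fun x hx => (hφ x hx).mul ((hK x hx).neg.exp)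
    refine antitoneOn_of_hasDerivWithinAt_nonpos (convex_Icc a b)
      (fun x hx => (hd x hx).continuousAt.continuousWithinAt)
      (fun x hx => (hd x (interior_subset hx)).hasDerivWithinAt) fun x hx => ?_
    have := (abs_le.1 (h x (interior_subset hx))).2
    nlinarith [Real.exp_pos (-K x)]
  have h2 : MonotoneOn (fun x => φ x * Real.exp (K x)) (Icc a b) := by
    have hd : ∀ x ∈ Icc a b, HasDerivAt (fun x => φ x * Real.exp (K x))
        (φ' x * Real.exp (K x) + φ x * (Real.exp (K x) * (k x))) x :=
      fun x hx => (hφ x hx).mul ((hK x hx).exp)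
    refine monotoneOn_of_hasDerivWithinAt_nonneg (convex_Icc a b)
      (fun x hx => (hd x hx).continuousAt.continuousWithinAt)
      (fun x hx => (hd x (interior_subset hx)).hasDerivWithinAt) fun x hx => ?_
    have := (abs_le.1 (h x (interior_subset hx))).1
    nlinarith [Real.exp_pos (K x)]
  have h1' := h1 (left_mem_Icc.2 hab) (right_mem_Icc.2 hab) hab
  have h2' := h2 (left_mem_Icc.2 hab) (right_mem_Icc.2 hab) hab
  simp only at h1' h2'
  constructor
  · have := mul_le_mul_of_nonneg_right h1' (Real.exp_pos (K b)).le
    rw [mul_assoc, mul_assoc, ← Real.exp_add, ← Real.exp_add] at this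
    simpa [sub_eq_neg_add] using this
  · have := mul_le_mul_of_nonneg_right h2' (Real.exp_pos (-K a)).le
    rw [mul_assoc, mul_assoc, ← Real.exp_add, ← Real.exp_add] at this
    simpa [sub_eq_add_neg] using this

/-- The Jacobi differential equation with eigenvalue `N²`. -/
def JacobiODE (α β N : ℝ) (y : ℝ[X]) : Prop :=
  ∀ t : ℝ, (1 - t ^ 2) * y.derivative.derivative.eval t
    + (β - α - (α + β + 2) * t) * y.derivative.eval t + N ^ 2 * y.eval t = 0

lemma JacobiODE.comp_neg_X {α β N : ℝ} {y : ℝ[X]} (hy : JacobiODE α β N y) :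
    JacobiODE β α N (y.comp (-X)) := by
  intro t
  have := hy (-t)
  simp only [derivative_comp, derivative_neg, derivative_X, derivative_mul, eval_mul, eval_neg,
    eval_one, eval_comp, eval_X, derivative_one, eval_add]
  simp
  linear_combination this

/-- The Jacobi energy: `1 - t²` times the squared derivative of `y`, plus `N² y²`. -/
noncomputable def jacobiEnergy (N : ℝ) (y : ℝ[X]) (t : ℝ) : ℝ :=
  (1 - t ^ 2) * y.derivative.eval t ^ 2 + N ^ 2 * y.eval t ^ 2

lemma deriv_nonpos_of_isMaxOn_right {φ : ℝ → ℝ} {φ' a b : ℝ} (hab : a < b)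
    (hφ : HasDerivAt φ φ' a) (h : ∀ x ∈ Icc a b, φ x ≤ φ a) : φ' ≤ 0 := by
  have h1 := (hasDerivWithinAt_iff_tendsto_slope' (self_notMem_Ioi (a := a))).1
    (hφ.hasDerivWithinAt (s := Ioi a))
  refine le_of_tendsto h1 ?_
  filter_upwards [Ioc_mem_nhdsGT hab] with x hx
  rw [slope_def_field]
  exact div_nonpos_of_nonpos_of_nonneg (by linarith [h x ⟨hx.1.le, hx.2⟩]) (by linarith [hx.1])

/-- Near `t = 1`, a solution of the Jacobi equation stays close to its value at `1`. -/
lemma JacobiODE.near_one {α β N : ℝ} {y : ℝ[X]} (hy : JacobiODE α β N y) (hα : -1 < α)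
    (hβ : -1 < β) (hN : 0 < N) (hN2 : α + β + 2 ≤ 4 * N ^ 2) {t : ℝ} (ht1 : t ≤ 1)
    (ht : 1 - t ≤ (α + 1) / 4 / N ^ 2) :
    |y.eval t - y.eval 1| ≤ |y.eval 1| / 3 ∧
      |y.derivative.eval t| ≤ 4 / 3 * N ^ 2 * |y.eval 1| / (α + 1) := by
  set r := (α + 1) / 4 / N ^ 2 with hr
  have hα1 : 0 < α + 1 := by linarith
  have hr0 : 0 < r := by positivity
  have hrN : r * N ^ 2 = (α + 1) / 4 := by rw [hr]; field_simp
  set I := Icc (1 - r) 1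
  have hne : I.Nonempty := ⟨1, by simp [I, hr0.le]⟩
  obtain ⟨t₁, ht₁, hm₁⟩ := isCompact_Icc.exists_isMaxOn hne
    (f := fun t => y.derivative.eval t ^ 2) (by fun_prop)
  obtain ⟨t₂, ht₂, hm₂⟩ := isCompact_Icc.exists_isMaxOn hne
    (f := fun t => |y.eval t|) (by fun_prop)
  set m := |y.eval t₂| with hm
  have hm0 : 0 ≤ m := abs_nonneg _
  have hd : (α + 1) * |y.derivative.eval t₁| ≤ N ^ 2 * m := by
    have hq : α + 1 ≤ (α - β) + (α + β + 2) * t₁ := by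
      have h1 : (α + β + 2) * (1 - t₁) ≤ α + 1 := by
        have : 1 - t₁ ≤ r := by linarith [ht₁.1]
        calc (α + β + 2) * (1 - t₁) ≤ (4 * N ^ 2) * r := by
              apply mul_le_mul hN2 this (by linarith [ht₁.2]) (by positivity)
          _ = α + 1 := by linarith
      nlinarith
    have hp : (1 - t₁ ^ 2) * (y.derivative.eval t₁ * y.derivative.derivative.eval t₁) ≤ 0 := by
      rcases eq_or_lt_of_le ht₁.2 with h | h
      · simp [h]
      · by_cases hneg : 0 ≤ 1 - t₁ ^ 2
        · refine mul_nonpos_of_nonneg_of_nonpos hneg ?_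
          have hder : HasDerivAt (fun t => y.derivative.eval t ^ 2)
              (2 * (y.derivative.eval t₁ * y.derivative.derivative.eval t₁)) t₁ := by
            exact ((y.derivative.hasDerivAt t₁).fun_pow 2).congr_deriv (by push_cast; ring)
          have := deriv_nonpos_of_isMaxOn_right h hder
            (fun x hx => hm₁ ⟨ht₁.1.trans hx.1, hx.2⟩)
          linarith
        · exfalso
          have hr1 : r ≤ 1 := by
            have h2 : (α + 1) / 4 ≤ N ^ 2 := by linarith
            rw [hr]; rw [div_le_one (by positivity)]; exact h2
          have := ht₁.1
          apply hneg; nlinarith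
    have hode := hy t₁
    have hyt : |y.eval t₁| ≤ m := hm₂ ht₁
    set d := y.derivative.eval t₁
    have h1 : (α + 1) * d ^ 2 ≤ N ^ 2 * (y.eval t₁ * d) := by
      have h0 := congrArg (· * d) hode
      simp only [zero_mul] at h0
      nlinarith [mul_le_mul_of_nonneg_right hq (sq_nonneg d)]
    have h2 : y.eval t₁ * d ≤ m * |d| := by
      calc _ ≤ |y.eval t₁ * d| := le_abs_self _
        _ = |y.eval t₁| * |d| := abs_mul _ _
        _ ≤ _ := by gcongr
    rcases eq_or_lt_of_le (abs_nonneg d) with h | h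
    · rw [← h]; simp; positivity
    · have h3 : (α + 1) * |d| * |d| ≤ N ^ 2 * m * |d| := by
        have : d ^ 2 = |d| * |d| := by rw [abs_mul_abs_self, sq]
        rw [this] at h1
        nlinarith [mul_le_mul_of_nonneg_left h2 (sq_nonneg N)]
      exact le_of_mul_le_mul_right h3 h
  have hd' : ∀ x ∈ I, |y.derivative.eval x| ≤ N ^ 2 * m / (α + 1) := fun x hx => by
    rw [le_div_iff₀ hα1, mul_comm]
    refine le_trans (mul_le_mul_of_nonneg_left ?_ hα1.le) hd
    have h1 : y.derivative.eval x ^ 2 ≤ y.derivative.eval t₁ ^ 2 := hm₁ hx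
    exact sq_le_sq.1 h1
  have hlip : ∀ x ∈ I, |y.eval x - y.eval 1| ≤ m / 4 := fun x hx => by
    have := (convex_Icc (1 - r) 1).norm_image_sub_le_of_norm_hasDerivWithin_le
      (f := fun t => y.eval t) (f' := fun t => y.derivative.eval t)
      (fun x _ => (y.hasDerivAt x).hasDerivWithinAt) (fun x hx => hd' x hx)
      (right_mem_Icc.2 (by linarith)) hx
    rw [Real.norm_eq_abs, Real.norm_eq_abs] at this
    refine this.trans ?_
    have h2 : |x - 1| ≤ r := by
      rw [abs_le]; constructor <;> linarith [hx.1, hx.2]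
    calc _ ≤ N ^ 2 * m / (α + 1) * r := by gcongr
      _ = (r * N ^ 2) * m / (α + 1) := by ring
      _ = m / 4 := by rw [hrN]; field_simp
  have hmle : m ≤ 4 / 3 * |y.eval 1| := by
    have := hlip t₂ ht₂
    have h2 := abs_sub_abs_le_abs_sub (y.eval t₂) (y.eval 1)
    linarith
  have htI : t ∈ I := ⟨by linarith, ht1⟩
  refine ⟨(hlip t htI).trans (by linarith), (hd' t htI).trans ?_⟩
  refine div_le_div_of_nonneg_right ?_ hα1.le
  nlinarith [sq_nonneg N]

/-- Near `t = 1`, the energy of a solution is comparable to `N² y(1)²`. -/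
lemma JacobiODE.energy_near_one {α β N : ℝ} {y : ℝ[X]} (hy : JacobiODE α β N y) (hα : -1 < α)
    (hβ : -1 < β) (hN : 0 < N) (hN2 : α + β + 2 ≤ 4 * N ^ 2) {t : ℝ} (ht1 : t ≤ 1)
    (ht0 : -1 ≤ t) (ht : 1 - t ≤ (α + 1) / 4 / N ^ 2) :
    4 / 9 * y.eval 1 ^ 2 ≤ y.eval t ^ 2 ∧
    4 / 9 * N ^ 2 * y.eval 1 ^ 2 ≤ jacobiEnergy N y t ∧
      jacobiEnergy N y t ≤ (16 / 9 + 8 / 9 / (α + 1)) * N ^ 2 * y.eval 1 ^ 2 := by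
  obtain ⟨h1, h2⟩ := hy.near_one hα hβ hN hN2 ht1 ht
  have hα1 : 0 < α + 1 := by linarith
  have hlow : 4 / 9 * y.eval 1 ^ 2 ≤ y.eval t ^ 2 := by
    have : 2 / 3 * |y.eval 1| ≤ |y.eval t| := by
      have := abs_sub_abs_le_abs_sub (y.eval 1) (y.eval t)
      rw [abs_sub_comm] at this
      linarith
    have h3 := pow_le_pow_left₀ (by positivity) this 2
    rw [mul_pow, sq_abs, sq_abs] at h3
    linarith
  have hup : y.eval t ^ 2 ≤ 16 / 9 * y.eval 1 ^ 2 := by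
    have : |y.eval t| ≤ 4 / 3 * |y.eval 1| := by
      have := abs_sub_abs_le_abs_sub (y.eval t) (y.eval 1)
      linarith
    have h3 := pow_le_pow_left₀ (by positivity) this 2
    rw [mul_pow, sq_abs, sq_abs] at h3
    linarith
  have hd : y.derivative.eval t ^ 2 ≤ (4 / 3 * N ^ 2 / (α + 1)) ^ 2 * y.eval 1 ^ 2 := by
    have h3 := pow_le_pow_left₀ (abs_nonneg _) h2 2
    rw [sq_abs] at h3
    refine h3.trans_eq ?_
    rw [div_pow, div_pow, mul_pow, sq_abs]; ring
  have hw : 1 - t ^ 2 ≤ 2 * ((α + 1) / 4 / N ^ 2) := by nlinarith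
  have hw0 : 0 ≤ 1 - t ^ 2 := by nlinarith
  refine ⟨hlow, ?_, ?_⟩ <;> unfold jacobiEnergy
  · have := mul_le_mul_of_nonneg_left hlow (sq_nonneg N)
    have := mul_nonneg hw0 (sq_nonneg (y.derivative.eval t))
    linarith
  · have h4 := mul_le_mul hw hd (sq_nonneg _) (by positivity)
    have h5 : 2 * ((α + 1) / 4 / N ^ 2) * ((4 / 3 * N ^ 2 / (α + 1)) ^ 2 * y.eval 1 ^ 2)
        = 8 / 9 / (α + 1) * N ^ 2 * y.eval 1 ^ 2 := by
      field_simp; ring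
    have := mul_le_mul_of_nonneg_left hup (sq_nonneg N)
    rw [h5] at h4
    linarith

/-- Half the coefficient of the first derivative in the Jacobi equation for `θ ↦ y (cos θ)`. -/
noncomputable def jacobiDrift (α β θ : ℝ) : ℝ :=
  ((α - β) + (α + β + 1) * Real.cos θ) / (2 * Real.sin θ)

/-- The derivative of `jacobiDrift`. -/
noncomputable def jacobiDriftDeriv (α β θ : ℝ) : ℝ :=
  -((α + β + 1) + (α - β) * Real.cos θ) / (2 * Real.sin θ ^ 2)

/-- The square of the Liouville factor turning the angular Jacobi equation into normal form. -/
noncomputable def jacobiGauge (α β θ : ℝ) : ℝ :=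
  (1 - Real.cos θ) ^ (α + 1 / 2) * (1 + Real.cos θ) ^ (β + 1 / 2)

/-- The angular derivative of `θ ↦ y (cos θ)`. -/
noncomputable def angularDeriv (y : ℝ[X]) (θ : ℝ) : ℝ :=
  -Real.sin θ * y.derivative.eval (Real.cos θ)

/-- A bound for the coefficients of the angular Jacobi equation. -/
def jacobiBound (α β : ℝ) : ℝ := |α| + |β| + 1

lemma jacobiBound_pos (α β : ℝ) : 0 < jacobiBound α β := by unfold jacobiBound; positivity

lemma hasDerivAt_eval_cos (y : ℝ[X]) (θ : ℝ) :
    HasDerivAt (fun θ => y.eval (Real.cos θ)) (angularDeriv y θ) θ :=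
  ((y.hasDerivAt (Real.cos θ)).comp θ (Real.hasDerivAt_cos θ)).congr_deriv (by
    unfold angularDeriv; ring)

lemma JacobiODE.hasDerivAt_angularDeriv {α β N : ℝ} {y : ℝ[X]} (hy : JacobiODE α β N y) {θ : ℝ}
    (hθ : 0 < Real.sin θ) :
    HasDerivAt (angularDeriv y)
      (-2 * jacobiDrift α β θ * angularDeriv y θ - N ^ 2 * y.eval (Real.cos θ)) θ := by
  have h := (Real.hasDerivAt_sin θ).neg.mul (hasDerivAt_eval_cos y.derivative θ)
  refine h.congr_deriv ?_
  have := hy (Real.cos θ)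
  unfold jacobiDrift angularDeriv
  have hs := Real.sin_sq_add_cos_sq θ
  simp only [Pi.neg_apply]
  field_simp
  linear_combination this + eval (Real.cos θ) y.derivative.derivative * hs

lemma hasDerivAt_jacobiDrift (α β : ℝ) {θ : ℝ} (hθ : 0 < Real.sin θ) :
    HasDerivAt (jacobiDrift α β) (jacobiDriftDeriv α β θ) θ := by
  have h := (((Real.hasDerivAt_cos θ).const_mul (α + β + 1)).const_add (α - β)).div
    ((Real.hasDerivAt_sin θ).const_mul 2) (by positivity)
  refine h.congr_deriv ?_
  unfold jacobiDriftDeriv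
  have hs := Real.sin_sq_add_cos_sq θ
  field_simp
  linear_combination (-(α + β + 1)) * hs

lemma one_sub_cos_pos_of_sin_pos {θ : ℝ} (hθ : 0 < Real.sin θ) : 0 < 1 - Real.cos θ := by
  have hs := Real.sin_sq_add_cos_sq θ
  nlinarith [Real.cos_le_one θ, Real.neg_one_le_cos θ, pow_pos hθ 2]

lemma one_add_cos_pos_of_sin_pos {θ : ℝ} (hθ : 0 < Real.sin θ) : 0 < 1 + Real.cos θ := by
  have hs := Real.sin_sq_add_cos_sq θ
  nlinarith [Real.cos_le_one θ, Real.neg_one_le_cos θ, pow_pos hθ 2]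

lemma jacobiGauge_pos (α β : ℝ) {θ : ℝ} (hθ : 0 < Real.sin θ) : 0 < jacobiGauge α β θ :=
  mul_pos (Real.rpow_pos_of_pos (one_sub_cos_pos_of_sin_pos hθ) _)
    (Real.rpow_pos_of_pos (one_add_cos_pos_of_sin_pos hθ) _)

lemma hasDerivAt_jacobiGauge (α β : ℝ) {θ : ℝ} (hθ : 0 < Real.sin θ) :
    HasDerivAt (jacobiGauge α β) (2 * jacobiDrift α β θ * jacobiGauge α β θ) θ := by
  have h1 := one_sub_cos_pos_of_sin_pos hθ
  have h2 := one_add_cos_pos_of_sin_pos hθ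
  have h := (((Real.hasDerivAt_cos θ).const_sub 1).rpow_const (p := α + 1 / 2)
    (Or.inl h1.ne')).mul (((Real.hasDerivAt_cos θ).const_add 1).rpow_const (p := β + 1 / 2)
    (Or.inl h2.ne'))
  refine h.congr_deriv ?_
  unfold jacobiDrift jacobiGauge
  rw [Real.rpow_sub_one h1.ne', Real.rpow_sub_one h2.ne']
  have hs := Real.sin_sq_add_cos_sq θ
  field_simp
  linear_combination ((1 + Real.cos θ) * (1 + 2 * α) - (1 - Real.cos θ) * (2 * β + 1)) * hs

lemma abs_jacobiDrift_le (α β : ℝ) {θ : ℝ} (hθ : 0 < Real.sin θ) :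
    |jacobiDrift α β θ| ≤ jacobiBound α β / Real.sin θ := by
  unfold jacobiDrift jacobiBound
  rw [abs_div, abs_of_pos (by positivity : 0 < 2 * Real.sin θ), div_le_div_iff₀ (by positivity) hθ]
  have hc := Real.cos_le_one θ
  have hc' := Real.neg_one_le_cos θ
  have : |(α - β) + (α + β + 1) * Real.cos θ| ≤ 2 * (|α| + |β| + 1) := by
    rw [abs_le]
    constructor <;> cases abs_cases α <;> cases abs_cases β <;> nlinarith
  nlinarith

lemma abs_jacobiDriftDeriv_le (α β : ℝ) {θ : ℝ} (hθ : 0 < Real.sin θ) :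
    |jacobiDriftDeriv α β θ| ≤ jacobiBound α β / Real.sin θ ^ 2 := by
  unfold jacobiDriftDeriv jacobiBound
  rw [abs_div, abs_of_pos (by positivity : 0 < 2 * Real.sin θ ^ 2),
    div_le_div_iff₀ (by positivity) (by positivity)]
  have hc := Real.cos_le_one θ
  have hc' := Real.neg_one_le_cos θ
  have : |(-((α + β + 1) + (α - β) * Real.cos θ))| ≤ 2 * (|α| + |β| + 1) := by
    rw [abs_le]
    constructor <;> cases abs_cases α <;> cases abs_cases β <;> nlinarith
  nlinarith [pow_pos hθ 2]

lemma jacobiEnergy_cos (N : ℝ) (y : ℝ[X]) (θ : ℝ) :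
    jacobiEnergy N y (Real.cos θ) = angularDeriv y θ ^ 2 + N ^ 2 * y.eval (Real.cos θ) ^ 2 := by
  unfold jacobiEnergy angularDeriv
  rw [← Real.sin_sq]; ring

lemma jacobiEnergy_cos_nonneg (N : ℝ) (y : ℝ[X]) (θ : ℝ) : 0 ≤ jacobiEnergy N y (Real.cos θ) := by
  rw [jacobiEnergy_cos]; positivity

lemma JacobiODE.hasDerivAt_energy {α β N : ℝ} {y : ℝ[X]} (hy : JacobiODE α β N y) {θ : ℝ}
    (hθ : 0 < Real.sin θ) :
    HasDerivAt (fun θ => jacobiEnergy N y (Real.cos θ))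
      (-4 * jacobiDrift α β θ * angularDeriv y θ ^ 2) θ := by
  simp only [jacobiEnergy_cos]
  refine (((hy.hasDerivAt_angularDeriv hθ).fun_pow 2).add
    (((hasDerivAt_eval_cos y θ).fun_pow 2).const_mul (N ^ 2))).congr_deriv ?_
  push_cast; ring

/-- The sine is bounded below on an interval by its values at the end points. -/
lemma le_sin_of_mem_Icc {s a b x : ℝ} (ha : 0 ≤ a) (hb : b ≤ Real.pi) (hx : x ∈ Icc a b)
    (hsa : s ≤ Real.sin a) (hsb : s ≤ Real.sin b) : s ≤ Real.sin x := by
  have h := strictConcaveOn_sin_Icc.concaveOn.min_le_of_mem_Icc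
    (⟨ha, hx.1.trans (hx.2.trans hb)⟩ : a ∈ Icc 0 Real.pi) ⟨ha.trans (hx.1.trans hx.2), hb⟩ hx
  exact (le_min hsa hsb).trans h

/-- Local comparability of the energy. -/
lemma JacobiODE.energy_local {α β N s : ℝ} {y : ℝ[X]} (hy : JacobiODE α β N y) (hs : 0 < s)
    {a b : ℝ} (hab : a ≤ b) (h : ∀ x ∈ Icc a b, s ≤ Real.sin x) :
    jacobiEnergy N y (Real.cos b) ≤
        jacobiEnergy N y (Real.cos a) * Real.exp (4 * jacobiBound α β / s * (b - a)) ∧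
      jacobiEnergy N y (Real.cos a) ≤
        jacobiEnergy N y (Real.cos b) * Real.exp (4 * jacobiBound α β / s * (b - a)) := by
  rw [mul_sub]
  refine gronwall_two_sided hab (k := fun _ => 4 * jacobiBound α β / s)
    (K := fun x => 4 * jacobiBound α β / s * x)
    (fun x hx => hy.hasDerivAt_energy (hs.trans_le (h x hx)))
    (fun x hx => by simpa using (hasDerivAt_id x).const_mul (4 * jacobiBound α β / s)) ?_
  intro x hx
  have hx0 := hs.trans_le (h x hx)
  have h1 : |jacobiDrift α β x| ≤ jacobiBound α β / s :=
    (abs_jacobiDrift_le α β hx0).trans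
      (div_le_div_of_nonneg_left (jacobiBound_pos α β).le hs (h x hx))
  rw [abs_mul, abs_mul, abs_of_nonneg (sq_nonneg (angularDeriv y x))]
  have h2 : angularDeriv y x ^ 2 ≤ jacobiEnergy N y (Real.cos x) := by
    rw [jacobiEnergy_cos]; nlinarith [mul_nonneg (sq_nonneg N) (sq_nonneg (y.eval (Real.cos x)))]
  have h3 := mul_le_mul h1 h2 (sq_nonneg _) (by have := jacobiBound_pos α β; positivity)
  simp only [abs_neg, Nat.abs_ofNat]
  calc _ = 4 * (|jacobiDrift α β x| * angularDeriv y x ^ 2) := by ring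
    _ ≤ 4 * (jacobiBound α β / s * jacobiEnergy N y (Real.cos x)) := by gcongr
    _ = _ := by ring

/-- Local comparability of the weighted energy. -/
lemma JacobiODE.gauge_energy_local {α β N s : ℝ} {y : ℝ[X]} (hy : JacobiODE α β N y) (hs : 0 < s)
    {a b : ℝ} (hab : a ≤ b) (h : ∀ x ∈ Icc a b, s ≤ Real.sin x) :
    jacobiGauge α β b * jacobiEnergy N y (Real.cos b) ≤
        jacobiGauge α β a * jacobiEnergy N y (Real.cos a)
          * Real.exp (2 * jacobiBound α β / s * (b - a)) ∧
      jacobiGauge α β a * jacobiEnergy N y (Real.cos a) ≤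
        jacobiGauge α β b * jacobiEnergy N y (Real.cos b)
          * Real.exp (2 * jacobiBound α β / s * (b - a)) := by
  rw [mul_sub]
  refine gronwall_two_sided hab (φ := fun x => jacobiGauge α β x * jacobiEnergy N y (Real.cos x))
    (k := fun _ => 2 * jacobiBound α β / s)
    (K := fun x => 2 * jacobiBound α β / s * x)
    (fun x hx => (hasDerivAt_jacobiGauge α β (hs.trans_le (h x hx))).mul
      (hy.hasDerivAt_energy (hs.trans_le (h x hx))))
    (fun x hx => by simpa using (hasDerivAt_id x).const_mul (2 * jacobiBound α β / s)) ?_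
  intro x hx
  have hx0 := hs.trans_le (h x hx)
  have h1 : |jacobiDrift α β x| ≤ jacobiBound α β / s :=
    (abs_jacobiDrift_le α β hx0).trans
      (div_le_div_of_nonneg_left (jacobiBound_pos α β).le hs (h x hx))
  have hg := jacobiGauge_pos α β hx0
  simp only [jacobiEnergy_cos]
  set d := angularDeriv y x
  set f := y.eval (Real.cos x)
  have h2 : |N ^ 2 * f ^ 2 - d ^ 2| ≤ d ^ 2 + N ^ 2 * f ^ 2 := by
    have := mul_nonneg (sq_nonneg N) (sq_nonneg f)
    have := sq_nonneg d
    rw [abs_le]; constructor <;> linarith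
  have h3 := mul_le_mul h1 h2 (abs_nonneg _) (by have := jacobiBound_pos α β; positivity)
  calc _ = |2 * jacobiGauge α β x * (jacobiDrift α β x * (N ^ 2 * f ^ 2 - d ^ 2))| := by
        congr 1; ring
    _ = 2 * jacobiGauge α β x * (|jacobiDrift α β x| * |N ^ 2 * f ^ 2 - d ^ 2|) := by
        rw [abs_mul, abs_mul (jacobiDrift α β x), abs_of_pos (by positivity)]
    _ ≤ 2 * jacobiGauge α β x * (jacobiBound α β / s * (d ^ 2 + N ^ 2 * f ^ 2)) := by gcongr
    _ = _ := by ring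

lemma abs_two_mul_mul_le_energy {N : ℝ} (hN : 0 < N) (y : ℝ[X]) (θ : ℝ) :
    |2 * angularDeriv y θ * y.eval (Real.cos θ)| ≤ jacobiEnergy N y (Real.cos θ) / N := by
  rw [jacobiEnergy_cos, le_div_iff₀ hN, ← abs_of_pos hN, ← abs_mul, abs_of_pos hN, abs_le]
  set d := angularDeriv y θ
  set f := y.eval (Real.cos θ)
  constructor <;> nlinarith [sq_nonneg (d + N * f), sq_nonneg (d - N * f)]

/-- The weighted energy is almost constant where `N sin θ` is large. -/
lemma JacobiODE.gauge_energy_bulk {α β N : ℝ} {y : ℝ[X]} (hy : JacobiODE α β N y) (hN : 0 < N)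
    {a b : ℝ} (hab : a ≤ b) (h : ∀ x ∈ Icc a b, 2 * jacobiBound α β ≤ N * Real.sin x) :
    jacobiGauge α β b * jacobiEnergy N y (Real.cos b) ≤
        3 * Real.exp 2 * (jacobiGauge α β a * jacobiEnergy N y (Real.cos a)) ∧
      jacobiGauge α β a * jacobiEnergy N y (Real.cos a) ≤
        3 * Real.exp 2 * (jacobiGauge α β b * jacobiEnergy N y (Real.cos b)) := by
  have hK := jacobiBound_pos α β
  have hsin : ∀ x ∈ Icc a b, 0 < Real.sin x := fun x hx => by
    by_contra hcon
    have := h x hx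
    nlinarith
  set E : ℝ → ℝ := fun x => jacobiGauge α β x * (jacobiEnergy N y (Real.cos x)
    + jacobiDrift α β x * (2 * angularDeriv y x * y.eval (Real.cos x))) with hE
  have hpert : ∀ x ∈ Icc a b, |jacobiDrift α β x * (2 * angularDeriv y x * y.eval (Real.cos x))|
      ≤ jacobiEnergy N y (Real.cos x) / 2 := fun x hx => by
    have hs := hsin x hx
    have hF := jacobiEnergy_cos_nonneg N y x
    rw [abs_mul]
    calc _ ≤ jacobiBound α β / Real.sin x * (jacobiEnergy N y (Real.cos x) / N) :=
          mul_le_mul (abs_jacobiDrift_le α β hs) (abs_two_mul_mul_le_energy hN y x)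
            (abs_nonneg _) (by positivity)
      _ = jacobiBound α β / (N * Real.sin x) * jacobiEnergy N y (Real.cos x) := by field_simp
      _ ≤ 1 / 2 * jacobiEnergy N y (Real.cos x) := by
          gcongr ?_ * _
          rw [div_le_iff₀ (by positivity)]
          linarith [h x hx]
      _ = _ := by ring
  have hElow : ∀ x ∈ Icc a b, jacobiGauge α β x * jacobiEnergy N y (Real.cos x) ≤ 2 * E x :=
    fun x hx => by
      have hg := jacobiGauge_pos α β (hsin x hx)
      have := (abs_le.1 (hpert x hx)).1
      simp only [hE]; nlinarith
  have hEup : ∀ x ∈ Icc a b, 2 * E x ≤ 3 * (jacobiGauge α β x * jacobiEnergy N y (Real.cos x)) :=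
    fun x hx => by
      have hg := jacobiGauge_pos α β (hsin x hx)
      have := (abs_le.1 (hpert x hx)).2
      simp only [hE]; nlinarith
  have key := gronwall_two_sided hab (φ := E)
    (φ' := fun x => jacobiGauge α β x * (jacobiDriftDeriv α β x *
      (2 * angularDeriv y x * y.eval (Real.cos x))))
    (K := fun x => -(2 * jacobiBound α β / N * (Real.cos x / Real.sin x)))
    (k := fun x => 2 * jacobiBound α β / N / Real.sin x ^ 2)
    (fun x hx => by
      have hs := hsin x hx
      refine ((hasDerivAt_jacobiGauge α β hs).mul ((hy.hasDerivAt_energy hs).add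
        ((hasDerivAt_jacobiDrift α β hs).mul (((hy.hasDerivAt_angularDeriv hs).const_mul 2).mul
          (hasDerivAt_eval_cos y x))))).congr_deriv ?_
      simp only [jacobiEnergy_cos, Pi.add_apply, Pi.mul_apply]
      ring)
    (fun x hx => by
      have hs := hsin x hx
      refine (((Real.hasDerivAt_cos x).div (Real.hasDerivAt_sin x) hs.ne').const_mul
        (2 * jacobiBound α β / N)).neg.congr_deriv ?_
      have := Real.sin_sq_add_cos_sq x
      field_simp
      linear_combination this)
    (fun x hx => by
      have hs := hsin x hx
      have hg := jacobiGauge_pos α β hs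
      have hF := jacobiEnergy_cos_nonneg N y x
      rw [abs_mul, abs_mul, abs_of_pos hg]
      calc _ ≤ jacobiGauge α β x * (jacobiBound α β / Real.sin x ^ 2 *
            (jacobiEnergy N y (Real.cos x) / N)) := by
            gcongr
            · exact abs_jacobiDriftDeriv_le α β hs
            · exact abs_two_mul_mul_le_energy hN y x
        _ = jacobiBound α β / N / Real.sin x ^ 2 *
            (jacobiGauge α β x * jacobiEnergy N y (Real.cos x)) := by field_simp
        _ ≤ jacobiBound α β / N / Real.sin x ^ 2 * (2 * E x) := by
            exact mul_le_mul_of_nonneg_left (hElow x hx) (by positivity)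
        _ = _ := by ring)
  have hexp : -(2 * jacobiBound α β / N * (Real.cos b / Real.sin b))
      - -(2 * jacobiBound α β / N * (Real.cos a / Real.sin a)) ≤ 2 := by
    have hcot : ∀ x ∈ Icc a b,
        |2 * jacobiBound α β / N * (Real.cos x / Real.sin x)| ≤ 1 := fun x hx => by
      have hs := hsin x hx
      have h1 : 2 * jacobiBound α β / N * (Real.cos x / Real.sin x)
          = (2 * jacobiBound α β) * Real.cos x / (N * Real.sin x) := by field_simp
      rw [h1, abs_div, abs_of_pos (by positivity : 0 < N * Real.sin x),
        div_le_one (by positivity), abs_mul, abs_of_pos (by positivity : 0 < 2 * jacobiBound α β)]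
      nlinarith [h x hx, Real.abs_cos_le_one x]
    have h1 := (abs_le.1 (hcot a (left_mem_Icc.2 hab))).2
    have h2 := (abs_le.1 (hcot b (right_mem_Icc.2 hab))).1
    linarith
  have hexp' := Real.exp_le_exp.2 hexp
  have hEnn : ∀ x ∈ Icc a b, 0 ≤ E x := fun x hx => by
    have := hElow x hx
    have := mul_nonneg (jacobiGauge_pos α β (hsin x hx)).le (jacobiEnergy_cos_nonneg N y x)
    linarith
  have ha := left_mem_Icc.2 hab
  have hb := right_mem_Icc.2 hab
  have e2 := Real.exp_pos 2
  constructor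
  · have h1 := key.1.trans (mul_le_mul_of_nonneg_left hexp' (hEnn a ha))
    have h2 := hElow b hb
    have h3 := mul_le_mul_of_nonneg_right (hEup a ha) e2.le
    linarith
  · have h1 := key.2.trans (mul_le_mul_of_nonneg_left hexp' (hEnn b hb))
    have h2 := hElow a ha
    have h3 := mul_le_mul_of_nonneg_right (hEup b hb) e2.le
    linarith

/-- The weighted energy is comparable to the energy at `t = 0` as soon as `N sin θ` is bounded
away from zero. -/
lemma gauge_energy_comparable (α β c : ℝ) (hc : 0 < c) :
    ∃ K : ℝ, 1 ≤ K ∧ ∀ N : ℝ, 2 * jacobiBound α β ≤ N → ∀ y : ℝ[X], JacobiODE α β N y →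
      ∀ θ ∈ Icc 0 Real.pi, c ≤ N * Real.sin θ →
        jacobiGauge α β θ * jacobiEnergy N y (Real.cos θ) ≤ K * jacobiEnergy N y 0 ∧
        jacobiEnergy N y 0 ≤ K * (jacobiGauge α β θ * jacobiEnergy N y (Real.cos θ)) := by
  have hB := jacobiBound_pos α β
  set B := jacobiBound α β with hBdef
  set L := Real.exp (2 * B / c * (Real.pi * B)) with hL
  have hL1 : 1 ≤ L := Real.one_le_exp (by have := Real.pi_pos; positivity)
  have he2 : 1 ≤ 3 * Real.exp 2 := by linarith [Real.one_le_exp (zero_le_two (α := ℝ))]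
  refine ⟨L * (3 * Real.exp 2), one_le_mul_of_one_le_of_one_le hL1 he2, ?_⟩
  intro N hN2 y hy
  have hN : 0 < N := by linarith
  have hmid : jacobiGauge α β (Real.pi / 2) * jacobiEnergy N y (Real.cos (Real.pi / 2))
      = jacobiEnergy N y 0 := by
    simp [jacobiGauge]
  have hpi := Real.pi_pos
  have bulk : ∀ θ ∈ Icc 0 Real.pi, 2 * B ≤ N * Real.sin θ →
      jacobiGauge α β θ * jacobiEnergy N y (Real.cos θ) ≤
        3 * Real.exp 2 * jacobiEnergy N y 0 ∧
      jacobiEnergy N y 0 ≤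
        3 * Real.exp 2 * (jacobiGauge α β θ * jacobiEnergy N y (Real.cos θ)) := by
    intro θ hθ h
    have h1 : 2 * B / N ≤ Real.sin θ := by rw [div_le_iff₀ hN]; linarith
    have h2 : 2 * B / N ≤ Real.sin (Real.pi / 2) := by
      rw [Real.sin_pi_div_two, div_le_one hN]; exact hN2
    rcases le_total θ (Real.pi / 2) with hle | hle
    · have := hy.gauge_energy_bulk hN hle (fun x hx => by
        have := le_sin_of_mem_Icc hθ.1 (by linarith) hx h1 h2
        rw [div_le_iff₀ hN] at this; linarith)
      rw [hmid] at this
      exact this.symm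
    · have := hy.gauge_energy_bulk hN hle (fun x hx => by
        have := le_sin_of_mem_Icc (by linarith) hθ.2 hx h2 h1
        rw [div_le_iff₀ hN] at this; linarith)
      rw [hmid] at this
      exact this
  intro θ hθ hcθ
  by_cases hbulk : 2 * B ≤ N * Real.sin θ
  · obtain ⟨h1, h2⟩ := bulk θ hθ hbulk
    have hE : 0 ≤ jacobiEnergy N y 0 := by
      have := jacobiEnergy_cos_nonneg N y (Real.pi / 2); rwa [Real.cos_pi_div_two] at this
    have hE' : 0 ≤ jacobiGauge α β θ * jacobiEnergy N y (Real.cos θ) := by nlinarith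
    constructor
    · rw [mul_assoc]; exact h1.trans (le_mul_of_one_le_left (by positivity) hL1)
    · rw [mul_assoc]; exact h2.trans (le_mul_of_one_le_left (by positivity) hL1)
  · push Not at hbulk
    have hcN : c / N ≤ Real.sin θ := by rw [div_le_iff₀ hN]; linarith
    have hc2 : c / N ≤ 2 * B / N := by gcongr; linarith
    have hB1 : 2 * B / N ≤ 1 := by rw [div_le_one hN]; exact hN2
    have hB0 : 0 < 2 * B / N := by positivity
    set θ₀ := Real.arcsin (2 * B / N) with hθ₀
    have hsin : Real.sin θ₀ = 2 * B / N := Real.sin_arcsin (by linarith) hB1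
    have h00 : 0 ≤ θ₀ := Real.arcsin_nonneg.2 hB0.le
    have h01 : θ₀ ≤ Real.pi / 2 := Real.arcsin_le_pi_div_two _
    have hlen : θ₀ ≤ Real.pi * B / N := by
      have := Real.mul_le_sin h00 h01
      rw [hsin] at this
      rw [le_div_iff₀ hN]
      rw [le_div_iff₀ hN] at this
      field_simp at this
      linarith
    have hbθ₀ := bulk θ₀ ⟨h00, by linarith⟩ (by rw [hsin]; field_simp; rfl)
    have hbθ₁ := bulk (Real.pi - θ₀) ⟨by linarith, by linarith⟩
      (by rw [Real.sin_pi_sub, hsin]; field_simp; rfl)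
    have hexp : ∀ d : ℝ, d ≤ θ₀ → Real.exp (2 * B / (c / N) * d) ≤ L := fun d hd => by
      rw [hL]
      apply Real.exp_le_exp.2
      calc _ ≤ 2 * B / (c / N) * (Real.pi * B / N) := by gcongr; exact hd.trans hlen
        _ = _ := by field_simp
    have conclude : ∀ a b e M : ℝ, 0 ≤ a → 0 ≤ M → 0 < e → e ≤ L → (b ≤ a * e ∧ a ≤ b * e) →
        (a ≤ 3 * Real.exp 2 * M ∧ M ≤ 3 * Real.exp 2 * a) →
        b ≤ L * (3 * Real.exp 2) * M ∧ M ≤ L * (3 * Real.exp 2) * b := by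
      intro a b e M ha hM he heL h1 h2
      have e2 := Real.exp_pos 2
      have hb : 0 ≤ b := by
        by_contra hcon
        have := mul_neg_of_neg_of_pos (not_le.1 hcon) he
        linarith [h1.2]
      constructor
      · calc b ≤ a * e := h1.1
          _ ≤ (3 * Real.exp 2 * M) * L := mul_le_mul h2.1 heL he.le (by positivity)
          _ = _ := by ring
      · calc M ≤ 3 * Real.exp 2 * a := h2.2
          _ ≤ 3 * Real.exp 2 * (b * L) := by
              gcongr; exact h1.2.trans (mul_le_mul_of_nonneg_left heL hb)
          _ = _ := by ring
    have hE : 0 ≤ jacobiEnergy N y 0 := by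
      have := jacobiEnergy_cos_nonneg N y (Real.pi / 2); rwa [Real.cos_pi_div_two] at this
    rcases le_total θ (Real.pi / 2) with hle | hle
    · have hθθ : θ ≤ θ₀ := by
        by_contra hcon
        have := Real.sin_le_sin_of_le_of_le_pi_div_two (by linarith) hle (not_le.1 hcon).le
        rw [hsin, div_le_iff₀ hN] at this
        linarith
      have hloc := hy.gauge_energy_local (by positivity : 0 < c / N) hθθ (fun x hx =>
        le_sin_of_mem_Icc hθ.1 (by linarith) hx hcN (by rw [hsin]; exact hc2))
      refine conclude _ _ _ _ ?_ hE (Real.exp_pos _) (hexp (θ₀ - θ) (by linarith [hθ.1]))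
        hloc.symm hbθ₀
      exact mul_nonneg (jacobiGauge_pos α β (by rw [hsin]; exact hB0)).le
        (jacobiEnergy_cos_nonneg N y _)
    · have hθθ : Real.pi - θ₀ ≤ θ := by
        by_contra hcon
        have := Real.sin_le_sin_of_le_of_le_pi_div_two (x := θ₀) (y := Real.pi - θ)
          (by linarith) (by linarith) (by linarith)
        rw [hsin, Real.sin_pi_sub, div_le_iff₀ hN] at this
        linarith
      have hloc := hy.gauge_energy_local (by positivity : 0 < c / N) hθθ (fun x hx =>
        le_sin_of_mem_Icc (by linarith) hθ.2 hx (by rw [Real.sin_pi_sub, hsin]; exact hc2) hcN)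
      refine conclude _ _ _ _ ?_ hE (Real.exp_pos _)
        (hexp (θ - (Real.pi - θ₀)) (by linarith [hθ.2])) hloc hbθ₁
      exact mul_nonneg (jacobiGauge_pos α β (by rw [Real.sin_pi_sub, hsin]; exact hB0)).le
        (jacobiEnergy_cos_nonneg N y _)

lemma JacobiODE.eval_one_ne_zero {α β N : ℝ} {y : ℝ[X]} (hy : JacobiODE α β N y) (hα : -1 < α)
    (hβ : -1 < β) (hN : 0 < N) (hN2 : α + β + 2 ≤ 4 * N ^ 2) (hy0 : y ≠ 0) : y.eval 1 ≠ 0 := by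
  intro h
  have hα1 : 0 < α + 1 := by linarith
  apply hy0
  refine Polynomial.eq_zero_of_infinite_isRoot y
    (Set.Infinite.mono ?_ (Ioo_infinite (a := 1 - (α + 1) / 4 / N ^ 2) (b := 1) ?_))
  · intro t ht
    have := (hy.near_one hα hβ hN hN2 ht.2.le (by linarith [ht.1])).1
    rw [h] at this
    simp at this
    exact this
  · have : 0 < (α + 1) / 4 / N ^ 2 := by positivity
    linarith

lemma JacobiODE.lt_one_sub_of_isRoot {α β N : ℝ} {y : ℝ[X]} (hy : JacobiODE α β N y) (hα : -1 < α)
    (hβ : -1 < β) (hN : 0 < N) (hN2 : α + β + 2 ≤ 4 * N ^ 2) (hy0 : y ≠ 0) {t : ℝ}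
    (ht1 : t ≤ 1) (ht0 : -1 ≤ t) (ht : y.eval t = 0) : (α + 1) / 4 / N ^ 2 < 1 - t := by
  by_contra hcon
  have h1 := (hy.energy_near_one hα hβ hN hN2 ht1 ht0 (not_lt.1 hcon)).1
  rw [ht] at h1
  have h2 := pow_pos (abs_pos.2 (hy.eval_one_ne_zero hα hβ hN hN2 hy0)) 2
  rw [sq_abs] at h2
  linarith

/-- The roots of a Jacobi polynomial keep a distance of order `1/N` from the end points. -/
lemma JacobiODE.le_mul_sin_of_isRoot {α β N : ℝ} {y : ℝ[X]} (hy : JacobiODE α β N y) (hα : -1 < α)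
    (hβ : -1 < β) (hN : 0 < N) (hN2 : α + β + 2 ≤ 4 * N ^ 2) (hy0 : y ≠ 0) {θ : ℝ}
    (hθ : θ ∈ Icc 0 Real.pi) (h : y.eval (Real.cos θ) = 0) :
    √(min (α + 1) (β + 1) / 4) ≤ N * Real.sin θ := by
  have hs0 := Real.sin_nonneg_of_mem_Icc hθ
  refine Real.sqrt_le_iff.2 ⟨by positivity, ?_⟩
  have h1 := hy.lt_one_sub_of_isRoot hα hβ hN hN2 hy0 (Real.cos_le_one θ) (Real.neg_one_le_cos θ) h
  have hy0' : y.comp (-X) ≠ 0 := by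
    intro h0
    apply hy0
    have : (y.comp (-X)).comp (-X) = 0 := by rw [h0]; simp
    rw [comp_assoc] at this
    simpa using this
  have h2 := hy.comp_neg_X.lt_one_sub_of_isRoot hβ hα hN (by linarith) hy0' (t := -Real.cos θ)
    (by linarith [Real.neg_one_le_cos θ]) (by linarith [Real.cos_le_one θ]) (by simpa using h)
  rw [div_lt_iff₀ (by positivity)] at h1 h2
  have hm1 := min_le_left (α + 1) (β + 1)
  have hm2 := min_le_right (α + 1) (β + 1)
  have hs := Real.sin_sq_add_cos_sq θ
  have hNpos := pow_pos hN 2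
  have e : (N * Real.sin θ) ^ 2 = (1 - Real.cos θ) * (1 + Real.cos θ) * N ^ 2 := by
    rw [mul_pow]; linear_combination N ^ 2 * hs
  rw [e]
  rcases le_total 0 (Real.cos θ) with hc | hc
  · nlinarith [mul_nonneg (mul_nonneg hc (by linarith [Real.cos_le_one θ] : 0 ≤ 1 - Real.cos θ))
      hNpos.le]
  · nlinarith [mul_nonneg (mul_nonneg (neg_nonneg.2 hc)
      (by linarith [Real.neg_one_le_cos θ] : 0 ≤ 1 + Real.cos θ)) hNpos.le]

/-- Distinct roots are at angular distance at least of order `1/N`. -/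
lemma root_gap_lower (α β c : ℝ) (hc : 0 < c) :
    ∃ ε : ℝ, 0 < ε ∧ ∀ N : ℝ, 2 * jacobiBound α β ≤ N → ∀ y : ℝ[X], JacobiODE α β N y →
      0 < jacobiEnergy N y 0 → ∀ a b : ℝ, 0 ≤ a → a < b → b ≤ Real.pi → c ≤ N * Real.sin a →
        c ≤ N * Real.sin b → y.eval (Real.cos a) = 0 → y.eval (Real.cos b) = 0 →
          ε ≤ N * (b - a) := by
  obtain ⟨K, hK1, hK⟩ := gauge_energy_comparable α β c hc
  have hB := jacobiBound_pos α β
  set D := Real.exp (4 * jacobiBound α β / c) with hD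
  have hD1 : 1 ≤ D := Real.one_le_exp (by positivity)
  refine ⟨1 / D, by positivity, ?_⟩
  intro N hN2 y hy hE a b ha hab hb hca hcb hya hyb
  have hN : 0 < N := by linarith
  by_contra! hcon
  have hba : 0 < b - a := by linarith
  have hsin : ∀ x ∈ Icc a b, c / N ≤ Real.sin x := fun x hx =>
    le_sin_of_mem_Icc ha hb hx (by rw [div_le_iff₀ hN]; linarith) (by rw [div_le_iff₀ hN]; linarith)
  obtain ⟨ξ, hξ, hξ0⟩ := exists_hasDerivAt_eq_zero (f := fun θ => y.eval (Real.cos θ))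
    (f' := angularDeriv y) hab
    (fun x _ => (hasDerivAt_eval_cos y x).continuousAt.continuousWithinAt) (by simp [hya, hyb])
    (fun x _ => hasDerivAt_eval_cos y x)
  obtain ⟨η, hη, hη0⟩ := exists_hasDerivAt_eq_slope (f := fun θ => y.eval (Real.cos θ))
    (f' := angularDeriv y) hξ.1
    (fun x _ => (hasDerivAt_eval_cos y x).continuousAt.continuousWithinAt)
    (fun x _ => hasDerivAt_eval_cos y x)
  have hξI : ξ ∈ Icc a b := ⟨hξ.1.le, hξ.2.le⟩
  have hFpos : 0 < jacobiEnergy N y (Real.cos ξ) := by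
    have hs := hsin ξ hξI
    have hg := jacobiGauge_pos α β ((by positivity : 0 < c / N).trans_le hs)
    have := (hK N hN2 y hy ξ ⟨ha.trans hξI.1, hξI.2.trans hb⟩
      (by rw [div_le_iff₀ hN] at hs; linarith)).2
    by_contra hcon'
    have h3 : jacobiGauge α β ξ * jacobiEnergy N y (Real.cos ξ) ≤ 0 :=
      mul_nonpos_of_nonneg_of_nonpos hg.le (not_lt.1 hcon')
    nlinarith
  have hloc := (hy.energy_local (by positivity : 0 < c / N) (hη.2.le : η ≤ ξ) (fun x hx =>
    hsin x ⟨hη.1.le.trans hx.1, hx.2.trans hξI.2⟩)).2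
  have hexp : Real.exp (4 * jacobiBound α β / (c / N) * (ξ - η)) ≤ D := by
    rw [hD]
    apply Real.exp_le_exp.2
    have : N * (ξ - η) ≤ 1 := by
      have h1 : ξ - η ≤ b - a := by linarith [hη.1, hξ.2]
      have h2 : 1 / D ≤ 1 := by rw [div_le_one (by positivity)]; exact hD1
      nlinarith
    calc _ = 4 * jacobiBound α β / c * (N * (ξ - η)) := by field_simp
      _ ≤ 4 * jacobiBound α β / c * 1 := by gcongr
      _ = _ := mul_one _
  have hloc' := hloc.trans (mul_le_mul_of_nonneg_left hexp hFpos.le)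
  have h1 : angularDeriv y η ^ 2 ≤ jacobiEnergy N y (Real.cos η) := by
    rw [jacobiEnergy_cos]
    nlinarith [mul_nonneg (sq_nonneg N) (sq_nonneg (y.eval (Real.cos η)))]
  rw [hya, sub_zero, eq_div_iff (by linarith [hξ.1])] at hη0
  have h2 : jacobiEnergy N y (Real.cos ξ)
      = (N * (ξ - a)) ^ 2 * angularDeriv y η ^ 2 := by
    rw [jacobiEnergy_cos, hξ0, ← hη0]; ring
  have h3 : (N * (ξ - a)) ^ 2 < (1 / D) ^ 2 := by
    refine pow_lt_pow_left₀ ?_ (mul_nonneg hN.le (by linarith [hξ.1])) two_ne_zero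
    nlinarith [hξ.2]
  have h4 : jacobiEnergy N y (Real.cos ξ) ≤
      (N * (ξ - a)) ^ 2 * (jacobiEnergy N y (Real.cos ξ) * D) := by
    nth_rewrite 1 [h2]
    exact mul_le_mul_of_nonneg_left (h1.trans hloc') (sq_nonneg _)
  have h5 : (N * (ξ - a)) ^ 2 * (jacobiEnergy N y (Real.cos ξ) * D) <
      (1 / D) ^ 2 * (jacobiEnergy N y (Real.cos ξ) * D) :=
    mul_lt_mul_of_pos_right h3 (by positivity)
  have h6 : (1 / D) ^ 2 * (jacobiEnergy N y (Real.cos ξ) * D) ≤ jacobiEnergy N y (Real.cos ξ) := by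
    have : (1 / D) ^ 2 * (jacobiEnergy N y (Real.cos ξ) * D)
        = jacobiEnergy N y (Real.cos ξ) / D := by field_simp
    rw [this]
    exact div_le_self hFpos.le hD1
  linarith

lemma two_mul_jacobiDrift_half (α β θ : ℝ) :
    2 * jacobiDrift (α / 2 - 1 / 4) (β / 2 - 1 / 4) θ = jacobiDrift α β θ := by
  unfold jacobiDrift
  ring

/-- Sturm comparison: a solution cannot be positive on a long interval. -/
lemma JacobiODE.not_pos_on_Ioo {α β N : ℝ} {y : ℝ[X]} (hy : JacobiODE α β N y) (hN : 0 < N)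
    {a : ℝ}
    (h : ∀ x ∈ Icc a (a + 2 * Real.pi / N), 2 * jacobiBound α β ≤ N * Real.sin x)
    (hpos : ∀ x ∈ Ioo a (a + 2 * Real.pi / N), 0 < y.eval (Real.cos x)) : False := by
  set b := a + 2 * Real.pi / N with hb
  have hB := jacobiBound_pos α β
  have hB1 : 1 ≤ jacobiBound α β := by unfold jacobiBound; linarith [abs_nonneg α, abs_nonneg β]
  have hpi := Real.pi_pos
  have hab : a < b := by rw [hb]; have : 0 < 2 * Real.pi / N := by positivity
                         linarith
  have hsin : ∀ x ∈ Icc a b, 0 < Real.sin x := fun x hx => by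
    by_contra hcon
    have := h x hx
    nlinarith
  set g := jacobiGauge (α / 2 - 1 / 4) (β / 2 - 1 / 4) with hg
  set W : ℝ → ℝ := fun x => g x * ((angularDeriv y x + jacobiDrift α β x * y.eval (Real.cos x)) *
    Real.sin (N / 2 * (x - a)) - y.eval (Real.cos x) * (N / 2 * Real.cos (N / 2 * (x - a)))) with hW
  have hWd : ∀ x ∈ Icc a b, HasDerivAt W (g x * Real.sin (N / 2 * (x - a)) * y.eval (Real.cos x) *
      (jacobiDrift α β x ^ 2 + jacobiDriftDeriv α β x - N ^ 2 + (N / 2) ^ 2)) x := fun x hx => by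
    have hs := hsin x hx
    have hlin : HasDerivAt (fun x => N / 2 * (x - a)) (N / 2) x := by
      simpa using ((hasDerivAt_id x).sub_const a).const_mul (N / 2)
    have hgd : HasDerivAt g (jacobiDrift α β x * g x) x :=
      (hasDerivAt_jacobiGauge (α / 2 - 1 / 4) (β / 2 - 1 / 4) hs).congr_deriv (by
        rw [two_mul_jacobiDrift_half])
    refine (hgd.mul ((((hy.hasDerivAt_angularDeriv hs).add ((hasDerivAt_jacobiDrift α β hs).mul
      (hasDerivAt_eval_cos y x))).mul hlin.sin).sub ((hasDerivAt_eval_cos y x).mul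
        (hlin.cos.const_mul (N / 2))))).congr_deriv ?_
    simp only [Pi.add_apply, Pi.mul_apply, Pi.sub_apply]
    ring
  have hanti : StrictAntiOn W (Icc a b) := by
    refine strictAntiOn_of_deriv_neg (convex_Icc a b)
      (fun x hx => (hWd x hx).continuousAt.continuousWithinAt) fun x hx => ?_
    rw [interior_Icc] at hx
    have hxI : x ∈ Icc a b := Ioo_subset_Icc_self hx
    rw [(hWd x hxI).deriv]
    have hs := hsin x hxI
    refine mul_neg_of_pos_of_neg (mul_pos (mul_pos (jacobiGauge_pos _ _ hs) ?_) (hpos x hx)) ?_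
    · refine Real.sin_pos_of_pos_of_lt_pi (by have := hx.1; nlinarith) ?_
      have : x - a < 2 * Real.pi / N := by linarith [hx.2]
      rw [lt_div_iff₀ hN] at this
      linarith
    · have h1 := abs_jacobiDrift_le α β hs
      have h2 := (abs_le.1 (abs_jacobiDriftDeriv_le α β hs)).2
      have h3 : jacobiBound α β / Real.sin x ≤ N / 2 := by
        rw [div_le_iff₀ hs]; linarith [h x hxI]
      have h4 : jacobiDrift α β x ^ 2 ≤ (N / 2) ^ 2 := by
        rw [← sq_abs]; exact pow_le_pow_left₀ (abs_nonneg _) (h1.trans h3) 2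
      have h5 : jacobiBound α β / Real.sin x ^ 2 ≤ (N / 2) ^ 2 := by
        calc _ ≤ (jacobiBound α β / Real.sin x) ^ 2 := by
              rw [div_pow]
              gcongr
              nlinarith
          _ ≤ _ := pow_le_pow_left₀ (by positivity) h3 2
      have := pow_pos hN 2
      linarith
  have hlt := hanti (left_mem_Icc.2 hab.le) (right_mem_Icc.2 hab.le) hab
  have hnn : ∀ x ∈ Icc a b, 0 ≤ y.eval (Real.cos x) := by
    have hcl : closure (Ioo a b) ⊆ {x | 0 ≤ y.eval (Real.cos x)} :=
      closure_minimal (fun x hx => (hpos x hx).le)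
        (isClosed_le continuous_const (by fun_prop))
    rwa [closure_Ioo hab.ne] at hcl
  have ha : W a = -(g a * (y.eval (Real.cos a) * (N / 2))) := by simp [hW]
  have hb' : W b = g b * (y.eval (Real.cos b) * (N / 2)) := by
    have : N / 2 * (b - a) = Real.pi := by rw [hb]; field_simp; ring
    simp [hW, this]
  have h1 := hnn a (left_mem_Icc.2 hab.le)
  have h2 := hnn b (right_mem_Icc.2 hab.le)
  have h3 : 0 < g a := jacobiGauge_pos _ _ (hsin a (left_mem_Icc.2 hab.le))
  have h4 : 0 < g b := jacobiGauge_pos _ _ (hsin b (right_mem_Icc.2 hab.le))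
  have h5 : 0 ≤ g a * (y.eval (Real.cos a) * (N / 2)) := by positivity
  have h6 : 0 ≤ g b * (y.eval (Real.cos b) * (N / 2)) := by positivity
  linarith

lemma JacobiODE.neg {α β N : ℝ} {y : ℝ[X]} (hy : JacobiODE α β N y) : JacobiODE α β N (-y) := by
  intro t
  have := hy t
  simp only [derivative_neg, eval_neg]
  linear_combination -this

/-- Every angular interval of length `2π/N` in the bulk contains a root. -/
lemma JacobiODE.exists_root_Ioo {α β N : ℝ} {y : ℝ[X]} (hy : JacobiODE α β N y) (hN : 0 < N)
    {a : ℝ}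
    (h : ∀ x ∈ Icc a (a + 2 * Real.pi / N), 2 * jacobiBound α β ≤ N * Real.sin x) :
    ∃ x ∈ Ioo a (a + 2 * Real.pi / N), y.eval (Real.cos x) = 0 := by
  by_contra! hcon
  have hcont : ContinuousOn (fun x => y.eval (Real.cos x)) (Ioo a (a + 2 * Real.pi / N)) := by
    fun_prop
  have hsign : (∀ x ∈ Ioo a (a + 2 * Real.pi / N), 0 < y.eval (Real.cos x)) ∨
      (∀ x ∈ Ioo a (a + 2 * Real.pi / N), y.eval (Real.cos x) < 0) := by
    by_contra! hc
    obtain ⟨⟨u, hu, hu0⟩, ⟨v, hv, hv0⟩⟩ := hc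
    obtain ⟨w, hw, hw0⟩ := isPreconnected_Ioo.intermediate_value hu hv hcont ⟨hu0, hv0⟩
    exact hcon w hw hw0
  rcases hsign with hs | hs
  · exact hy.not_pos_on_Ioo hN h hs
  · exact hy.neg.not_pos_on_Ioo hN h (fun x hx => by simpa using hs x hx)

lemma succ_mul_le_of_gap {n : ℕ} {φ : Fin n → ℝ} {d : ℝ} (h0 : ∀ j, d ≤ φ j)
    (hgap : ∀ i j, i < j → d ≤ φ j - φ i) (j : Fin n) : ((j : ℕ) + 1) * d ≤ φ j := by
  obtain ⟨k, hk⟩ := j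
  induction k with
  | zero => simpa using h0 ⟨0, hk⟩
  | succ k ih =>
    have h1 := ih (by omega)
    have h2 := hgap ⟨k, by omega⟩ ⟨k + 1, hk⟩ (by simp [Fin.lt_def])
    push_cast at h1 ⊢
    linarith

/-- Upper bound for the `k`-th angular root. -/
lemma JacobiODE.root_le {α β N : ℝ} {y : ℝ[X]} (hy : JacobiODE α β N y) (hN : 0 < N) {n : ℕ}
    {θ : Fin n → ℝ} (hθ : StrictMono θ) (hpi : ∀ j, θ j ≤ Real.pi)
    (hall : ∀ x ∈ Ioo 0 Real.pi, y.eval (Real.cos x) = 0 → ∃ j, θ j = x) (k : Fin n) :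
    N * θ k ≤ 2 * Real.pi * (jacobiBound α β + 2) * ((k : ℕ) + 1) := by
  have hB := jacobiBound_pos α β
  set B := jacobiBound α β
  have hp := Real.pi_pos
  have key : ∀ m : ℕ, ∀ hm : m < n, (Real.pi * B + 2 * Real.pi * (m + 1)) / N ≤ Real.pi / 2 →
      θ ⟨m, hm⟩ ≤ (Real.pi * B + 2 * Real.pi * (m + 1)) / N := by
    have hroot : ∀ m : ℕ, (Real.pi * B + 2 * Real.pi * (m + 1)) / N ≤ Real.pi / 2 →
        ∃ j, (Real.pi * B + 2 * Real.pi * m) / N < θ j ∧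
          θ j ≤ (Real.pi * B + 2 * Real.pi * (m + 1)) / N := by
      intro m hm
      have e : (Real.pi * B + 2 * Real.pi * m) / N + 2 * Real.pi / N
          = (Real.pi * B + 2 * Real.pi * (m + 1)) / N := by ring
      have h0 : Real.pi * B / N ≤ (Real.pi * B + 2 * Real.pi * m) / N := by
        gcongr; linarith [show 0 ≤ 2 * Real.pi * (m : ℝ) by positivity]
      have h1 : 0 < Real.pi * B / N := by positivity
      obtain ⟨x, hx, hx0⟩ := hy.exists_root_Ioo hN (a := (Real.pi * B + 2 * Real.pi * m) / N)
        (fun x hx => by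
          rw [e] at hx
          have h2 := Real.mul_le_sin (x := x) (by linarith [hx.1]) (by linarith [hx.2])
          have h3 : Real.pi * B / N ≤ x := h0.trans hx.1
          rw [div_le_iff₀ hN] at h3
          have h4 : 2 * B ≤ N * (2 / Real.pi * x) := by
            have : N * (2 / Real.pi * x) = 2 * (x * N) / Real.pi := by ring
            rw [this, le_div_iff₀ hp]
            linarith
          exact h4.trans (mul_le_mul_of_nonneg_left h2 hN.le))
      rw [e] at hx
      obtain ⟨j, hj⟩ := hall x ⟨by linarith [hx.1], by linarith [hx.2]⟩ hx0
      exact ⟨j, by rw [hj]; exact hx.1, by rw [hj]; exact hx.2.le⟩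
    intro m
    induction m with
    | zero =>
      intro hm h
      obtain ⟨j, -, hj⟩ := hroot 0 h
      exact (hθ.monotone (show (⟨0, hm⟩ : Fin n) ≤ j by simp [Fin.le_def])).trans hj
    | succ m ih =>
      intro hm h
      obtain ⟨j, hj1, hj⟩ := hroot (m + 1) h
      have h3 := ih (by omega) (le_trans (by gcongr; simp) h)
      push_cast at hj1
      have h4 : (⟨m, by omega⟩ : Fin n) < j := hθ.lt_iff_lt.1 (h3.trans_lt hj1)
      exact (hθ.monotone (show (⟨m + 1, hm⟩ : Fin n) ≤ j by
        simp only [Fin.lt_def, Fin.le_def] at h4 ⊢; omega)).trans hj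
  have hk0 : (0 : ℝ) ≤ (k : ℕ) := by positivity
  have hle : Real.pi * B + 2 * Real.pi * ((k : ℕ) + 1) ≤
      Real.pi * (B + 2) * ((k : ℕ) + 1) := by
    nlinarith [mul_nonneg (mul_nonneg hp.le hB.le) hk0]
  have hnn : 0 ≤ Real.pi * (B + 2) * ((k : ℕ) + 1) := by positivity
  rcases le_or_gt ((Real.pi * B + 2 * Real.pi * ((k : ℕ) + 1)) / N) (Real.pi / 2) with h | h
  · have := key k k.2 h
    rw [le_div_iff₀ hN] at this
    linarith
  · rw [lt_div_iff₀ hN] at h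
    have := mul_le_mul_of_nonneg_left (hpi k) hN.le
    linarith

/-- `gauge_energy_comparable` in the algebraic variable. -/
lemma weight_energy_comparable (α β c : ℝ) (hc : 0 < c) :
    ∃ K : ℝ, 1 ≤ K ∧ ∀ N : ℝ, 2 * jacobiBound α β ≤ N → ∀ y : ℝ[X], JacobiODE α β N y →
      ∀ t ∈ Icc (-1 : ℝ) 1, c ≤ N ^ 2 * (1 - t ^ 2) →
        jacobiWeight (α + 1 / 2) (β + 1 / 2) t * jacobiEnergy N y t ≤ K * jacobiEnergy N y 0 ∧
        jacobiEnergy N y 0 ≤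
          K * (jacobiWeight (α + 1 / 2) (β + 1 / 2) t * jacobiEnergy N y t) := by
  obtain ⟨K, hK1, hK⟩ := gauge_energy_comparable α β (√c) (Real.sqrt_pos.2 hc)
  refine ⟨K, hK1, fun N hN y hy t ht hct => ?_⟩
  have hN0 : 0 < N := by linarith [jacobiBound_pos α β]
  have h := hK N hN y hy (Real.arccos t) ⟨Real.arccos_nonneg t, Real.arccos_le_pi t⟩ (by
    rw [Real.sin_arccos, Real.sqrt_le_iff]
    refine ⟨by positivity, ?_⟩
    rw [mul_pow, Real.sq_sqrt (by nlinarith [ht.1, ht.2])]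
    exact hct)
  have e : jacobiGauge α β (Real.arccos t) = jacobiWeight (α + 1 / 2) (β + 1 / 2) t := by
    unfold jacobiGauge jacobiWeight
    rw [Real.cos_arccos ht.1 ht.2]
  rwa [e, Real.cos_arccos ht.1 ht.2] at h

lemma jacobiEnergy_nonneg (N : ℝ) (y : ℝ[X]) {t : ℝ} (ht : t ∈ Icc (-1 : ℝ) 1) :
    0 ≤ jacobiEnergy N y t := by
  rw [← Real.cos_arccos ht.1 ht.2]; exact jacobiEnergy_cos_nonneg _ _ _

lemma jacobiWeight_pos (α β : ℝ) {t : ℝ} (ht : t ∈ Ioo (-1 : ℝ) 1) : 0 < jacobiWeight α β t :=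
  mul_pos (Real.rpow_pos_of_pos (by linarith [ht.2]) _)
    (Real.rpow_pos_of_pos (by linarith [ht.1]) _)

lemma continuousOn_jacobiWeight (α β : ℝ) : ContinuousOn (jacobiWeight α β) (Ioo (-1 : ℝ) 1) := by
  intro t ht
  have h1 : 1 - t ≠ 0 := by linarith [ht.2]
  have h2 : 1 + t ≠ 0 := by linarith [ht.1]
  exact (((continuousAt_const.sub continuousAt_id).rpow_const (Or.inl h1)).mul
    ((continuousAt_const.add continuousAt_id).rpow_const (Or.inl h2))).continuousWithinAt

/-- The weight is bounded and bounded away from zero on compact subintervals. -/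
lemma exists_jacobiWeight_bounds (α β : ℝ) {r : ℝ} (hr0 : 0 ≤ r) (hr : r < 1) :
    ∃ K : ℝ, 1 ≤ K ∧ ∀ t ∈ Icc (-r) r, jacobiWeight α β t ≤ K ∧ 1 ≤ K * jacobiWeight α β t := by
  have hsub : Icc (-r) r ⊆ Ioo (-1 : ℝ) 1 := fun t ht => ⟨by linarith [ht.1], by linarith [ht.2]⟩
  have hne : (Icc (-r) r).Nonempty := ⟨0, by simp [hr0]⟩
  obtain ⟨a, ha, hamin⟩ := isCompact_Icc.exists_isMinOn hne
    ((continuousOn_jacobiWeight α β).mono hsub)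
  obtain ⟨b, hb, hbmax⟩ := isCompact_Icc.exists_isMaxOn hne
    ((continuousOn_jacobiWeight α β).mono hsub)
  have hpa := jacobiWeight_pos α β (hsub ha)
  refine ⟨max 1 (max (jacobiWeight α β b) (1 / jacobiWeight α β a)), le_max_left _ _,
    fun t ht => ⟨?_, ?_⟩⟩
  · exact (hbmax ht).trans ((le_max_left _ _).trans (le_max_right _ _))
  · have h1 : 1 / jacobiWeight α β a ≤ max 1 (max (jacobiWeight α β b) (1 / jacobiWeight α β a)) :=
      (le_max_right _ _).trans (le_max_right _ _)
    calc 1 = 1 / jacobiWeight α β a * jacobiWeight α β a := by field_simp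
      _ ≤ _ := mul_le_mul h1 (hamin ht) hpa.le (zero_le_one.trans (le_max_left _ _))

/-- The energy of a solution is controlled by its mass on `[-1/2, 1/2]`. -/
lemma energy_le_mass (α β : ℝ) :
    ∃ K N₀ : ℝ, 0 < K ∧ ∀ N : ℝ, N₀ ≤ N → ∀ y : ℝ[X], JacobiODE α β N y →
      jacobiEnergy N y 0 ≤ K * (N ^ 2 * ∫ t in (-(1 / 2) : ℝ)..(1 / 2), y.eval t ^ 2) := by
  obtain ⟨K, hK1, hK⟩ := weight_energy_comparable α β 1 one_pos
  obtain ⟨L, hL1, hL⟩ := exists_jacobiWeight_bounds (α + 1 / 2) (β + 1 / 2)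
    (r := 1 / 2) (by norm_num) (by norm_num)
  have hB := jacobiBound_pos α β
  set B := jacobiBound α β with hBdef
  set M := K * L with hM
  have hM1 : 1 ≤ M := one_le_mul_of_one_le_of_one_le hK1 hL1
  refine ⟨4 * M, max 2 (max (2 * B) (4 * M ^ 2 * (B + 1))), by positivity, ?_⟩
  intro N hN y hy
  have hN2 : 2 ≤ N := (le_max_left _ _).trans hN
  have hNB : 2 * B ≤ N := ((le_max_left _ _).trans (le_max_right _ _)).trans hN
  have hNM : 4 * M ^ 2 * (B + 1) ≤ N := ((le_max_right _ _).trans (le_max_right _ _)).trans hN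
  set E := jacobiEnergy N y 0 with hE
  have hE0 : 0 ≤ E := jacobiEnergy_nonneg N y (by norm_num)
  have hcomp : ∀ t ∈ Icc (-(1 / 2) : ℝ) (1 / 2),
      jacobiEnergy N y t ≤ M * E ∧ E ≤ M * jacobiEnergy N y t := by
    intro t ht
    have ht' : t ∈ Icc (-1 : ℝ) 1 := ⟨by linarith [ht.1], by linarith [ht.2]⟩
    have hsq : t ^ 2 ≤ 1 / 4 := by nlinarith [ht.1, ht.2]
    obtain ⟨h1, h2⟩ := hK N hNB y hy t ht' (by nlinarith)
    obtain ⟨h3, h4⟩ := hL t ht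
    have h5 := jacobiEnergy_nonneg N y ht'
    constructor
    · calc jacobiEnergy N y t = 1 * jacobiEnergy N y t := (one_mul _).symm
        _ ≤ (L * jacobiWeight (α + 1 / 2) (β + 1 / 2) t) * jacobiEnergy N y t := by gcongr
        _ = L * (jacobiWeight (α + 1 / 2) (β + 1 / 2) t * jacobiEnergy N y t) := by ring
        _ ≤ L * (K * E) := by gcongr
        _ = M * E := by rw [hM]; ring
    · calc E ≤ K * (jacobiWeight (α + 1 / 2) (β + 1 / 2) t * jacobiEnergy N y t) := h2
        _ ≤ K * (L * jacobiEnergy N y t) := by gcongr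
        _ = _ := by rw [hM]; ring
  have hcross : ∀ t ∈ Icc (-(1 / 2) : ℝ) (1 / 2),
      |y.eval t * y.derivative.eval t| ≤ M * E / N := by
    intro t ht
    have hsq : t ^ 2 ≤ 1 / 4 := by nlinarith [ht.1, ht.2]
    refine le_trans ?_ (div_le_div_of_nonneg_right (hcomp t ht).1 (by linarith))
    rw [le_div_iff₀ (by linarith)]
    unfold jacobiEnergy
    set p := y.eval t
    set d := y.derivative.eval t
    rw [← abs_of_pos (by linarith : 0 < N), ← abs_mul, abs_of_pos (by linarith : 0 < N), abs_le]
    have := mul_nonneg (by linarith : 0 ≤ 1 / 4 - t ^ 2) (sq_nonneg d)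
    constructor <;> nlinarith [sq_nonneg (d + 2 * N * p), sq_nonneg (d - 2 * N * p), sq_nonneg d]
  set D : ℝ → ℝ := fun t => (1 - t ^ 2) * y.derivative.eval t ^ 2 - N ^ 2 * y.eval t ^ 2
    - (β - α - (α + β) * t) * (y.eval t * y.derivative.eval t) with hD
  have hderiv : ∀ t : ℝ, HasDerivAt (fun t => (1 - t ^ 2) * (y.eval t * y.derivative.eval t))
      (D t) t := fun t => by
    refine ((((hasDerivAt_id t).fun_pow 2).const_sub 1).mul
      ((y.hasDerivAt t).mul (y.derivative.hasDerivAt t))).congr_deriv ?_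
    have := hy t
    simp only [hD, id, Pi.mul_apply]
    push_cast
    linear_combination y.eval t * this
  have hFTC := intervalIntegral.integral_eq_sub_of_hasDerivAt (a := -(1 / 2)) (b := 1 / 2)
    (fun t _ => hderiv t) (Continuous.intervalIntegrable (by fun_prop) _ _)
  have hlow : ∀ t ∈ Icc (-(1 / 2) : ℝ) (1 / 2),
      E / M - 2 * B * (M * E / N) - 2 * N ^ 2 * y.eval t ^ 2 ≤ D t := by
    intro t ht
    have h1 : E / M ≤ jacobiEnergy N y t := by
      rw [div_le_iff₀ (by positivity), mul_comm]; exact (hcomp t ht).2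
    have h2 : |β - α - (α + β) * t| ≤ 2 * B := by
      have := abs_nonneg α
      have := abs_nonneg β
      rw [hBdef, abs_le]; unfold jacobiBound
      constructor <;> cases abs_cases α <;> cases abs_cases β <;> nlinarith [ht.1, ht.2]
    have h3 := mul_le_mul h2 (hcross t ht) (abs_nonneg _) (by positivity)
    rw [← abs_mul] at h3
    have h4 := (abs_le.1 h3).2
    unfold jacobiEnergy at h1
    simp only [hD]
    linarith
  have hmono := intervalIntegral.integral_mono_on (a := -(1 / 2)) (b := 1 / 2) (μ := volume)
    (by norm_num) (Continuous.intervalIntegrable (by fun_prop) _ _)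
    (Continuous.intervalIntegrable (by fun_prop) _ _) hlow
  rw [hFTC, intervalIntegral.integral_sub (by simp)
    (Continuous.intervalIntegrable (by fun_prop) _ _), intervalIntegral.integral_const,
    intervalIntegral.integral_const_mul] at hmono
  have hb1 := (abs_le.1 (hcross (1 / 2) (by norm_num))).2
  have hb2 := (abs_le.1 (hcross (-(1 / 2)) (by norm_num))).1
  have hME : 0 ≤ M * E / N := by positivity
  have hsmall : (2 * B + 2) * (M * E / N) ≤ E / M / 2 := by
    rw [div_div, ← mul_div_assoc, div_le_div_iff₀ (by linarith) (by positivity)]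
    calc (2 * B + 2) * (M * E) * (M * 2) = (4 * M ^ 2 * (B + 1)) * E := by ring
      _ ≤ N * E := by gcongr
      _ = E * N := mul_comm _ _
  have hfin : E / M / 2 ≤ 2 * N ^ 2 * ∫ t in (-(1 / 2) : ℝ)..(1 / 2), y.eval t ^ 2 := by
    norm_num at hmono hb1 hb2 ⊢
    linarith
  have : E = M * 2 * (E / M / 2) := by field_simp
  rw [this]
  calc _ ≤ M * 2 * (2 * N ^ 2 * ∫ t in (-(1 / 2) : ℝ)..(1 / 2), y.eval t ^ 2) := by gcongr
    _ = _ := by ring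

lemma rpow_le_two_rpow_mul {x a b : ℝ} (hx : 0 < x) (hx2 : x ≤ 2) (hab : b ≤ a) :
    x ^ a ≤ 2 ^ (a - b) * x ^ b := by
  have : x ^ a = x ^ (a - b) * x ^ b := by rw [← Real.rpow_add hx]; ring_nf
  rw [this]
  gcongr

set_option maxHeartbeats 1000000 in
/-- Pointwise domination of `N² y² w` on the half interval `[0, 1)`. -/
lemma sq_mul_weight_le_half (α β : ℝ) (hα : -1 < α) (hβ : -1 < β) :
    ∃ K N₀ : ℝ, 0 < K ∧ ∀ N : ℝ, N₀ ≤ N → ∀ y : ℝ[X], JacobiODE α β N y →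
      ∀ t ∈ Ico (0 : ℝ) 1, N ^ 2 * y.eval t ^ 2 * jacobiWeight α β t ≤
        K * jacobiEnergy N y 0 * jacobiWeight (min α (-1 / 2)) (min β (-1 / 2)) t := by
  have hα1 : 0 < α + 1 := by linarith
  set s := (α + 1) / 4 with hs
  have hs0 : 0 < s := by positivity
  obtain ⟨K, hK1, hK⟩ := weight_energy_comparable α β s hs0
  have hB := jacobiBound_pos α β
  set a := min α (-1 / 2) with ha
  set b := min β (-1 / 2) with hb
  have haα : a ≤ α := min_le_left _ _
  have hbβ : b ≤ β := min_le_left _ _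
  have ha2 : a ≤ -1 / 2 := min_le_right _ _
  have hb2 : b ≤ -1 / 2 := min_le_right _ _
  set C₁ : ℝ := 2 ^ (-1 / 2 - a) * 2 ^ (-1 / 2 - b) with hC₁
  set K₁ : ℝ := 16 / 9 + 8 / 9 / (α + 1) with hK₁
  set C₂ : ℝ := 2 ^ (β - b) * 2 ^ |β + 1 / 2| with hC₂
  have hC₁0 : 0 < C₁ := by positivity
  have hC₂0 : 0 < C₂ := by positivity
  have hK₁0 : 0 < K₁ := by positivity
  refine ⟨K * C₁ + 9 / 4 * K₁ * K * C₂, max 1 (max (2 * jacobiBound α β) (α + β + 2 + s)),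
    by positivity, ?_⟩
  intro N hN y hy t ht
  have hN1 : 1 ≤ N := (le_max_left _ _).trans hN
  have hNB : 2 * jacobiBound α β ≤ N := ((le_max_left _ _).trans (le_max_right _ _)).trans hN
  have hNs : α + β + 2 + s ≤ N := ((le_max_right _ _).trans (le_max_right _ _)).trans hN
  have hN0 : 0 < N := by linarith
  have hNN : N ≤ N ^ 2 := by nlinarith
  set E := jacobiEnergy N y 0 with hE
  have hE0 : 0 ≤ E := jacobiEnergy_nonneg N y (by norm_num)
  have ht' : t ∈ Ioo (-1 : ℝ) 1 := ⟨by linarith [ht.1], ht.2⟩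
  have hu : 0 < 1 - t := by linarith [ht.2]
  have hv : 0 < 1 + t := by linarith [ht.1]
  have hwab := jacobiWeight_pos a b ht'
  have hw := jacobiWeight_pos α β ht'
  have hnn1 : 0 ≤ K * C₁ * E * jacobiWeight a b t := by positivity
  have hnn2 : 0 ≤ 9 / 4 * K₁ * K * C₂ * E * jacobiWeight a b t := by positivity
  have hEt : N ^ 2 * y.eval t ^ 2 ≤ jacobiEnergy N y t := by
    unfold jacobiEnergy
    have : 0 ≤ (1 - t ^ 2) * y.derivative.eval t ^ 2 :=
      mul_nonneg (by nlinarith) (sq_nonneg _)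
    linarith
  by_cases hcase : s ≤ N ^ 2 * (1 - t ^ 2)
  · have h1 := (hK N hNB y hy t ⟨ht'.1.le, ht'.2.le⟩ hcase).1
    have e : jacobiWeight α β t = jacobiWeight (α + 1 / 2) (β + 1 / 2) t *
        ((1 - t) ^ (-1 / 2 : ℝ) * (1 + t) ^ (-1 / 2 : ℝ)) := by
      unfold jacobiWeight
      have e1 : (1 - t) ^ α = (1 - t) ^ (α + 1 / 2) * (1 - t) ^ (-1 / 2 : ℝ) := by
        rw [← Real.rpow_add hu]; ring_nf
      have e2 : (1 + t) ^ β = (1 + t) ^ (β + 1 / 2) * (1 + t) ^ (-1 / 2 : ℝ) := by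
        rw [← Real.rpow_add hv]; ring_nf
      rw [e1, e2]; ring
    have h2 : (1 - t) ^ (-1 / 2 : ℝ) * (1 + t) ^ (-1 / 2 : ℝ) ≤ C₁ * jacobiWeight a b t := by
      have h3 := rpow_le_two_rpow_mul hu (by linarith [ht.1]) ha2
      have h4 := rpow_le_two_rpow_mul hv (by linarith [ht.2]) hb2
      have := mul_le_mul h3 h4 (by positivity) (by positivity)
      refine this.trans_eq ?_
      rw [hC₁]; unfold jacobiWeight; ring
    have hw' := jacobiWeight_pos (α + 1 / 2) (β + 1 / 2) ht'
    calc _ = jacobiWeight (α + 1 / 2) (β + 1 / 2) t * (N ^ 2 * y.eval t ^ 2) *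
          ((1 - t) ^ (-1 / 2 : ℝ) * (1 + t) ^ (-1 / 2 : ℝ)) := by rw [e]; ring
      _ ≤ (K * E) * (C₁ * jacobiWeight a b t) := by
          refine mul_le_mul ?_ h2 (by positivity) (by positivity)
          exact (mul_le_mul_of_nonneg_left hEt hw'.le).trans h1
      _ = K * C₁ * E * jacobiWeight a b t := by ring
      _ ≤ _ := by nlinarith
  · push Not at hcase
    have hsN : s / N ^ 2 ≤ 1 := by rw [div_le_one (by positivity)]; linarith
    have hsN0 : 0 < s / N ^ 2 := by positivity
    have hts : 1 - t ≤ s / N ^ 2 := by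
      rw [le_div_iff₀ (by positivity)]
      nlinarith [mul_nonneg (mul_nonneg ht.1 hu.le) (sq_nonneg N)]
    have hN2 : α + β + 2 ≤ 4 * N ^ 2 := by linarith
    set t₁ := 1 - s / N ^ 2 with ht₁
    have ht₁I : t₁ ∈ Icc (-1 : ℝ) 1 := ⟨by linarith, by linarith⟩
    have ht₁J : t₁ ∈ Ioo (-1 : ℝ) 1 := ⟨by linarith, by linarith⟩
    obtain ⟨-, -, hup⟩ := hy.energy_near_one hα hβ hN0 hN2 ht.2.le ht'.1.le hts
    obtain ⟨-, hlo, -⟩ := hy.energy_near_one hα hβ hN0 hN2 (t := t₁) ht₁I.2 ht₁I.1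
      (by rw [ht₁, sub_sub_cancel])
    have hcmp := (hK N hNB y hy t₁ ht₁I (by
      have e : N ^ 2 * (1 - t₁ ^ 2) = N ^ 2 * (s / N ^ 2) * (1 + t₁) := by rw [ht₁]; ring
      have e' : N ^ 2 * (s / N ^ 2) = s := mul_div_cancel₀ s (pow_ne_zero 2 hN0.ne')
      rw [e, e']
      exact le_mul_of_one_le_right hs0.le (by linarith))).1
    have hw₁ := jacobiWeight_pos (α + 1 / 2) (β + 1 / 2) ht₁J
    set w₁ := jacobiWeight (α + 1 / 2) (β + 1 / 2) t₁ with hw₁def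
    have h1 : N ^ 2 * y.eval t ^ 2 * w₁ ≤ 9 / 4 * K₁ * K * E := by
      have h2 : N ^ 2 * y.eval t ^ 2 ≤ 9 / 4 * K₁ * jacobiEnergy N y t₁ := by
        calc _ ≤ K₁ * N ^ 2 * y.eval 1 ^ 2 := hEt.trans hup
          _ = 9 / 4 * K₁ * (4 / 9 * N ^ 2 * y.eval 1 ^ 2) := by ring
          _ ≤ _ := by gcongr
      calc _ ≤ 9 / 4 * K₁ * jacobiEnergy N y t₁ * w₁ := by gcongr
        _ = 9 / 4 * K₁ * (w₁ * jacobiEnergy N y t₁) := by ring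
        _ ≤ 9 / 4 * K₁ * (K * E) := by gcongr
        _ = _ := by ring
    have h2 : jacobiWeight α β t ≤ w₁ * (C₂ * jacobiWeight a b t) := by
      have e1 : (1 - t) ^ α ≤ (s / N ^ 2) ^ (α + 1 / 2) * (1 - t) ^ a := by
        have : (1 - t) ^ α = (1 - t) ^ (α - a) * (1 - t) ^ a := by
          rw [← Real.rpow_add hu]; ring_nf
        rw [this]
        gcongr
        calc (1 - t) ^ (α - a) ≤ (s / N ^ 2) ^ (α - a) :=
              Real.rpow_le_rpow hu.le hts (by linarith)
          _ = (s / N ^ 2) ^ (α + 1 / 2) * (s / N ^ 2) ^ (-1 / 2 - a) := by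
              rw [← Real.rpow_add hsN0]; ring_nf
          _ ≤ (s / N ^ 2) ^ (α + 1 / 2) * 1 := by
              gcongr
              exact Real.rpow_le_one hsN0.le hsN (by linarith)
          _ = _ := mul_one _
      have e2 := rpow_le_two_rpow_mul hv (by linarith [ht.2]) hbβ
      have h1t : 1 ≤ 1 + t₁ := by linarith
      have e3 : 1 ≤ 2 ^ |β + 1 / 2| * (1 + t₁) ^ (β + 1 / 2) := by
        rcases le_total 0 (β + 1 / 2) with h | h
        · exact one_le_mul_of_one_le_of_one_le
            (Real.one_le_rpow one_le_two (abs_nonneg _)) (Real.one_le_rpow h1t h)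
        · rw [abs_of_nonpos h, Real.rpow_neg zero_le_two, inv_mul_eq_div,
            one_le_div (by positivity)]
          exact Real.rpow_le_rpow_of_nonpos (by linarith) (by linarith) h
      unfold jacobiWeight at hw₁def ⊢
      have hst : 1 - t₁ = s / N ^ 2 := by rw [ht₁]; ring
      rw [hw₁def, hst, hC₂]
      calc (1 - t) ^ α * (1 + t) ^ β
          ≤ ((s / N ^ 2) ^ (α + 1 / 2) * (1 - t) ^ a) * (2 ^ (β - b) * (1 + t) ^ b) :=
            mul_le_mul e1 e2 (by positivity) (by positivity)
        _ = ((s / N ^ 2) ^ (α + 1 / 2) * (1 - t) ^ a) * (2 ^ (β - b) * (1 + t) ^ b) * 1 :=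
            (mul_one _).symm
        _ ≤ ((s / N ^ 2) ^ (α + 1 / 2) * (1 - t) ^ a) * (2 ^ (β - b) * (1 + t) ^ b) *
            (2 ^ |β + 1 / 2| * (1 + t₁) ^ (β + 1 / 2)) := by gcongr
        _ = _ := by ring
    calc _ ≤ N ^ 2 * y.eval t ^ 2 * (w₁ * (C₂ * jacobiWeight a b t)) := by gcongr
      _ = (N ^ 2 * y.eval t ^ 2 * w₁) * (C₂ * jacobiWeight a b t) := by ring
      _ ≤ (9 / 4 * K₁ * K * E) * (C₂ * jacobiWeight a b t) := by gcongr
      _ = 9 / 4 * K₁ * K * C₂ * E * jacobiWeight a b t := by ring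
      _ ≤ _ := by nlinarith

lemma jacobiWeight_neg (α β t : ℝ) : jacobiWeight α β (-t) = jacobiWeight β α t := by
  unfold jacobiWeight
  rw [sub_neg_eq_add, ← sub_eq_add_neg, mul_comm]

lemma jacobiEnergy_comp_neg_X (N : ℝ) (y : ℝ[X]) (t : ℝ) :
    jacobiEnergy N (y.comp (-X)) t = jacobiEnergy N y (-t) := by
  unfold jacobiEnergy
  simp [derivative_comp]

/-- Pointwise domination of `N² y² w` by a fixed integrable weight. -/
lemma sq_mul_weight_le (α β : ℝ) (hα : -1 < α) (hβ : -1 < β) :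
    ∃ K N₀ : ℝ, 0 < K ∧ ∀ N : ℝ, N₀ ≤ N → ∀ y : ℝ[X], JacobiODE α β N y →
      ∀ t ∈ Ioo (-1 : ℝ) 1, N ^ 2 * y.eval t ^ 2 * jacobiWeight α β t ≤
        K * jacobiEnergy N y 0 * jacobiWeight (min α (-1 / 2)) (min β (-1 / 2)) t := by
  obtain ⟨K, N₀, hK0, hK⟩ := sq_mul_weight_le_half α β hα hβ
  obtain ⟨K', N₀', hK0', hK'⟩ := sq_mul_weight_le_half β α hβ hα
  refine ⟨max K K', max N₀ N₀', lt_max_of_lt_left hK0, fun N hN y hy t ht => ?_⟩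
  have hE0 : 0 ≤ jacobiEnergy N y 0 := jacobiEnergy_nonneg N y (by norm_num)
  have hw := jacobiWeight_pos (min α (-1 / 2)) (min β (-1 / 2)) ht
  rcases le_or_gt 0 t with h | h
  · refine (hK N ((le_max_left _ _).trans hN) y hy t ⟨h, ht.2⟩).trans ?_
    gcongr
    exact le_max_left _ _
  · have := hK' N ((le_max_right _ _).trans hN) _ hy.comp_neg_X (-t)
      ⟨by linarith, by linarith [ht.1]⟩
    rw [jacobiEnergy_comp_neg_X, jacobiWeight_neg, jacobiWeight_neg] at this
    simp only [eval_comp, eval_neg, eval_X, neg_neg, neg_zero] at this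
    refine this.trans ?_
    gcongr
    exact le_max_right _ _

/-- The Jacobi weight is integrable. -/
lemma integrableOn_jacobiWeight {α β : ℝ} (hα : -1 < α) (hβ : -1 < β) :
    IntegrableOn (jacobiWeight α β) (Ioo (-1 : ℝ) 1) := by
  have half : ∀ {α β : ℝ}, -1 < α → IntegrableOn (jacobiWeight α β) (Ioc (0 : ℝ) 1) := by
    intro α β hα
    have h1 : IntervalIntegrable (fun t : ℝ => (1 - t) ^ α) volume 0 1 := by
      have := (intervalIntegral.intervalIntegrable_rpow' (a := 0) (b := 1) hα).comp_sub_left 1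
      simpa using this.symm
    have h2 := h1.mul_continuousOn (g := fun t : ℝ => (1 + t) ^ β) (by
      intro t ht
      rw [uIcc_of_le zero_le_one] at ht
      exact ((continuousAt_const.add continuousAt_id).rpow_const
        (Or.inl (show (1 : ℝ) + t ≠ 0 from ne_of_gt (by linarith [ht.1])))).continuousWithinAt)
    exact (intervalIntegrable_iff_integrableOn_Ioc_of_le zero_le_one).1 h2
  have hI : IntervalIntegrable (jacobiWeight α β) volume 0 1 :=
    (intervalIntegrable_iff_integrableOn_Ioc_of_le zero_le_one).2 (half hα)
  have hI' : IntervalIntegrable (jacobiWeight β α) volume 0 1 :=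
    (intervalIntegrable_iff_integrableOn_Ioc_of_le zero_le_one).2 (half hβ)
  have hneg : IntervalIntegrable (jacobiWeight α β) volume (-1) 0 := by
    have := (hI'.comp_mul_left (c := -1)).symm
    simpa [jacobiWeight_neg] using this
  have := (intervalIntegrable_iff_integrableOn_Ioc_of_le (by norm_num)).1 (hneg.trans hI)
  exact this.mono_set Ioo_subset_Ioc_self

lemma integrableOn_eval_mul_jacobiWeight {α β : ℝ} (hα : -1 < α) (hβ : -1 < β) (Q : ℝ[X]) :
    IntegrableOn (fun t => Q.eval t * jacobiWeight α β t) (Ioo (-1 : ℝ) 1) := by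
  obtain ⟨K, hK⟩ := (isCompact_Icc (a := (-1 : ℝ)) (b := 1)).exists_bound_of_continuousOn
    (f := fun t => Q.eval t) Q.continuous.continuousOn
  refine Integrable.bdd_mul (integrableOn_jacobiWeight hα hβ)
    Q.continuous.aestronglyMeasurable (c := K) ?_
  exact (ae_restrict_iff' measurableSet_Ioo).2
    (Eventually.of_forall fun t ht => hK t (Ioo_subset_Icc_self ht))

/-- Integration of polynomials against the Jacobi weight, as a linear functional. -/
noncomputable def jacobiIntegral {α β : ℝ} (hα : -1 < α) (hβ : -1 < β) : ℝ[X] →ₗ[ℝ] ℝ where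
  toFun Q := ∫ t in Ioo (-1 : ℝ) 1, Q.eval t * jacobiWeight α β t
  map_add' Q R := by
    rw [← integral_add (integrableOn_eval_mul_jacobiWeight hα hβ Q)
      (integrableOn_eval_mul_jacobiWeight hα hβ R)]
    simp only [eval_add, add_mul]
  map_smul' c Q := by
    simp only [eval_smul, smul_eq_mul, mul_assoc, RingHom.id_apply]
    exact integral_const_mul _ _

lemma jacobiIntegral_apply {α β : ℝ} (hα : -1 < α) (hβ : -1 < β) (Q : ℝ[X]) :
    jacobiIntegral hα hβ Q = ∫ t in Ioo (-1 : ℝ) 1, Q.eval t * jacobiWeight α β t := rfl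

lemma jacobiIntegral_nonneg {α β : ℝ} (hα : -1 < α) (hβ : -1 < β) {Q : ℝ[X]}
    (hQ : ∀ t ∈ Ioo (-1 : ℝ) 1, 0 ≤ Q.eval t) : 0 ≤ jacobiIntegral hα hβ Q :=
  setIntegral_nonneg measurableSet_Ioo fun t ht =>
    mul_nonneg (hQ t ht) (jacobiWeight_pos α β ht).le

/-- The Pearson equation of the Jacobi weight in integrated form. -/
lemma jacobiIntegral_pearson {α β : ℝ} (hα : -1 < α) (hβ : -1 < β) (R : ℝ[X]) :
    jacobiIntegral hα hβ
      ((1 - X ^ 2) * derivative R + (C (β - α) - C (α + β + 2) * X) * R) = 0 := by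
  set Q := (1 - X ^ 2) * derivative R + (C (β - α) - C (α + β + 2) * X) * R with hQ
  rw [jacobiIntegral_apply, ← integral_Ioc_eq_integral_Ioo,
    ← intervalIntegral.integral_of_le (by norm_num)]
  have hInt : IntervalIntegrable (fun t => Q.eval t * jacobiWeight α β t) volume (-1) 1 := by
    rw [intervalIntegrable_iff_integrableOn_Ioo_of_le (by norm_num)]
    exact integrableOn_eval_mul_jacobiWeight hα hβ Q
  rw [intervalIntegral.integral_eq_sub_of_hasDerivAt_of_le
    (f := fun t => R.eval t * ((1 - t) ^ (α + 1) * (1 + t) ^ (β + 1))) (by norm_num) ?_ ?_ hInt]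
  · simp [Real.zero_rpow (by linarith : α + 1 ≠ 0), Real.zero_rpow (by linarith : β + 1 ≠ 0)]
  · refine R.continuous.continuousOn.mul (ContinuousOn.mul ?_ ?_)
    · exact (continuous_const.sub continuous_id).continuousOn.rpow_const
        fun t _ => Or.inr (by linarith)
    · exact (continuous_const.add continuous_id).continuousOn.rpow_const
        fun t _ => Or.inr (by linarith)
  · intro t ht
    have hu : 0 < 1 - t := by linarith [ht.2]
    have hv : 0 < 1 + t := by linarith [ht.1]
    have d1 : HasDerivAt (fun x : ℝ => (1 - x) ^ (α + 1))
        (-1 * (α + 1) * (1 - t) ^ (α + 1 - 1)) t :=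
      ((hasDerivAt_id t).const_sub 1).rpow_const (Or.inl hu.ne')
    have d2 : HasDerivAt (fun x : ℝ => (1 + x) ^ (β + 1)) (1 * (β + 1) * (1 + t) ^ (β + 1 - 1)) t :=
      ((hasDerivAt_id t).const_add 1).rpow_const (Or.inl hv.ne')
    refine ((R.hasDerivAt t).mul (d1.mul d2)).congr_deriv ?_
    have e1 : (1 - t) ^ (α + 1) = (1 - t) ^ α * (1 - t) := Real.rpow_add_one hu.ne' α
    have e2 : (1 + t) ^ (β + 1) = (1 + t) ^ β * (1 + t) := Real.rpow_add_one hv.ne' β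
    simp only [add_sub_cancel_right, Pi.mul_apply, hQ, jacobiWeight, eval_add, eval_sub, eval_mul,
      eval_one, eval_pow, eval_X, eval_C]
    rw [e1, e2]
    ring

section OrthonormalSystem

variable {Λ : ℝ[X] →ₗ[ℝ] ℝ} {P : ℕ → ℝ[X]}

lemma LinearMap.map_mul_C_mul (Λ : ℝ[X] →ₗ[ℝ] ℝ) (a : ℝ) (p q : ℝ[X]) :
    Λ (p * (C a * q)) = a * Λ (p * q) := by
  rw [show p * (C a * q) = a • (p * q) by rw [smul_eq_C_mul]; ring, map_smul, smul_eq_mul]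

/-- Expansion of a polynomial in an orthonormal system. -/
lemma eq_sum_of_orthonormal (hdeg : ∀ n, (P n).natDegree = n) (hP : ∀ n, P n ≠ 0)
    (horth : ∀ n m, Λ (P n * P m) = if n = m then 1 else 0) (d : ℕ) (Q : ℝ[X])
    (hQ : ∀ m, d ≤ m → Q.coeff m = 0) :
    Q = ∑ k ∈ Finset.range d, C (Λ (P k * Q)) * P k := by
  have hex : ∀ d : ℕ, ∀ Q : ℝ[X], (∀ m, d ≤ m → Q.coeff m = 0) →
      ∃ a : ℕ → ℝ, Q = ∑ k ∈ Finset.range d, C (a k) * P k := by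
    intro d
    induction d with
    | zero =>
      intro Q hQ
      exact ⟨0, by ext m; simp [hQ m (Nat.zero_le m)]⟩
    | succ d ih =>
      intro Q hQ
      have hl : (P d).coeff d ≠ 0 := by
        have := leadingCoeff_ne_zero.2 (hP d)
        rwa [leadingCoeff, hdeg] at this
      obtain ⟨a, ha⟩ := ih (Q - C (Q.coeff d / (P d).coeff d) * P d) (by
        intro m hm
        rw [coeff_sub, coeff_C_mul]
        rcases hm.eq_or_lt with rfl | hlt
        · rw [div_mul_cancel₀ _ hl, sub_self]
        · have h0 : (P d).coeff m = 0 := coeff_eq_zero_of_natDegree_lt (by rwa [hdeg])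
          rw [hQ m hlt, h0, mul_zero, sub_zero])
      refine ⟨Function.update a d (Q.coeff d / (P d).coeff d), ?_⟩
      rw [Finset.sum_range_succ, Function.update_self]
      rw [Finset.sum_congr rfl (g := fun k => C (a k) * P k), ← ha, sub_add_cancel]
      intro k hk
      rw [Function.update_of_ne (Finset.mem_range.1 hk).ne]
  obtain ⟨a, ha⟩ := hex d Q hQ
  have hcoef : ∀ k ∈ Finset.range d, Λ (P k * Q) = a k := by
    intro k hk
    rw [ha, Finset.mul_sum, map_sum]
    simp only [LinearMap.map_mul_C_mul, horth]
    simp [Finset.mem_range.1 hk]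
  rw [Finset.sum_congr rfl fun k hk => by rw [hcoef k hk]]
  exact ha

lemma map_mul_eq_zero_of_orthonormal (hdeg : ∀ n, (P n).natDegree = n) (hP : ∀ n, P n ≠ 0)
    (horth : ∀ n m, Λ (P n * P m) = if n = m then 1 else 0) {n : ℕ} {Q : ℝ[X]}
    (hQ : ∀ m, n ≤ m → Q.coeff m = 0) : Λ (P n * Q) = 0 := by
  rw [eq_sum_of_orthonormal hdeg hP horth n Q hQ, Finset.mul_sum, map_sum]
  refine Finset.sum_eq_zero fun k hk => ?_
  rw [LinearMap.map_mul_C_mul, horth, if_neg (Finset.mem_range.1 hk).ne', mul_zero]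

end OrthonormalSystem

/-- The Jacobi differential operator, of which the Jacobi polynomials are eigenfunctions. -/
noncomputable def jacobiOp (α β : ℝ) (y : ℝ[X]) : ℝ[X] :=
  (1 - X ^ 2) * derivative (derivative y) + (C (β - α) - C (α + β + 2) * X) * derivative y

lemma coeff_one_sub_X_sq_mul_derivative (y : ℝ[X]) (m : ℕ) :
    ((1 - X ^ 2) * derivative y).coeff (m + 1) = (m + 2) * y.coeff (m + 2) - m * y.coeff m := by
  rw [sub_mul, one_mul, coeff_sub, coeff_derivative, coeff_X_pow_mul']
  rcases m with _ | m
  · simp; ring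
  · rw [if_pos (by omega), coeff_derivative, show m + 1 + 1 - 2 = m by omega]
    push_cast; ring

lemma coeff_jacobiOp (α β : ℝ) (y : ℝ[X]) (m : ℕ) :
    (jacobiOp α β y).coeff m = (m + 1) * (m + 2) * y.coeff (m + 2) +
      (β - α) * (m + 1) * y.coeff (m + 1) - m * (m + α + β + 1) * y.coeff m := by
  unfold jacobiOp
  rcases m with _ | m
  · simp [sub_mul, mul_assoc, coeff_derivative, mul_coeff_zero]
    ring
  · rw [coeff_add, coeff_one_sub_X_sq_mul_derivative, sub_mul, coeff_sub, coeff_C_mul, mul_assoc,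
      coeff_C_mul, coeff_X_mul]
    simp only [coeff_derivative]
    push_cast; ring

namespace JacobiSystem

variable {α β : ℝ} (J : JacobiSystem α β)

lemma ne_zero (n : ℕ) : J.P n ≠ 0 := leadingCoeff_ne_zero.1 (J.leadingCoeff_pos n).ne'

lemma coeff_pos (n : ℕ) : 0 < (J.P n).coeff n := by
  have := J.leadingCoeff_pos n
  rwa [leadingCoeff, J.natDegree_eq] at this

lemma coeff_eq_zero {n m : ℕ} (h : n < m) : (J.P n).coeff m = 0 :=
  coeff_eq_zero_of_natDegree_lt (by rwa [J.natDegree_eq])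

lemma jacobiIntegral_mul (hα : -1 < α) (hβ : -1 < β) (n m : ℕ) :
    jacobiIntegral hα hβ (J.P n * J.P m) = if n = m then 1 else 0 := by
  rw [jacobiIntegral_apply, ← J.orthonormal n m]
  simp only [eval_mul]

lemma jacobiOp_eq (hα : -1 < α) (hβ : -1 < β) (n : ℕ) :
    jacobiOp α β (J.P n) = C (-(n * (n + α + β + 1))) * J.P n := by
  have hsymm : ∀ y q : ℝ[X], jacobiIntegral hα hβ (q * jacobiOp α β y) =
      jacobiIntegral hα hβ (y * jacobiOp α β q) := by
    intro y q
    have h1 := jacobiIntegral_pearson hα hβ (derivative y * q)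
    have h2 := jacobiIntegral_pearson hα hβ (derivative q * y)
    rw [← sub_eq_zero, ← map_sub, ← sub_zero (0 : ℝ)]
    nth_rw 1 [← h1]
    rw [← h2, ← map_sub]
    congr 1
    simp only [jacobiOp, derivative_mul]
    ring
  have hexp := eq_sum_of_orthonormal J.natDegree_eq J.ne_zero (J.jacobiIntegral_mul hα hβ) (n + 1)
    (jacobiOp α β (J.P n)) (by
      intro m hm
      rw [coeff_jacobiOp, J.coeff_eq_zero hm, J.coeff_eq_zero (by omega : n < m + 1),
        J.coeff_eq_zero (by omega : n < m + 2)]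
      ring)
  rw [Finset.sum_range_succ, Finset.sum_eq_zero, zero_add] at hexp
  · have hc := congrArg (fun q => q.coeff n) hexp
    simp only [coeff_jacobiOp, coeff_C_mul, J.coeff_eq_zero (by omega : n < n + 1),
      J.coeff_eq_zero (by omega : n < n + 2)] at hc
    rw [hexp]
    congr 2
    exact mul_right_cancel₀ (J.coeff_pos n).ne' (by rw [← hc]; ring)
  · intro k hk
    have hk := Finset.mem_range.1 hk
    rw [hsymm, map_mul_eq_zero_of_orthonormal J.natDegree_eq J.ne_zero
      (J.jacobiIntegral_mul hα hβ), C_0, zero_mul]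
    intro m hm
    rw [coeff_jacobiOp, J.coeff_eq_zero (by omega : k < m),
      J.coeff_eq_zero (by omega : k < m + 1), J.coeff_eq_zero (by omega : k < m + 2)]
    ring

/-- The Jacobi polynomials solve the Jacobi differential equation. -/
lemma jacobiODE (hα : -1 < α) (hβ : -1 < β) {n : ℕ} (hn : 0 ≤ n * (n + α + β + 1)) :
    JacobiODE α β √(n * (n + α + β + 1)) (J.P n) := by
  intro t
  have := congrArg (fun q => q.eval t) (J.jacobiOp_eq hα hβ n)
  simp only [jacobiOp, eval_add, eval_sub, eval_mul, eval_one, eval_pow, eval_X, eval_C] at this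
  rw [Real.sq_sqrt hn, this]
  ring

/-- The structure relation evaluated at a zero of `P n`. -/
lemma derivative_eval_of_isRoot (hα : -1 < α) (hβ : -1 < β) (n : ℕ) {t : ℝ}
    (ht : (J.P n).eval t = 0) :
    (1 - t ^ 2) * (derivative (J.P n)).eval t * (J.P (n + 1)).coeff (n + 1) =
      -((2 * n + α + β + 1) * (J.P n).coeff n) * (J.P (n + 1)).eval t := by
  set Q : ℝ[X] := (1 - X ^ 2) * derivative (J.P n) - C (n + α + β + 1) * (X * J.P n) with hQ
  have hcoeff : ∀ m, Q.coeff (m + 1) =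
      (m + 2) * (J.P n).coeff (m + 2) - (m + n + α + β + 1) * (J.P n).coeff m := by
    intro m
    rw [hQ, coeff_sub, coeff_one_sub_X_sq_mul_derivative, coeff_C_mul, coeff_X_mul]
    ring
  have hexp := eq_sum_of_orthonormal J.natDegree_eq J.ne_zero (J.jacobiIntegral_mul hα hβ) (n + 2)
    Q (by
      intro m hm
      obtain ⟨m, rfl⟩ : ∃ k, m = k + 1 := ⟨m - 1, by omega⟩
      rw [hcoeff, J.coeff_eq_zero (by omega : n < m), J.coeff_eq_zero (by omega : n < m + 2)]
      ring)
  rw [Finset.sum_range_succ, Finset.sum_range_succ, Finset.sum_eq_zero, zero_add] at hexp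
  · set e := jacobiIntegral hα hβ (J.P n * Q)
    set κ := jacobiIntegral hα hβ (J.P (n + 1) * Q)
    have hc := hcoeff n
    rw [J.coeff_eq_zero (by omega : n < n + 2), hexp, coeff_add, coeff_C_mul, coeff_C_mul,
      J.coeff_eq_zero (by omega : n < n + 1)] at hc
    have he := congrArg (fun q => q.eval t) hexp
    simp only [hQ, eval_add, eval_sub, eval_mul, eval_one, eval_pow, eval_X, eval_C, ht] at he
    linear_combination (J.P (n + 1)).coeff (n + 1) * he + (J.P (n + 1)).eval t * hc
  · intro k hk
    have hk := Finset.mem_range.1 hk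
    set T : ℝ[X] := (1 - X ^ 2) * derivative (J.P k) + C (β - α) * J.P k +
      C ((n : ℝ) - 1) * (X * J.P k) with hT
    have hz : jacobiIntegral hα hβ (J.P n * T) = 0 := by
      refine map_mul_eq_zero_of_orthonormal J.natDegree_eq J.ne_zero
        (J.jacobiIntegral_mul hα hβ) fun m hm => ?_
      obtain ⟨m, rfl⟩ : ∃ k, m = k + 1 := ⟨m - 1, by omega⟩
      rw [hT, coeff_add, coeff_add, coeff_one_sub_X_sq_mul_derivative, coeff_C_mul, coeff_C_mul,
        coeff_X_mul, J.coeff_eq_zero (by omega : k < m + 1),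
        J.coeff_eq_zero (by omega : k < m + 2)]
      rcases hm.eq_or_lt with h | h
      · rw [h]; push_cast; ring
      · rw [J.coeff_eq_zero (by omega : k < m)]; ring
    have hp := jacobiIntegral_pearson hα hβ (J.P n * J.P k)
    have : jacobiIntegral hα hβ (J.P k * Q) = 0 := by
      rw [← sub_zero (0 : ℝ)]
      nth_rw 1 [← hp]
      rw [← hz, ← map_sub]
      congr 1
      simp only [hQ, hT, derivative_mul, map_add, map_sub]
      have : (C (1 : ℝ) : ℝ[X]) = 1 := C_1
      rw [this, show (C (2 : ℝ) : ℝ[X]) = 1 + 1 by rw [← C_1, ← C_add]; norm_num]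
      ring
    rw [this, C_0, zero_mul]

lemma coeff_le_coeff_succ (hα : -1 < α) (hβ : -1 < β) (n : ℕ) :
    (J.P n).coeff n ≤ (J.P (n + 1)).coeff (n + 1) := by
  have hexp := eq_sum_of_orthonormal J.natDegree_eq J.ne_zero (J.jacobiIntegral_mul hα hβ) (n + 2)
    (X * J.P n) (by
      intro m hm
      obtain ⟨m, rfl⟩ : ∃ k, m = k + 1 := ⟨m - 1, by omega⟩
      rw [coeff_X_mul, J.coeff_eq_zero (by omega : n < m)])
  have hc := congrArg (fun q => q.coeff (n + 1)) hexp
  simp only [Finset.sum_range_succ _ (n + 1), coeff_X_mul, coeff_add, finsetSum_coeff,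
    coeff_C_mul] at hc
  rw [Finset.sum_eq_zero, zero_add] at hc
  · have hpos : 0 ≤ jacobiIntegral hα hβ (J.P n * J.P n + J.P (n + 1) * J.P (n + 1) -
        (J.P (n + 1) * (X * J.P n) + J.P (n + 1) * (X * J.P n))) := by
      refine jacobiIntegral_nonneg hα hβ fun t ht => ?_
      simp only [eval_add, eval_sub, eval_mul, eval_X]
      have h1 : 0 < 1 - t := by linarith [ht.2]
      have h2 : 0 < 1 + t := by linarith [ht.1]
      nlinarith [mul_nonneg h1.le (sq_nonneg ((J.P n).eval t + (J.P (n + 1)).eval t)),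
        mul_nonneg h2.le (sq_nonneg ((J.P n).eval t - (J.P (n + 1)).eval t))]
    rw [map_sub, map_add, map_add, J.jacobiIntegral_mul, J.jacobiIntegral_mul, if_pos rfl,
      if_pos rfl] at hpos
    rw [hc]
    exact mul_le_of_le_one_left (J.coeff_pos _).le (by linarith)
  · intro k hk
    rw [J.coeff_eq_zero (Finset.mem_range.1 hk), mul_zero]

end JacobiSystem

/-- The frequency `√(n(n+α+β+1))` in the Jacobi differential equation for `P n`. -/
noncomputable def jacobiFreq (α β : ℝ) (n : ℕ) : ℝ := √(n * (n + α + β + 1))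

lemma abs_add_add_one_le_jacobiBound (α β : ℝ) : |α + β + 1| ≤ jacobiBound α β := by
  unfold jacobiBound
  have h1 := abs_add_le (α + β) 1
  have h2 := abs_add_le α β
  rw [abs_one] at h1
  linarith

lemma jacobiFreq_arg_nonneg {α β : ℝ} {n : ℕ} (hn : 4 * jacobiBound α β ≤ n) :
    0 ≤ n * (n + α + β + 1) := by
  have h := abs_le.1 (abs_add_add_one_le_jacobiBound α β)
  have hB := jacobiBound_pos α β
  exact mul_nonneg (Nat.cast_nonneg n) (by linarith [h.1])

lemma half_le_jacobiFreq {α β : ℝ} {n : ℕ} (hn : 4 * jacobiBound α β ≤ n) :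
    n / 2 ≤ jacobiFreq α β n := by
  have h := abs_le.1 (abs_add_add_one_le_jacobiBound α β)
  have hB := jacobiBound_pos α β
  apply Real.le_sqrt_of_sq_le
  nlinarith

lemma jacobiFreq_le_two_mul {α β : ℝ} {n : ℕ} (hn : 4 * jacobiBound α β ≤ n) :
    jacobiFreq α β n ≤ 2 * n := by
  have h := abs_le.1 (abs_add_add_one_le_jacobiBound α β)
  have hB := jacobiBound_pos α β
  apply Real.sqrt_le_iff.2
  constructor
  · linarith
  · nlinarith

lemma jacobiFreq_le_succ {α β : ℝ} {n : ℕ} (hn : 4 * jacobiBound α β ≤ n) :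
    jacobiFreq α β n ≤ jacobiFreq α β (n + 1) := by
  have h := abs_le.1 (abs_add_add_one_le_jacobiBound α β)
  have hB := jacobiBound_pos α β
  apply Real.sqrt_le_sqrt
  push_cast
  nlinarith

lemma JacobiSystem.jacobiODE_freq {α β : ℝ} (J : JacobiSystem α β) (hα : -1 < α) (hβ : -1 < β)
    {n : ℕ} (hn : 4 * jacobiBound α β ≤ n) : JacobiODE α β (jacobiFreq α β n) (J.P n) :=
  J.jacobiODE hα hβ (jacobiFreq_arg_nonneg hn)

lemma JacobiSystem.jacobiIntegral_sq {α β : ℝ} (J : JacobiSystem α β) (hα : -1 < α) (hβ : -1 < β)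
    (n : ℕ) : ∫ t in Ioo (-1 : ℝ) 1, (J.P n ^ 2).eval t * jacobiWeight α β t = 1 := by
  have := J.jacobiIntegral_mul hα hβ n n
  rw [if_pos rfl, ← sq, jacobiIntegral_apply] at this
  exact this

/-- The energy at `0` of the normalized Jacobi polynomials is comparable to the squared
frequency. -/
lemma energy_zero_comparable {α β : ℝ} (hα : -1 < α) (hβ : -1 < β) :
    ∃ (K : ℝ) (n₀ : ℕ), 1 ≤ K ∧ ∀ (J : JacobiSystem α β) (n : ℕ), n₀ ≤ n →
      jacobiFreq α β n ^ 2 ≤ K * jacobiEnergy (jacobiFreq α β n) (J.P n) 0 ∧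
      jacobiEnergy (jacobiFreq α β n) (J.P n) 0 ≤ K * jacobiFreq α β n ^ 2 := by
  obtain ⟨K₁, N₁, hK₁, h₁⟩ := energy_le_mass α β
  obtain ⟨K₂, N₂, hK₂, h₂⟩ := sq_mul_weight_le α β hα hβ
  obtain ⟨K₃, hK₃, h₃⟩ := exists_jacobiWeight_bounds α β (r := 1 / 2) (by norm_num) (by norm_num)
  set a := min α (-1 / 2) with ha
  set b := min β (-1 / 2) with hb
  have ha1 : -1 < a := lt_min hα (by norm_num)
  have hb1 : -1 < b := lt_min hβ (by norm_num)
  set I := ∫ t in Ioo (-1 : ℝ) 1, jacobiWeight a b t with hI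
  have hI0 : 0 ≤ I := setIntegral_nonneg measurableSet_Ioo fun t ht => (jacobiWeight_pos a b ht).le
  obtain ⟨n₀, hn₀⟩ := exists_nat_ge (max (4 * jacobiBound α β) (2 * max N₁ N₂))
  refine ⟨1 + K₁ * K₃ + K₂ * I, n₀, by
    nlinarith [mul_pos hK₁ (zero_lt_one.trans_le hK₃), mul_nonneg hK₂.le hI0], ?_⟩
  intro J n hn
  have hn' : max (4 * jacobiBound α β) (2 * max N₁ N₂) ≤ n := hn₀.trans (Nat.cast_le.2 hn)
  have hnB : 4 * jacobiBound α β ≤ n := (le_max_left _ _).trans hn'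
  have hN := half_le_jacobiFreq hnB
  have hNN : max N₁ N₂ ≤ jacobiFreq α β n := by
    linarith [le_max_right (4 * jacobiBound α β) (2 * max N₁ N₂)]
  have hODE := J.jacobiODE_freq hα hβ hnB
  set N := jacobiFreq α β n with hNdef
  set E := jacobiEnergy N (J.P n) 0 with hE
  have hE0 : 0 ≤ E := jacobiEnergy_nonneg N _ (by norm_num)
  have hsq := J.jacobiIntegral_sq hα hβ n
  have hInt := integrableOn_eval_mul_jacobiWeight hα hβ (J.P n ^ 2)
  constructor
  · have key : N ^ 2 * (∫ t in Ioo (-1 : ℝ) 1, (J.P n ^ 2).eval t * jacobiWeight α β t) ≤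
        K₂ * E * I := by
      rw [← integral_const_mul, hI, ← integral_const_mul]
      refine setIntegral_mono_on (hInt.const_mul _)
        ((integrableOn_jacobiWeight ha1 hb1).const_mul _) measurableSet_Ioo fun t ht => ?_
      have := h₂ N ((le_max_right _ _).trans hNN) _ hODE t ht
      rw [eval_pow, ← mul_assoc]
      exact this
    rw [hsq, mul_one] at key
    have : 0 ≤ (1 + K₁ * K₃) * E := by positivity
    linarith
  · have key : ∫ t in (-(1 / 2) : ℝ)..(1 / 2), (J.P n).eval t ^ 2 ≤ K₃ := by
      rw [intervalIntegral.integral_of_le (by norm_num)]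
      calc _ ≤ ∫ t in Ioc (-(1 / 2) : ℝ) (1 / 2),
              K₃ * ((J.P n ^ 2).eval t * jacobiWeight α β t) := by
            refine setIntegral_mono_on ?_ ?_ measurableSet_Ioc fun t ht => ?_
            · exact ((J.P n).continuous.pow 2).integrableOn_Ioc
            · exact (hInt.mono_set fun t ht => ⟨by linarith [ht.1], by linarith [ht.2]⟩).const_mul _
            · have := (h₃ t ⟨ht.1.le, ht.2⟩).2
              rw [eval_pow]
              nlinarith [sq_nonneg ((J.P n).eval t)]
        _ = K₃ * ∫ t in Ioc (-(1 / 2) : ℝ) (1 / 2),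
              (J.P n ^ 2).eval t * jacobiWeight α β t := integral_const_mul _ _
        _ ≤ K₃ * ∫ t in Ioo (-1 : ℝ) 1, (J.P n ^ 2).eval t * jacobiWeight α β t := by
            refine mul_le_mul_of_nonneg_left (setIntegral_mono_set hInt ?_ ?_) (by linarith)
            · refine (ae_restrict_iff' measurableSet_Ioo).2 (Eventually.of_forall fun t ht => ?_)
              simp only [eval_pow, Pi.zero_apply]
              exact mul_nonneg (sq_nonneg _) (jacobiWeight_pos α β ht).le
            · refine Eventually.of_forall fun t ht => ?_
              have ht : t ∈ Ioc (-(1 / 2) : ℝ) (1 / 2) := ht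
              exact (⟨by linarith [ht.1], by linarith [ht.2]⟩ : t ∈ Ioo (-1 : ℝ) 1)
        _ = K₃ := by rw [hsq, mul_one]
    have h := h₁ N ((le_max_left _ _).trans hNN) _ hODE
    calc E ≤ K₁ * (N ^ 2 * K₃) := h.trans (by gcongr)
      _ = K₁ * K₃ * N ^ 2 := by ring
      _ ≤ _ := by nlinarith [mul_nonneg (mul_nonneg hK₂.le hI0) (sq_nonneg N), sq_nonneg N]

namespace JacobiZeros

variable {α β : ℝ} {J : JacobiSystem α β} (Z : JacobiZeros J)

lemma exists_eq_of_isRoot {n : ℕ} {t : ℝ} (ht : (J.P n).eval t = 0) : ∃ j, Z.z n j = t := by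
  by_contra! h
  have hinj := (Z.strictAnti n).injective
  have hcard := card_le_degree_of_subset_roots (p := J.P n)
    (Z := insert t (Finset.univ.image (Z.z n))) (by
      intro x hx
      rw [mem_roots (J.ne_zero n), IsRoot.def]
      have hx : x ∈ insert t (Finset.univ.image (Z.z n)) := hx
      rcases Finset.mem_insert.1 hx with rfl | hx
      · exact ht
      · obtain ⟨j, -, rfl⟩ := Finset.mem_image.1 hx
        exact Z.isZero n j)
  rw [J.natDegree_eq, Finset.card_insert_of_notMem (by simpa using h),
    Finset.card_image_of_injective _ hinj, Finset.card_univ, Fintype.card_fin] at hcard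
  omega

/-- Two-sided bounds for the angles of the zeros. -/
lemma angle_bounds (hα : -1 < α) (hβ : -1 < β) :
    ∃ (d D : ℝ) (n₀ : ℕ), 0 < d ∧ 0 < D ∧ ∀ (J : JacobiSystem α β) (Z : JacobiZeros J) (n : ℕ),
      n₀ ≤ n → ∀ j : Fin n,
        ((j : ℕ) + 1) * d ≤ jacobiFreq α β n * Real.arccos (Z.z n j) ∧
        jacobiFreq α β n * Real.arccos (Z.z n j) ≤ D * ((j : ℕ) + 1) ∧
        ((n : ℝ) - (j : ℕ)) * d ≤ jacobiFreq α β n * (Real.pi - Real.arccos (Z.z n j)) ∧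
        min (α + 1) (β + 1) / 4 ≤ jacobiFreq α β n ^ 2 * (1 - Z.z n j ^ 2) := by
  set c := √(min (α + 1) (β + 1) / 4) with hc
  have hm : 0 < min (α + 1) (β + 1) := lt_min (by linarith) (by linarith)
  have hc0 : 0 < c := Real.sqrt_pos.2 (by linarith)
  obtain ⟨ε, hε, hgap⟩ := root_gap_lower α β c hc0
  obtain ⟨K, m₀, hK, hE⟩ := energy_zero_comparable hα hβ
  have hB := jacobiBound_pos α β
  obtain ⟨n₁, hn₁⟩ := exists_nat_ge (max (4 * jacobiBound α β) (α + β + 2))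
  refine ⟨min ε c, 2 * Real.pi * (jacobiBound α β + 2), max m₀ (max 1 n₁), lt_min hε hc0,
    by positivity, ?_⟩
  intro J Z n hn j
  have hn1 : max (4 * jacobiBound α β) (α + β + 2) ≤ n :=
    hn₁.trans (Nat.cast_le.2 ((le_max_right _ _).trans ((le_max_right _ _).trans hn)))
  have hnB : 4 * jacobiBound α β ≤ n := (le_max_left _ _).trans hn1
  have hnα : α + β + 2 ≤ n := (le_max_right _ _).trans hn1
  have hn1 : (1 : ℝ) ≤ n := by
    exact_mod_cast (le_max_left 1 n₁).trans ((le_max_right _ _).trans hn)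
  have hN := half_le_jacobiFreq hnB
  have hODE := J.jacobiODE_freq hα hβ hnB
  have hEn := (hE J n ((le_max_left _ _).trans hn)).1
  set N := jacobiFreq α β n with hNdef
  have hN0 : 0 < N := by linarith
  have hN2 : α + β + 2 ≤ 4 * N ^ 2 := by nlinarith
  have hE0 : 0 < jacobiEnergy N (J.P n) 0 := by
    by_contra! h
    nlinarith [pow_pos hN0 2]
  set θ : Fin n → ℝ := fun j => Real.arccos (Z.z n j) with hθ
  have hmem : ∀ j, θ j ∈ Icc 0 Real.pi := fun j => ⟨Real.arccos_nonneg _, Real.arccos_le_pi _⟩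
  have hcos : ∀ j, Real.cos (θ j) = Z.z n j := fun j =>
    Real.cos_arccos (Z.mem n j).1.le (Z.mem n j).2.le
  have hroot : ∀ j, (J.P n).eval (Real.cos (θ j)) = 0 := fun j => by rw [hcos]; exact Z.isZero n j
  have hmono : StrictMono θ := fun i j hij => Real.strictAntiOn_arccos
    ⟨(Z.mem n j).1.le, (Z.mem n j).2.le⟩ ⟨(Z.mem n i).1.le, (Z.mem n i).2.le⟩
    (Z.strictAnti n hij)
  have hsin : ∀ j, c ≤ N * Real.sin (θ j) := fun j =>
    hODE.le_mul_sin_of_isRoot hα hβ hN0 hN2 (J.ne_zero n) (hmem j) (hroot j)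
  have hg : ∀ i j, i < j → min ε c ≤ N * θ j - N * θ i := fun i j hij => by
    have := hgap N (by linarith) _ hODE hE0 (θ i) (θ j) (hmem i).1 (hmono hij) (hmem j).2
      (hsin i) (hsin j) (hroot i) (hroot j)
    rw [← mul_sub]
    exact (min_le_left _ _).trans this
  refine ⟨?_, ?_, ?_, ?_⟩
  · refine succ_mul_le_of_gap (φ := fun j => N * θ j) (fun j => ?_) hg j
    exact (min_le_right _ _).trans ((hsin j).trans
      (mul_le_mul_of_nonneg_left (Real.sin_le (hmem j).1) hN0.le))
  · refine hODE.root_le hN0 hmono (fun j => (hmem j).2) (fun x hx h => ?_) j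
    obtain ⟨k, hk⟩ := Z.exists_eq_of_isRoot h
    exact ⟨k, by rw [hθ]; simp only [hk]; exact Real.arccos_cos hx.1.le hx.2.le⟩
  · have := succ_mul_le_of_gap (φ := fun j => N * (Real.pi - θ j.rev)) (d := min ε c)
      (fun j => ?_) (fun i j hij => ?_) j.rev
    · simp only [Fin.rev_rev, Fin.val_rev] at this
      rw [Nat.cast_sub (by omega)] at this
      push_cast at this
      convert this using 2
      ring
    · refine (min_le_right _ _).trans ((hsin j.rev).trans
        (mul_le_mul_of_nonneg_left ?_ hN0.le))
      rw [← Real.sin_pi_sub]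
      exact Real.sin_le (by linarith [(hmem j.rev).2])
    · have := hg j.rev i.rev (Fin.rev_lt_rev.2 hij)
      linarith
  · have := pow_le_pow_left₀ hc0.le (hsin j) 2
    rwa [mul_pow, hc, Real.sq_sqrt (by linarith), Real.sin_sq, hcos] at this

end JacobiZeros

lemma sq_le_pi_sq_mul_one_sub_cos {x : ℝ} (hx : |x| ≤ Real.pi) :
    x ^ 2 ≤ Real.pi ^ 2 * (1 - Real.cos x) := by
  have h := Real.cos_le_one_sub_mul_cos_sq hx
  have hp := Real.pi_pos
  have h2 : 2 / Real.pi ^ 2 * x ^ 2 ≤ 1 - Real.cos x := by linarith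
  have h3 := mul_le_mul_of_nonneg_left h2 (sq_nonneg Real.pi)
  rw [← mul_assoc, mul_div_cancel₀ _ (pow_ne_zero 2 hp.ne')] at h3
  nlinarith [sq_nonneg x]

lemma rpow_le_of_comparable {u v K : ℝ} (hu : 0 < u) (hv : 0 < v) (hK : 0 < K) (huv : u ≤ K * v)
    (hvu : v ≤ K * u) (e : ℝ) : u ^ e ≤ K ^ |e| * v ^ e := by
  rcases le_total 0 e with h | h
  · rw [abs_of_nonneg h, ← Real.mul_rpow hK.le hv.le]
    exact Real.rpow_le_rpow hu.le huv h
  · calc u ^ e = K ^ (-e) * (K * u) ^ e := by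
          rw [Real.mul_rpow hK.le hu.le, ← mul_assoc, ← Real.rpow_add hK, neg_add_cancel,
            Real.rpow_zero, one_mul]
      _ ≤ K ^ |e| * v ^ e := by
          rw [abs_of_nonpos h]
          exact mul_le_mul_of_nonneg_left (Real.rpow_le_rpow_of_nonpos hv hvu h) (by positivity)

namespace JacobiZeros

variable {α β : ℝ}

/-- Location of the first three quarters of the zeros. -/
lemma location (hα : -1 < α) (hβ : -1 < β) :
    ∃ (K : ℝ) (n₀ : ℕ), 2 ≤ K ∧ ∀ (J : JacobiSystem α β) (Z : JacobiZeros J) (n : ℕ),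
      n₀ ≤ n → ∀ i : Fin n, ((i : ℕ) + 1 : ℝ) ≤ 3 * n / 4 →
        (((i : ℕ) + 1 : ℝ) / n) ^ 2 ≤ K * (1 - Z.z n i) ∧
        1 - Z.z n i ≤ K * (((i : ℕ) + 1 : ℝ) / n) ^ 2 ∧
        1 ≤ K * (1 + Z.z n i) := by
  obtain ⟨d, D, n₀, hd, hD, h⟩ := angle_bounds hα hβ
  obtain ⟨n₁, hn₁⟩ := exists_nat_ge (4 * jacobiBound α β)
  refine ⟨2 + 2 * D ^ 2 + 64 * Real.pi ^ 2 / d ^ 2, max n₀ n₁,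
    by nlinarith [sq_nonneg D, show 0 ≤ 64 * Real.pi ^ 2 / d ^ 2 by positivity], ?_⟩
  intro J Z n hn i hi
  have hnB : 4 * jacobiBound α β ≤ n := hn₁.trans (Nat.cast_le.2 ((le_max_right _ _).trans hn))
  obtain ⟨h1, h2, h3, -⟩ := h J Z n ((le_max_left _ _).trans hn) i
  have hN := half_le_jacobiFreq hnB
  have hN' := jacobiFreq_le_two_mul hnB
  set N := jacobiFreq α β n
  have hn0 : (0 : ℝ) < n := by have := jacobiBound_pos α β; linarith
  set x : ℝ := ((i : ℕ) + 1 : ℝ) / n with hx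
  have hx0 : 0 < x := by positivity
  have hxn : ((i : ℕ) + 1 : ℝ) = x * n := by rw [hx]; field_simp
  set θ := Real.arccos (Z.z n i) with hθ
  have hcos : Real.cos θ = Z.z n i := Real.cos_arccos (Z.mem n i).1.le (Z.mem n i).2.le
  have hθ0 : 0 ≤ θ := Real.arccos_nonneg _
  have hθπ : θ ≤ Real.pi := Real.arccos_le_pi _
  rw [hxn] at h1 h2
  have b1 : x * d ≤ 2 * θ := by
    refine le_of_mul_le_mul_right ?_ hn0
    nlinarith [mul_le_mul_of_nonneg_right hN' hθ0]
  have b2 : θ ≤ 2 * D * x := by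
    refine le_of_mul_le_mul_right ?_ hn0
    nlinarith [mul_le_mul_of_nonneg_right hN hθ0]
  have b3 : d ≤ 8 * (Real.pi - θ) := by
    refine le_of_mul_le_mul_right ?_ hn0
    nlinarith [mul_le_mul_of_nonneg_right hN' (sub_nonneg.2 hθπ)]
  have c1 : 1 - Z.z n i ≤ θ ^ 2 / 2 := by
    rw [← hcos]; linarith [Real.one_sub_sq_div_two_le_cos (x := θ)]
  have c2 : θ ^ 2 ≤ Real.pi ^ 2 * (1 - Z.z n i) := by
    rw [← hcos]; exact sq_le_pi_sq_mul_one_sub_cos (by rw [abs_of_nonneg hθ0]; exact hθπ)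
  have c3 : (Real.pi - θ) ^ 2 ≤ Real.pi ^ 2 * (1 + Z.z n i) := by
    have := sq_le_pi_sq_mul_one_sub_cos (x := Real.pi - θ)
      (by rw [abs_of_nonneg (by linarith)]; linarith)
    rwa [Real.cos_pi_sub, hcos, sub_neg_eq_add] at this
  have hu : 0 ≤ 1 - Z.z n i := by linarith [(Z.mem n i).2]
  have hv : 0 ≤ 1 + Z.z n i := by linarith [(Z.mem n i).1]
  have e1 : 0 ≤ 64 * Real.pi ^ 2 / d ^ 2 := by positivity
  set R := 64 * Real.pi ^ 2 / d ^ 2 with hR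
  have hD2 := sq_nonneg D
  refine ⟨?_, ?_, ?_⟩
  · have : x ^ 2 * d ^ 2 ≤ 4 * Real.pi ^ 2 * (1 - Z.z n i) := by
      have := pow_le_pow_left₀ (by positivity) b1 2
      rw [mul_pow, mul_pow] at this
      linarith
    have h5 : x ^ 2 ≤ R * (1 - Z.z n i) := by
      rw [hR, div_mul_eq_mul_div, le_div_iff₀ (by positivity)]
      linarith [mul_nonneg (sq_nonneg Real.pi) hu]
    exact h5.trans (mul_le_mul_of_nonneg_right (by linarith) hu)
  · have := pow_le_pow_left₀ hθ0 b2 2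
    rw [mul_pow, mul_pow] at this
    have h5 : 1 - Z.z n i ≤ 2 * D ^ 2 * x ^ 2 := by linarith
    exact h5.trans (mul_le_mul_of_nonneg_right (by linarith) (sq_nonneg x))
  · have : d ^ 2 ≤ 64 * Real.pi ^ 2 * (1 + Z.z n i) := by
      have := pow_le_pow_left₀ hd.le b3 2
      rw [mul_pow] at this
      linarith
    have h5 : 1 ≤ R * (1 + Z.z n i) := by
      rw [hR, div_mul_eq_mul_div, le_div_iff₀ (by positivity)]
      linarith
    exact h5.trans (mul_le_mul_of_nonneg_right (by linarith) hv)

lemma jacobiWeight_add_half (α β : ℝ) {t : ℝ} (ht : t ∈ Ioo (-1 : ℝ) 1) :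
    jacobiWeight (α + 1 / 2) (β + 1 / 2) t =
      jacobiWeight (α - 1 / 2) (β - 1 / 2) t * (1 - t ^ 2) := by
  have hu : 0 < 1 - t := by linarith [ht.2]
  have hv : 0 < 1 + t := by linarith [ht.1]
  unfold jacobiWeight
  rw [show α + 1 / 2 = α - 1 / 2 + 1 by ring, show β + 1 / 2 = β - 1 / 2 + 1 by ring,
    Real.rpow_add_one hu.ne', Real.rpow_add_one hv.ne']
  ring

/-- The values of `P (n + 1)` at the zeros of `P n`, up to the ratio of leading coefficients. -/
lemma sq_eval_succ_comparable (hα : -1 < α) (hβ : -1 < β) :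
    ∃ (K : ℝ) (n₀ : ℕ), 1 ≤ K ∧ ∀ (J : JacobiSystem α β) (Z : JacobiZeros J) (n : ℕ),
      n₀ ≤ n → ∀ j : Fin n,
        (J.P (n + 1)).coeff (n + 1) ^ 2 ≤ K * ((J.P (n + 1)).eval (Z.z n j) ^ 2 *
          jacobiWeight (α - 1 / 2) (β - 1 / 2) (Z.z n j) * (J.P n).coeff n ^ 2) ∧
        (J.P (n + 1)).eval (Z.z n j) ^ 2 * jacobiWeight (α - 1 / 2) (β - 1 / 2) (Z.z n j) *
          (J.P n).coeff n ^ 2 ≤ K * (J.P (n + 1)).coeff (n + 1) ^ 2 := by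
  obtain ⟨d, D, n₀, -, -, h⟩ := angle_bounds hα hβ
  obtain ⟨K₂, n₂, hK₂, hE⟩ := energy_zero_comparable hα hβ
  have hm : 0 < min (α + 1) (β + 1) := lt_min (by linarith) (by linarith)
  obtain ⟨K₁, hK₁, hW⟩ := weight_energy_comparable α β (min (α + 1) (β + 1) / 4) (by linarith)
  obtain ⟨n₁, hn₁⟩ := exists_nat_ge (4 * jacobiBound α β)
  have hK12 : 1 ≤ K₁ * K₂ := one_le_mul_of_one_le_of_one_le hK₁ hK₂
  refine ⟨64 * (K₁ * K₂), max n₀ (max n₁ n₂), by linarith, ?_⟩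
  intro J Z n hn j
  have hnB : 4 * jacobiBound α β ≤ n :=
    hn₁.trans (Nat.cast_le.2 ((le_max_left _ _).trans ((le_max_right _ _).trans hn)))
  obtain ⟨-, -, -, h4⟩ := h J Z n ((le_max_left _ _).trans hn) j
  obtain ⟨hE1, hE2⟩ := hE J n ((le_max_right _ _).trans ((le_max_right _ _).trans hn))
  have hN := half_le_jacobiFreq hnB
  have hN' := jacobiFreq_le_two_mul hnB
  have hODE := J.jacobiODE_freq hα hβ hnB
  have hB := jacobiBound_pos α β
  set N := jacobiFreq α β n
  obtain ⟨hW1, hW2⟩ := hW N (by linarith) _ hODE (Z.z n j) (Ioo_subset_Icc_self (Z.mem n j)) h4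
  have hrel := J.derivative_eval_of_isRoot hα hβ n (Z.isZero n j)
  rw [jacobiWeight_add_half α β (Z.mem n j)] at hW1 hW2
  have hw := jacobiWeight_pos (α - 1 / 2) (β - 1 / 2) (Z.mem n j)
  set w := jacobiWeight (α - 1 / 2) (β - 1 / 2) (Z.z n j)
  set t := Z.z n j with ht
  have hEt : jacobiEnergy N (J.P n) t = (1 - t ^ 2) * (derivative (J.P n)).eval t ^ 2 := by
    unfold jacobiEnergy
    rw [Z.isZero n j]; ring
  set F := w * (1 - t ^ 2) * jacobiEnergy N (J.P n) t with hF
  set b := (J.P (n + 1)).coeff (n + 1)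
  set a := (J.P n).coeff n
  set p := (J.P (n + 1)).eval t
  set κ : ℝ := 2 * n + α + β + 1 with hκ
  have hkey : κ ^ 2 * (p ^ 2 * w * a ^ 2) = F * b ^ 2 := by
    rw [hF, hEt]
    linear_combination (-w) * congrArg (fun r => r ^ 2) hrel
  have habs := abs_le.1 (abs_add_add_one_le_jacobiBound α β)
  have hn0 : (0 : ℝ) < n := by linarith
  have hκ1 : n ≤ κ := by rw [hκ]; linarith [habs.1]
  have hκ2 : κ ≤ 4 * n := by rw [hκ]; linarith [habs.2]
  have hκN : κ ^ 2 ≤ 64 * N ^ 2 := by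
    have := pow_le_pow_left₀ (by linarith) (show κ ≤ 8 * N by linarith) 2
    rw [mul_pow] at this
    linarith
  have hNκ : N ^ 2 ≤ 4 * κ ^ 2 := by
    have := pow_le_pow_left₀ (by linarith) (show N ≤ 2 * κ by linarith) 2
    rw [mul_pow] at this
    linarith
  have hN0 : 0 < N ^ 2 := pow_pos (by linarith) 2
  have hκ0 : 0 < κ ^ 2 := pow_pos (by linarith) 2
  have hF1 : F ≤ K₁ * K₂ * N ^ 2 := by
    rw [mul_assoc]
    exact hW1.trans (mul_le_mul_of_nonneg_left hE2 (by linarith))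
  have hF2 : N ^ 2 ≤ K₁ * K₂ * F := by
    rw [mul_comm K₁, mul_assoc]
    exact hE1.trans (mul_le_mul_of_nonneg_left hW2 (by linarith))
  constructor
  · refine le_of_mul_le_mul_left ?_ hN0
    calc N ^ 2 * b ^ 2 ≤ K₁ * K₂ * F * b ^ 2 := by gcongr
      _ = K₁ * K₂ * (κ ^ 2 * (p ^ 2 * w * a ^ 2)) := by rw [hkey]; ring
      _ ≤ K₁ * K₂ * (64 * N ^ 2 * (p ^ 2 * w * a ^ 2)) := by gcongr
      _ = _ := by ring
  · refine le_of_mul_le_mul_left ?_ hκ0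
    rw [hkey]
    calc F * b ^ 2 ≤ K₁ * K₂ * N ^ 2 * b ^ 2 := by gcongr
      _ ≤ K₁ * K₂ * (4 * κ ^ 2) * b ^ 2 := by gcongr
      _ ≤ _ := by linarith [mul_nonneg (mul_nonneg (zero_le_one.trans hK12) hκ0.le) (sq_nonneg b)]

/-- The ratio of consecutive leading coefficients is bounded. -/
lemma sq_coeff_succ_le (hα : -1 < α) (hβ : -1 < β) :
    ∃ (K : ℝ) (n₀ : ℕ), 1 ≤ K ∧ ∀ (J : JacobiSystem α β), JacobiZeros J → ∀ n : ℕ,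
      n₀ ≤ n → (J.P (n + 1)).coeff (n + 1) ^ 2 ≤ K * (J.P n).coeff n ^ 2 := by
  obtain ⟨K₀, m₀, hK₀, h₀⟩ := location hα hβ
  obtain ⟨d, D, n₀, -, -, h⟩ := angle_bounds hα hβ
  obtain ⟨K₂, n₂, hK₂, hE⟩ := energy_zero_comparable hα hβ
  have hm : 0 < min (α + 1) (β + 1) := lt_min (by linarith) (by linarith)
  obtain ⟨K₁, hK₁, hW⟩ := weight_energy_comparable α β (min (α + 1) (β + 1) / 4) (by linarith)
  obtain ⟨K, n₃, hK, hp⟩ := sq_eval_succ_comparable hα hβ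
  obtain ⟨n₁, hn₁⟩ := exists_nat_ge (4 * jacobiBound α β)
  have hK12 : 1 ≤ K₁ * K₂ := one_le_mul_of_one_le_of_one_le hK₁ hK₂
  refine ⟨4 * K₀ ^ 2 * (K * (K₁ * K₂)), m₀ + n₀ + n₁ + n₂ + n₃ + 4, ?_, ?_⟩
  · have : 1 ≤ K * (K₁ * K₂) := one_le_mul_of_one_le_of_one_le hK hK12
    nlinarith
  intro J Z n hn
  have hnB : 4 * jacobiBound α β ≤ n := hn₁.trans (Nat.cast_le.2 (by omega))
  have hnB' : 4 * jacobiBound α β ≤ (n + 1 : ℕ) := hn₁.trans (Nat.cast_le.2 (by omega))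
  set j : Fin n := ⟨n / 2, by omega⟩ with hj
  have hj1 : ((j : ℕ) + 1 : ℝ) ≤ 3 * n / 4 := by
    have : 4 * (n / 2 + 1) ≤ 3 * n := by omega
    have : (4 : ℝ) * ((n / 2 : ℕ) + 1) ≤ 3 * n := by exact_mod_cast this
    rw [hj]
    linarith
  have hj2 : (n : ℝ) / 2 ≤ (j : ℕ) + 1 := by
    have : n ≤ 2 * (n / 2 + 1) := by omega
    have : (n : ℝ) ≤ 2 * ((n / 2 : ℕ) + 1) := by exact_mod_cast this
    rw [hj]
    linarith
  obtain ⟨hl1, -, hl2⟩ := h₀ J Z n (by omega) j hj1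
  obtain ⟨-, -, -, h4⟩ := h J Z n (by omega) j
  obtain ⟨-, hE2⟩ := hE J (n + 1) (by omega)
  have hp1 := (hp J Z n (by omega) j).1
  have hB := jacobiBound_pos α β
  have hN := half_le_jacobiFreq hnB
  have hNN := jacobiFreq_le_succ hnB
  have hN' := half_le_jacobiFreq hnB'
  have hODE := J.jacobiODE_freq hα hβ hnB'
  have hmem := Z.mem n j
  set t := Z.z n j
  set N := jacobiFreq α β (n + 1)
  have hn0 : (0 : ℝ) < n := by linarith
  have hN0 : 0 < N := by linarith
  have ht0 : 0 < 1 - t ^ 2 := by nlinarith [hmem.1, hmem.2]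
  have h5 : min (α + 1) (β + 1) / 4 ≤ N ^ 2 * (1 - t ^ 2) := by
    refine h4.trans ?_
    gcongr
    linarith
  have hW1 := (hW N (by push_cast at hnB'; linarith) _ hODE t (Ioo_subset_Icc_self hmem) h5).1
  rw [jacobiWeight_add_half α β hmem] at hW1
  have hw := jacobiWeight_pos (α - 1 / 2) (β - 1 / 2) hmem
  set w := jacobiWeight (α - 1 / 2) (β - 1 / 2) t
  set b := (J.P (n + 1)).coeff (n + 1)
  set a := (J.P n).coeff n
  set p := (J.P (n + 1)).eval t with hpdef
  have hEp : N ^ 2 * p ^ 2 ≤ jacobiEnergy N (J.P (n + 1)) t := by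
    unfold jacobiEnergy
    nlinarith [mul_nonneg ht0.le (sq_nonneg ((derivative (J.P (n + 1))).eval t))]
  have hpw : w * (1 - t ^ 2) * p ^ 2 ≤ K₁ * K₂ := by
    refine le_of_mul_le_mul_left ?_ (pow_pos hN0 2)
    calc N ^ 2 * (w * (1 - t ^ 2) * p ^ 2) = w * (1 - t ^ 2) * (N ^ 2 * p ^ 2) := by ring
      _ ≤ w * (1 - t ^ 2) * jacobiEnergy N (J.P (n + 1)) t := by gcongr
      _ ≤ K₁ * (K₂ * N ^ 2) := hW1.trans (by gcongr)
      _ = _ := by ring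
  have ht1 : 1 ≤ 4 * K₀ ^ 2 * (1 - t ^ 2) := by
    have hx : (1 / 2 : ℝ) ≤ ((j : ℕ) + 1 : ℝ) / n := by
      rw [le_div_iff₀ hn0]; linarith
    have h6 : (1 / 2) ^ 2 ≤ K₀ * (1 - t) := (pow_le_pow_left₀ (by norm_num) hx 2).trans hl1
    have := mul_le_mul h6 hl2 zero_le_one ((by norm_num : (0 : ℝ) ≤ (1 / 2) ^ 2).trans h6)
    linarith
  calc b ^ 2 ≤ 4 * K₀ ^ 2 * (1 - t ^ 2) * b ^ 2 := le_mul_of_one_le_left (sq_nonneg b) ht1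
    _ ≤ 4 * K₀ ^ 2 * (1 - t ^ 2) * (K * (p ^ 2 * w * a ^ 2)) := by gcongr
    _ = 4 * K₀ ^ 2 * (K * (w * (1 - t ^ 2) * p ^ 2)) * a ^ 2 := by ring
    _ ≤ _ := by gcongr

end JacobiZeros

/-- Asymptotics used in the proof of Theorem 1: `|p_{n+1}^{(α,β)}(t_i^n)| ∼ (n/i)^{α-1/2}`
uniformly for `1 ≤ i ≤ 3n/4`, where `t_i^n` is the `i`-th zero of `p_n^{(α,β)}`
(in decreasing order). -/
theorem jacobi_eval_at_zeros_asymptotics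
    (α β : ℝ) (hα : -1 < α) (hβ : -1 < β)
    (J : JacobiSystem α β) (Z : JacobiZeros J) :
    ∃ (c C : ℝ) (n₀ : ℕ), 0 < c ∧ c ≤ C ∧
      ∀ n : ℕ, n₀ ≤ n → ∀ i : Fin n, ((i : ℕ) + 1 : ℝ) ≤ 3 * n / 4 →
        c * ((n : ℝ) / ((i : ℕ) + 1)) ^ (α - 1 / 2)
            ≤ |(J.P (n + 1)).eval (Z.z n i)| ∧
          |(J.P (n + 1)).eval (Z.z n i)|
            ≤ C * ((n : ℝ) / ((i : ℕ) + 1)) ^ (α - 1 / 2) := by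
  obtain ⟨K₀, n₀, hK₀, h₀⟩ := JacobiZeros.location hα hβ
  obtain ⟨K₁, n₁, hK₁, h₁⟩ := JacobiZeros.sq_eval_succ_comparable hα hβ
  obtain ⟨K₂, n₂, hK₂, h₂⟩ := JacobiZeros.sq_coeff_succ_le hα hβ
  set L : ℝ := K₀ ^ |α - 1 / 2| * K₀ ^ |β - 1 / 2| with hL
  have hL1 : 1 ≤ L := one_le_mul_of_one_le_of_one_le
    (Real.one_le_rpow (by linarith) (abs_nonneg _)) (Real.one_le_rpow (by linarith) (abs_nonneg _))
  set A : ℝ := L * (K₁ * K₂) with hA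
  have hA1 : 1 ≤ A := one_le_mul_of_one_le_of_one_le hL1 (one_le_mul_of_one_le_of_one_le hK₁ hK₂)
  have hA0 : 0 < A := by linarith
  refine ⟨A⁻¹, A, n₀ + n₁ + n₂, inv_pos.2 hA0, (inv_le_one_of_one_le₀ hA1).trans hA1, ?_⟩
  intro n hn i hi
  obtain ⟨hl1, hl2, hl3⟩ := h₀ J Z n (by omega) i hi
  obtain ⟨hp1, hp2⟩ := h₁ J Z n (by omega) i
  have hb := h₂ J Z n (by omega)
  have ha : 0 < (J.P n).coeff n ^ 2 := pow_pos (J.coeff_pos n) 2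
  have hab : (J.P n).coeff n ^ 2 ≤ (J.P (n + 1)).coeff (n + 1) ^ 2 :=
    pow_le_pow_left₀ (J.coeff_pos n).le (J.coeff_le_coeff_succ hα hβ n) 2
  have hn0 : (0 : ℝ) < n := by exact_mod_cast i.pos
  have hmem := Z.mem n i
  have hu : 0 < 1 - Z.z n i := by linarith [hmem.2]
  have hv : 0 < 1 + Z.z n i := by linarith [hmem.1]
  set x : ℝ := ((i : ℕ) + 1 : ℝ) / n with hx
  have hx0 : 0 < x := by positivity
  rw [← inv_div ((i : ℕ) + 1 : ℝ) (n : ℝ), ← hx, Real.inv_rpow hx0.le]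
  have hx2 : (x ^ 2) ^ (α - 1 / 2) = (x ^ (α - 1 / 2)) ^ 2 := by
    rw [← Real.rpow_natCast, ← Real.rpow_natCast, ← Real.rpow_mul hx0.le, ← Real.rpow_mul hx0.le,
      mul_comm]
  have hK₀0 : 0 < K₀ := by linarith
  have hv1 : 1 + Z.z n i ≤ K₀ * 1 := by linarith [hmem.2]
  have hw1 : jacobiWeight (α - 1 / 2) (β - 1 / 2) (Z.z n i) ≤ L * (x ^ (α - 1 / 2)) ^ 2 := by
    have e1 := rpow_le_of_comparable hu (pow_pos hx0 2) hK₀0 hl2 hl1 (α - 1 / 2)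
    have e2 := rpow_le_of_comparable hv zero_lt_one hK₀0 hv1 hl3 (β - 1 / 2)
    rw [Real.one_rpow, mul_one] at e2
    rw [hx2] at e1
    refine (mul_le_mul e1 e2 (by positivity) (by positivity)).trans_eq ?_
    rw [hL]; ring
  have hw2 : (x ^ (α - 1 / 2)) ^ 2 ≤ L * jacobiWeight (α - 1 / 2) (β - 1 / 2) (Z.z n i) := by
    have e1 := rpow_le_of_comparable (pow_pos hx0 2) hu hK₀0 hl1 hl2 (α - 1 / 2)
    have e2 := rpow_le_of_comparable zero_lt_one hv hK₀0 hl3 hv1 (β - 1 / 2)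
    rw [Real.one_rpow] at e2
    rw [hx2] at e1
    calc _ = (x ^ (α - 1 / 2)) ^ 2 * 1 := (mul_one _).symm
      _ ≤ _ := mul_le_mul e1 e2 zero_le_one (by positivity)
      _ = _ := by rw [hL, jacobiWeight]; ring
  have hw := jacobiWeight_pos (α - 1 / 2) (β - 1 / 2) hmem
  set w := jacobiWeight (α - 1 / 2) (β - 1 / 2) (Z.z n i)
  set a := (J.P n).coeff n
  set b := (J.P (n + 1)).coeff (n + 1)
  set p := (J.P (n + 1)).eval (Z.z n i)
  set y := x ^ (α - 1 / 2)
  have hy : 0 < y := Real.rpow_pos_of_pos hx0 _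
  have hpw1 : 1 ≤ K₁ * (p ^ 2 * w) := by
    refine le_of_mul_le_mul_right ?_ ha
    linarith
  have hpw2 : p ^ 2 * w ≤ K₁ * K₂ := by
    refine le_of_mul_le_mul_right ?_ ha
    nlinarith
  have hs : (|p| * y) ^ 2 = p ^ 2 * y ^ 2 := by rw [mul_pow, sq_abs]
  constructor
  · rw [← mul_inv, inv_le_iff_one_le_mul₀ (by positivity)]
    have h3 : 1 ≤ A * (|p| * y) ^ 2 := by
      rw [hs]
      calc 1 ≤ K₁ * (p ^ 2 * w) := hpw1
        _ ≤ K₁ * (p ^ 2 * (L * y ^ 2)) := by gcongr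
        _ ≤ K₁ * (p ^ 2 * (L * y ^ 2)) * K₂ := le_mul_of_one_le_right (by positivity) hK₂
        _ = _ := by rw [hA]; ring
    have h4 : 1 ≤ (A * (|p| * y)) ^ 2 := by
      rw [mul_pow, sq A, mul_assoc]
      exact one_le_mul_of_one_le_of_one_le hA1 h3
    have := (one_le_sq_iff₀ (by positivity)).1 h4
    linarith
  · rw [← div_eq_mul_inv, le_div_iff₀ hy]
    refine le_of_sq_le_sq ?_ hA0.le
    rw [hs]
    calc p ^ 2 * y ^ 2 ≤ p ^ 2 * (L * w) := by gcongr
      _ = L * (p ^ 2 * w) := by ring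
      _ ≤ A := mul_le_mul_of_nonneg_left hpw2 (by linarith)
      _ ≤ A ^ 2 := by nlinarith
end
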